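/- There exist an integer k0 and a sequence delta_k -> 0 such that for every k >= k0 and every density r with r_bal < r < 2^k * ln 2 - (3/2) * ln 2 - delta_k, writing r = 2^k * ln 2 - rho, with high probability the random pair (d, m) is such that exp((n/2^k) * (rho - (ln 2)/2 - delta_k)) <= E[Z_{p,good}(Phi_{d,m})] <= exp((n/2^k) * (rho - (ln 2)/2 + delta_k)), where the expectation is over the uniform random formula Phi_{d,m}. -/

import Mathlib

open Classical Finset Filter

noncomputable section

/-- A literal: a variable index together with a sign (`true` = positive occurrence). -/
abbrev Lit (n : ℕ) := Fin n × Bool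

/-- A clause: an ordered `k`-tuple of literals. -/
abbrev Clause (n k : ℕ) := Fin k → Lit n

/-- A `k`-CNF formula with `m` clauses over `n` variables. -/
abbrev Formula (n k m : ℕ) := Fin m → Clause n k

/-- A truth assignment. -/
abbrev Assignment (n : ℕ) := Fin n → Bool

/-- The truth value of a literal under an assignment. -/
def litVal {n : ℕ} (σ : Assignment n) (l : Lit n) : Bool :=
  if l.2 then σ l.1 else !(σ l.1)

/-- `σ` satisfies `Φ` if every clause contains at least one true literal. -/
def Satisfies {n k m : ℕ} (σ : Assignment n) (Φ : Formula n k m) : Prop :=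
  ∀ i : Fin m, ∃ j : Fin k, litVal σ (Φ i j) = true

/-- The set of satisfying assignments of `Φ`. -/
def satSet (n k m : ℕ) (Φ : Formula n k m) : Finset (Assignment n) :=
  univ.filter fun σ => Satisfies σ Φ

/-- The number of satisfying assignments of `Φ`. -/
def satCount (n k m : ℕ) (Φ : Formula n k m) : ℕ := (satSet n k m Φ).card

/-- Probability of an event under the uniformly random formula `Φ_k(n,m)`. -/
def prF (n k m : ℕ) (E : Formula n k m → Prop) : ℝ :=
  ((univ.filter fun Φ : Formula n k m => E Φ).card : ℝ) / (Fintype.card (Formula n k m) : ℝ)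

/-- Expectation of a function of the uniformly random formula `Φ_k(n,m)`. -/
def expF (n k m : ℕ) (f : Formula n k m → ℝ) : ℝ :=
  (∑ Φ : Formula n k m, f Φ) / (Fintype.card (Formula n k m) : ℝ)

/-- The number of occurrences of the literal `l` in `Φ`. -/
def occ (n k m : ℕ) (Φ : Formula n k m) (l : Lit n) : ℕ :=
  (univ.filter fun p : Fin m × Fin k => Φ p.1 p.2 = l).card

/-- The (signed) degree sequence of `Φ`. -/
def degSeq (n k m : ℕ) (Φ : Formula n k m) : Lit n → ℕ := occ n k m Φ

/-- Hamming distance between two assignments. -/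
def hdist {n : ℕ} (σ τ : Assignment n) : ℕ :=
  (univ.filter fun x => σ x ≠ τ x).card

/-- The majority-vote assignment: `x ↦ true` iff `x` occurs more often positively
than negatively. -/
def sigmaMaj (n k m : ℕ) (Φ : Formula n k m) : Assignment n :=
  fun x => decide (occ n k m Φ (x, false) < occ n k m Φ (x, true))

/-- The Belief Propagation marginal map `p_BP`. -/
def pBP (k : ℕ) (z : ℤ) : ℝ :=
  if |(z : ℝ)| ≤ 10 * Real.sqrt ((k : ℝ) * 2 ^ k * Real.log k) then
    1 / 2 + (z : ℝ) / 2 ^ (k + 1)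
  else 1 / 2

/-- The type `p_d(l)` of a literal `l` given a degree sequence `d`. -/
def pLit (k : ℕ) {n : ℕ} (d : Lit n → ℕ) (l : Lit n) : ℝ :=
  if l.2 then pBP k ((d (l.1, true) : ℤ) - (d (l.1, false) : ℤ))
  else 1 - pBP k ((d (l.1, true) : ℤ) - (d (l.1, false) : ℤ))

/-- The `p_d`-type of a clause: the `k`-tuple of the types of its literals. -/
def clauseType (k : ℕ) {n : ℕ} (d : Lit n → ℕ) (C : Clause n k) : Fin k → ℝ :=
  fun j => pLit k d (C j)

/-- The number of clauses of `Φ` of type `ℓ`. -/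
def mCount (n k m : ℕ) (d : Lit n → ℕ) (Φ : Formula n k m) (ℓ : Fin k → ℝ) : ℕ :=
  (univ.filter fun i : Fin m => clauseType k d (Φ i) = ℓ).card

/-- The clause-type count vector of a formula (with respect to its own degree sequence). -/
def typeCounts (n k m : ℕ) (Φ : Formula n k m) : (Fin k → ℝ) → ℕ :=
  mCount n k m (degSeq n k m Φ) Φ

/-- The set of formulas with degree sequence `d` and clause-type counts `mv`;
the uniform distribution on this set is the distribution of `Φ_{d,m}`. -/
def formulaClass (n k m : ℕ) (d : Lit n → ℕ) (mv : (Fin k → ℝ) → ℕ) :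
    Finset (Formula n k m) :=
  univ.filter fun Φ => degSeq n k m Φ = d ∧ ∀ ℓ : Fin k → ℝ, mCount n k m d Φ ℓ = mv ℓ

/-- Average of `f` over a finite set (expectation under the uniform distribution). -/
def expOver {α : Type*} (S : Finset α) (f : α → ℝ) : ℝ := (∑ x ∈ S, f x) / (S.card : ℝ)

/-- `σ` is `p_d`-judicious in `Φ` (with additive slack `a`): for every clause type `ℓ` and
every position `j`, the number of type-`ℓ` clauses whose `j`-th literal is true under `σ`
equals `ℓ j · m(ℓ)` up to `a`. -/
def Judicious (a : ℝ) (n k m : ℕ) (d : Lit n → ℕ) (Φ : Formula n k m)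
    (σ : Assignment n) : Prop :=
  ∀ (ℓ : Fin k → ℝ) (j : Fin k),
    |((univ.filter fun i : Fin m =>
        clauseType k d (Φ i) = ℓ ∧ litVal σ (Φ i j) = true).card : ℝ) -
      ℓ j * (mCount n k m d Φ ℓ : ℝ)| ≤ a

/-- `Z_p(Φ)`: the number of `p_d`-judicious satisfying assignments. -/
def Zp (a : ℝ) (n k m : ℕ) (d : Lit n → ℕ) (Φ : Formula n k m) : ℕ :=
  (univ.filter fun σ : Assignment n => Satisfies σ Φ ∧ Judicious a n k m d Φ σ).card

/-- The size of the cluster of `σ`: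
`C_σ(Φ) = {τ ∈ S(Φ) : dist(σ,τ)/n ∉ [1/2 - k² 2^{-k/2}, 1/2 + k² 2^{-k/2}]}`. -/
def clusterSize (n k m : ℕ) (Φ : Formula n k m) (σ : Assignment n) : ℕ :=
  (univ.filter fun τ : Assignment n => Satisfies τ Φ ∧
    ¬(1 / 2 - (k : ℝ) ^ 2 * (2 : ℝ) ^ (-(k : ℝ) / 2) ≤ (hdist σ τ : ℝ) / n ∧
      (hdist σ τ : ℝ) / n ≤ 1 / 2 + (k : ℝ) ^ 2 * (2 : ℝ) ^ (-(k : ℝ) / 2))).card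

/-- `σ` is good in `Φ` if its cluster is no larger than `E[Z_p(Φ_{d,m})]`. -/
def Good (a : ℝ) (n k m : ℕ) (d : Lit n → ℕ) (mv : (Fin k → ℝ) → ℕ)
    (Φ : Formula n k m) (σ : Assignment n) : Prop :=
  (clusterSize n k m Φ σ : ℝ) ≤
    expOver (formulaClass n k m d mv) fun Ψ => (Zp a n k m d Ψ : ℝ)

/-- `Z_{p,good}(Φ)`: the number of good `p_d`-judicious satisfying assignments. -/
def Zgood (a : ℝ) (n k m : ℕ) (d : Lit n → ℕ) (mv : (Fin k → ℝ) → ℕ)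
    (Φ : Formula n k m) : ℕ :=
  (univ.filter fun σ : Assignment n =>
    Satisfies σ Φ ∧ Judicious a n k m d Φ σ ∧ Good a n k m d mv Φ σ).card

/-- `r_bal = 2^k ln 2 - k (ln 2)/2 - (1 + (ln 2)/2)`. -/
def rbal (k : ℕ) : ℝ :=
  2 ^ k * Real.log 2 - (k : ℝ) * (Real.log 2 / 2) - (1 + Real.log 2 / 2)

section
/-! Part A: weighted product expectations -/

def PW {ι α : Type} [Fintype ι] (p : ι → α → ℝ) (w : ι → α) : ℝ := ∏ i, p i (w i)

def Ex {ι α : Type} [Fintype ι] [DecidableEq ι] [Fintype α] (p : ι → α → ℝ) (F : (ι → α) → ℝ) : ℝ :=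
  ∑ w, PW p w * F w

section A
variable {ι α : Type} [Fintype ι] [DecidableEq ι] [Fintype α]

lemma PW_nonneg {ι α : Type} [Fintype ι] {p : ι → α → ℝ} (hp : ∀ i a, 0 ≤ p i a) (w : ι → α) : 0 ≤ PW p w :=
  Finset.prod_nonneg fun i _ => hp i _

lemma sum_prod_eq (g : ι → α → ℝ) : ∑ w : ι → α, ∏ i, g i (w i) = ∏ i, ∑ a, g i a := by
  rw [Finset.prod_univ_sum]
  simp [Fintype.piFinset_univ]

lemma Ex_const {p : ι → α → ℝ} (h1 : ∀ i, ∑ a, p i a = 1) (c : ℝ) : Ex p (fun _ => c) = c := by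
  unfold Ex PW
  rw [← Finset.sum_mul, sum_prod_eq]
  simp [h1]

lemma Ex_add (p : ι → α → ℝ) (F G : (ι → α) → ℝ) :
    Ex p (fun w => F w + G w) = Ex p F + Ex p G := by
  unfold Ex; rw [← Finset.sum_add_distrib]; congr 1; ext w; ring

lemma Ex_sub (p : ι → α → ℝ) (F G : (ι → α) → ℝ) :
    Ex p (fun w => F w - G w) = Ex p F - Ex p G := by
  unfold Ex; rw [← Finset.sum_sub_distrib]; congr 1; ext w; ring

lemma Ex_mul (p : ι → α → ℝ) (c : ℝ) (F : (ι → α) → ℝ) :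
    Ex p (fun w => c * F w) = c * Ex p F := by
  unfold Ex; rw [Finset.mul_sum]; congr 1; ext w; ring

lemma Ex_sum {κ : Type} (s : Finset κ) (p : ι → α → ℝ) (F : κ → (ι → α) → ℝ) :
    Ex p (fun w => ∑ i ∈ s, F i w) = ∑ i ∈ s, Ex p (F i) := by
  unfold Ex; rw [Finset.sum_comm]; congr 1; ext w; rw [Finset.mul_sum]

lemma Ex_mono {p : ι → α → ℝ} (hp : ∀ i a, 0 ≤ p i a) {F G : (ι → α) → ℝ}
    (h : ∀ w, F w ≤ G w) : Ex p F ≤ Ex p G :=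
  Finset.sum_le_sum fun w _ => mul_le_mul_of_nonneg_left (h w) (PW_nonneg hp w)

lemma Ex_nonneg {p : ι → α → ℝ} (hp : ∀ i a, 0 ≤ p i a) {F : (ι → α) → ℝ}
    (h : ∀ w, 0 ≤ F w) : 0 ≤ Ex p F :=
  Finset.sum_nonneg fun w _ => mul_nonneg (PW_nonneg hp w) (h w)

/-- variance about any point is at least the variance. -/
lemma Ex_sq_sub {p : ι → α → ℝ} (h1 : ∀ i, ∑ a, p i a = 1) (F : (ι → α) → ℝ) (c : ℝ) :
    Ex p (fun w => (F w - c) ^ 2) = Ex p (fun w => F w ^ 2) - (Ex p F) ^ 2 + (Ex p F - c) ^ 2 := by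
  have : (fun w => (F w - c) ^ 2) = fun w => (F w ^ 2 - (2 * c) * F w) + c ^ 2 := by
    ext w; ring
  rw [this, Ex_add, Ex_sub, Ex_mul, Ex_const h1]; ring

lemma Ex_sq_le {p : ι → α → ℝ} (hp : ∀ i a, 0 ≤ p i a) (h1 : ∀ i, ∑ a, p i a = 1)
    (F : (ι → α) → ℝ) : (Ex p F) ^ 2 ≤ Ex p (fun w => F w ^ 2) := by
  have := Ex_sq_sub h1 F (Ex p F)
  have h2 : 0 ≤ Ex p (fun w => (F w - Ex p F) ^ 2) := Ex_nonneg hp fun w => sq_nonneg _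
  rw [this] at h2; nlinarith

end A

lemma Ex_succ {α : Type} [Fintype α] {n : ℕ} (p : Fin (n+1) → α → ℝ)
    (F : (Fin (n+1) → α) → ℝ) :
    Ex p F = ∑ a, p 0 a * Ex (fun i => p i.succ) (fun w => F (Fin.cons a w)) := by
  unfold Ex PW
  have h := (Fin.consEquiv (fun _ : Fin (n+1) => α)).sum_comp (fun w => (∏ i, p i (w i)) * F w)
  refine h.symm.trans ?_
  rw [Fintype.sum_prod_type]
  congr 1; ext a
  rw [Finset.mul_sum]
  congr 1; ext w
  simp [Fin.consEquiv, Fin.prod_univ_succ, mul_assoc]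

lemma efron_stein_fin {α : Type} [Fintype α] : ∀ {n : ℕ} (p : Fin n → α → ℝ)
    (_ : ∀ i a, 0 ≤ p i a) (_ : ∀ i, ∑ a, p i a = 1) (a0 : Fin n → α)
    (F : (Fin n → α) → ℝ),
    Ex p (fun w => F w ^ 2) - (Ex p F) ^ 2 ≤
      ∑ i, Ex p (fun w => (F w - F (Function.update w i (a0 i))) ^ 2) := by
  intro n
  induction n with
  | zero =>
    intro p hp h1 a0 F
    simp [Ex, PW]
  | succ n ih =>
    intro p hp h1 a0 F
    set q : Fin n → α → ℝ := fun i => p i.succ with hq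
    have hq0 : ∀ i a, 0 ≤ q i a := fun i a => hp _ _
    have hq1 : ∀ i, ∑ a, q i a = 1 := fun i => h1 _
    set G : α → ℝ := fun a => Ex q (fun w => F (Fin.cons a w)) with hG
    have e1 : Ex p F = ∑ a, p 0 a * G a := Ex_succ p F
    have e2 : Ex p (fun w => F w ^ 2) =
        ∑ a, p 0 a * Ex q (fun w => F (Fin.cons a w) ^ 2) := Ex_succ p _
    have e3 : ∀ a, Ex q (fun w => F (Fin.cons a w) ^ 2) ≤ G a ^ 2 +
        ∑ i : Fin n, Ex q (fun w => (F (Fin.cons a w) -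
          F (Fin.cons a (Function.update w i (a0 i.succ)))) ^ 2) := by
      intro a
      have := ih q hq0 hq1 (fun i => a0 i.succ) (fun w => F (Fin.cons a w))
      linarith
    have e4 : ∀ a, (G a - G (a0 0)) ^ 2 ≤
        Ex q (fun w => (F (Fin.cons a w) - F (Fin.cons (a0 0) w)) ^ 2) := by
      intro a
      have := Ex_sq_le hq0 hq1 (fun w => F (Fin.cons a w) - F (Fin.cons (a0 0) w))
      rwa [Ex_sub] at this
    have e5 : ∑ a, p 0 a * G a ^ 2 - (∑ a, p 0 a * G a) ^ 2 ≤
        ∑ a, p 0 a * (G a - G (a0 0)) ^ 2 := by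
      have : ∑ a, p 0 a * (G a - G (a0 0)) ^ 2 = ∑ a, p 0 a * G a ^ 2 -
          2 * G (a0 0) * (∑ a, p 0 a * G a) + G (a0 0) ^ 2 * ∑ a, p 0 a := by
        rw [Finset.mul_sum, Finset.mul_sum, ← Finset.sum_sub_distrib, ← Finset.sum_add_distrib]
        congr 1; ext a; ring
      rw [this, h1 0]
      nlinarith [sq_nonneg (∑ a, p 0 a * G a - G (a0 0))]
    rw [Fin.sum_univ_succ]
    have r0 : Ex p (fun w => (F w - F (Function.update w 0 (a0 0))) ^ 2) =
        ∑ a, p 0 a * Ex q (fun w => (F (Fin.cons a w) - F (Fin.cons (a0 0) w)) ^ 2) := by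
      rw [Ex_succ]; simp [Fin.update_cons_zero, hq]
    have r1 : ∀ i : Fin n, Ex p (fun w => (F w - F (Function.update w i.succ (a0 i.succ))) ^ 2) =
        ∑ a, p 0 a * Ex q (fun w => (F (Fin.cons a w) -
          F (Fin.cons a (Function.update w i (a0 i.succ)))) ^ 2) := by
      intro i
      rw [Ex_succ]
      simp only [hq, Fin.cons_update]
    rw [r0, e1, e2]
    simp_rw [r1]
    rw [Finset.sum_comm]
    simp_rw [← Finset.mul_sum]
    have s1 : ∑ a, p 0 a * Ex q (fun w => F (Fin.cons a w) ^ 2) ≤ ∑ a, (p 0 a * G a ^ 2 + p 0 a *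
        ∑ i : Fin n, Ex q (fun w => (F (Fin.cons a w) -
          F (Fin.cons a (Function.update w i (a0 i.succ)))) ^ 2)) := by
      apply Finset.sum_le_sum; intro a _
      rw [← mul_add]
      exact mul_le_mul_of_nonneg_left (e3 a) (hp _ _)
    rw [Finset.sum_add_distrib] at s1
    have s2 : ∑ a, p 0 a * (G a - G (a0 0)) ^ 2 ≤
        ∑ a, p 0 a * Ex q (fun w => (F (Fin.cons a w) - F (Fin.cons (a0 0) w)) ^ 2) :=
      Finset.sum_le_sum fun a _ => mul_le_mul_of_nonneg_left (e4 a) (hp _ _)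
    linarith

lemma Ex_equiv {ι ι' α : Type} [Fintype ι] [Fintype ι'] [DecidableEq ι] [DecidableEq ι'] [Fintype α] (e : ι' ≃ ι)
    (p : ι → α → ℝ) (F : (ι → α) → ℝ) :
    Ex p F = Ex (fun i => p (e i)) (fun w => F (fun i => w (e.symm i))) := by
  unfold Ex PW
  rw [← (Equiv.arrowCongr e (Equiv.refl α)).sum_comp]
  congr 1; ext w
  congr 1
  rw [← e.prod_comp]
  simp [Equiv.arrowCongr]

lemma efron_stein {ι α : Type} [Fintype ι] [DecidableEq ι] [Fintype α] (p : ι → α → ℝ)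
    (hp : ∀ i a, 0 ≤ p i a) (h1 : ∀ i, ∑ a, p i a = 1) (a0 : ι → α)
    (F : (ι → α) → ℝ) :
    Ex p (fun w => F w ^ 2) - (Ex p F) ^ 2 ≤
      ∑ i, Ex p (fun w => (F w - F (Function.update w i (a0 i))) ^ 2) := by
  set e := (Fintype.equivFin ι).symm with he
  have := efron_stein_fin (fun i => p (e i)) (fun i => hp _) (fun i => h1 _) (fun i => a0 (e i))
    (fun w => F (fun i => w (e.symm i)))
  rw [Ex_equiv e p F, Ex_equiv e p, ← e.sum_comp]
  refine this.trans (le_of_eq ?_)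
  congr 1; ext i
  rw [Ex_equiv e p]
  congr 1; ext w
  congr 3
  ext j
  by_cases h : j = e i
  · subst h; simp
  · rw [Function.update_of_ne h, Function.update_of_ne]
    intro h'; apply h; rw [← h']; simp

/-- Chebyshev -/
lemma chebyshev_Ex {ι α : Type} [Fintype ι] [DecidableEq ι] [Fintype α] (p : ι → α → ℝ)
    (hp : ∀ i a, 0 ≤ p i a) (h1 : ∀ i, ∑ a, p i a = 1)
    (F : (ι → α) → ℝ) (V t : ℝ) (ht : 0 < t)
    (hV : Ex p (fun w => F w ^ 2) - (Ex p F) ^ 2 ≤ V) :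
    Ex p (fun w => if t ≤ |F w - Ex p F| then 1 else 0) ≤ V / t ^ 2 := by
  rw [le_div_iff₀ (by positivity)]
  have := Ex_sq_sub h1 F (Ex p F)
  calc _ = Ex p (fun w => t ^ 2 * (if t ≤ |F w - Ex p F| then 1 else 0)) := by
        rw [Ex_mul]; ring
    _ ≤ Ex p (fun w => (F w - Ex p F) ^ 2) := by
        apply Ex_mono hp; intro w
        split_ifs with h
        · rw [mul_one, ← sq_abs (F w - _)]; exact pow_le_pow_left₀ ht.le h 2
        · simp; positivity
    _ ≤ V := by rw [this]; simpa using hV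

/-- Lemma R (reserved coordinates). -/
lemma reserve {ι α : Type} [Fintype ι] [DecidableEq ι] [Fintype α] (p : ι → α → ℝ)
    (hp : ∀ i a, 0 ≤ p i a) (h1 : ∀ i, ∑ a, p i a = 1) (J : Finset ι) (c : ℝ) (hc : 0 < c)
    (typ E : Finset (ι → α))
    (h : ∀ w ∈ typ, ∃ w' ∈ E, (∀ i, i ∉ J → w' i = w i) ∧ ∀ i ∈ J, c ≤ p i (w' i)) :
    c ^ J.card * ∑ w ∈ typ, PW p w ≤ ∑ w ∈ E, PW p w := by
  choose! φ hφE hφa hφc using h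
  have key : ∀ w' ∈ E, c ^ J.card * ∑ w ∈ typ with φ w = w', PW p w ≤ PW p w' := by
    intro w' _
    by_cases hne : ({w ∈ typ | φ w = w'} : Finset _).Nonempty
    · obtain ⟨w0, hw0⟩ := hne
      rw [Finset.mem_filter] at hw0
      have hcJ : ∀ i ∈ J, c ≤ p i (w' i) := by
        intro i hi; rw [← hw0.2]; exact hφc w0 hw0.1 i hi
      have s1 : ∑ w ∈ typ with φ w = w', PW p w ≤
          ∑ w ∈ Fintype.piFinset (fun i => if i ∈ J then (univ : Finset α) else {w' i}), PW p w := by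
        apply Finset.sum_le_sum_of_subset_of_nonneg
        · intro w hw
          rw [Finset.mem_filter] at hw
          rw [Fintype.mem_piFinset]
          intro i
          split_ifs with hi
          · simp
          · rw [Finset.mem_singleton, ← hw.2, hφa w hw.1 i hi]
        · intro w _ _; exact PW_nonneg hp w
      have s2 : ∑ w ∈ Fintype.piFinset (fun i => if i ∈ J then (univ : Finset α) else {w' i}), PW p w
          = ∏ i, (if i ∈ J then 1 else p i (w' i)) := by
        unfold PW
        rw [← Finset.prod_univ_sum]
        apply Finset.prod_congr rfl
        intro i _
        split_ifs with hi
        · exact h1 i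
        · simp
      have s3 : c ^ J.card = ∏ i, (if i ∈ J then c else 1) := by
        rw [Finset.prod_ite_mem]; simp
      calc _ ≤ c ^ J.card * ∏ i, (if i ∈ J then 1 else p i (w' i)) := by
            rw [← s2]; exact mul_le_mul_of_nonneg_left s1 (by positivity)
        _ = ∏ i, (if i ∈ J then c else p i (w' i)) := by
            rw [s3, ← Finset.prod_mul_distrib]
            apply Finset.prod_congr rfl; intro i _; split_ifs <;> ring
        _ ≤ PW p w' := by
            apply Finset.prod_le_prod
            · intro i _; split_ifs; exacts [hc.le, hp _ _]
            · intro i _; split_ifs with hi; exacts [hcJ i hi, le_rfl]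
    · rw [Finset.not_nonempty_iff_eq_empty] at hne
      rw [hne]; simp; exact PW_nonneg hp _
  rw [← Finset.sum_fiberwise_of_maps_to hφE, Finset.mul_sum]
  exact Finset.sum_le_sum key

/-- card lemma for fibred products -/
lemma card_fibre {X G β : Type} [Fintype X] [DecidableEq X] [Fintype G] [DecidableEq G] [Fintype β] (g : X → G)
    (S : ∀ c : G, Finset ({x // g x = c} → β)) (E : Finset (X → β))
    (hE : ∀ σ : X → β, (∀ c, (fun x : {x // g x = c} => σ x.1) ∈ S c) → σ ∈ E) :
    ∏ c, (S c).card ≤ E.card := by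
  rw [← Fintype.card_piFinset]
  apply Finset.card_le_card_of_injOn (fun s x => s (g x) ⟨x, rfl⟩)
  · intro s hs
    rw [Finset.mem_coe, Fintype.mem_piFinset] at hs
    apply hE
    intro c
    convert hs c using 1
    ext ⟨x, hx⟩
    subst hx; rfl
  · intro s _ s' _ hss
    funext c x
    obtain ⟨x, rfl⟩ := x
    exact congrFun hss x

/-- push-forward lemma -/
lemma push_sum {Ω O : Type} [Fintype Ω] [Fintype O] [DecidableEq O] (m : ℕ) (κ : Ω → O) (a : Ω → ℝ)
    (F : (Fin m → O) → ℝ) :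
    ∑ Φ : Fin m → Ω, F (fun i => κ (Φ i)) * ∏ i, a (Φ i) =
      ∑ c : Fin m → O, F c * ∏ i, ∑ C with κ C = c i, a C := by
  rw [← Finset.sum_fiberwise (univ : Finset (Fin m → Ω)) (fun Φ => fun i => κ (Φ i))]
  apply Finset.sum_congr rfl
  intro c _
  rw [Finset.prod_univ_sum, Finset.mul_sum]
  have : ({Φ | (fun i => κ (Φ i)) = c} : Finset (Fin m → Ω)) =
      Fintype.piFinset (fun i => ({C | κ C = c i} : Finset Ω)) := by
    ext Φ; simp [funext_iff]
  rw [← this]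
  apply Finset.sum_congr rfl
  intro Φ hΦ
  rw [Finset.mem_filter] at hΦ
  rw [hΦ.2]
end

section
/-! Part B1: counting clauses -/

def satC {n k : ℕ} (σ : Assignment n) (C : Clause n k) : Prop := ∃ j, litVal σ (C j) = true

def LS {n : ℕ} (σ : Assignment n) (b : Bool) (U : Finset (Fin n)) : Finset (Lit n) :=
  univ.filter fun l => litVal σ l = b ∧ l.1 ∈ U

lemma mem_LS {n : ℕ} (σ : Assignment n) (b : Bool) (U : Finset (Fin n)) (l : Lit n) :
    l ∈ LS σ b U ↔ litVal σ l = b ∧ l.1 ∈ U := by simp [LS]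

lemma card_LS {n : ℕ} (σ : Assignment n) (b : Bool) (U : Finset (Fin n)) :
    (LS σ b U).card = U.card := by
  have : LS σ b U = U.image (fun v => ((v, σ v == b) : Lit n)) := by
    ext ⟨v, s⟩
    simp only [mem_LS, litVal, mem_image, Prod.mk.injEq]
    constructor
    · rintro ⟨h, hv⟩
      refine ⟨v, hv, rfl, ?_⟩
      cases s <;> cases b <;> cases hs : σ v <;> simp_all
    · rintro ⟨w, hw, rfl, h⟩
      refine ⟨?_, hw⟩
      cases s <;> cases b <;> cases hs : σ w <;> simp_all
  rw [this, Finset.card_image_of_injective]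
  intro a b h; simpa using congrArg Prod.fst h

lemma card_Lit (n : ℕ) : Fintype.card (Lit n) = 2 * n := by
  simp [Lit, mul_comm]

lemma card_Clause (n k : ℕ) : Fintype.card (Clause n k) = (2 * n) ^ k := by
  simp [Clause, mul_comm]

lemma card_Formula (n k m : ℕ) : Fintype.card (Formula n k m) = ((2 * n) ^ k) ^ m := by
  simp [Formula, mul_comm]

lemma card_unsat {n k : ℕ} (σ : Assignment n) :
    (univ.filter fun C : Clause n k => ¬ satC σ C).card = n ^ k := by
  have : (univ.filter fun C : Clause n k => ¬ satC σ C) =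
      Fintype.piFinset (fun _ : Fin k => LS σ false univ) := by
    ext C; simp [satC, LS, Fintype.mem_piFinset]
  rw [this, Fintype.card_piFinset]; simp [card_LS]

lemma card_sat {n k : ℕ} (σ : Assignment n) :
    ((univ.filter fun C : Clause n k => satC σ C).card : ℝ) = (2 ^ k - 1) * (n : ℝ) ^ k := by
  have h := Finset.card_filter_add_card_filter_not (s := (univ : Finset (Clause n k))) (satC σ)
  rw [card_unsat, Finset.card_univ, card_Clause] at h
  have h' : ((univ.filter fun C : Clause n k => satC σ C).card : ℝ) + (n : ℝ) ^ k = (2 * n) ^ k := by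
    exact_mod_cast h
  rw [mul_pow] at h'; linarith

def dset {n : ℕ} (σ τ : Assignment n) : Finset (Fin n) := univ.filter fun x => σ x ≠ τ x

lemma card_dset {n : ℕ} (σ τ : Assignment n) : (dset σ τ).card = hdist σ τ := rfl

lemma litVal_flip {n : ℕ} (σ τ : Assignment n) (l : Lit n) :
    litVal τ l = if l.1 ∈ dset σ τ then !(litVal σ l) else litVal σ l := by
  obtain ⟨v, s⟩ := l
  simp only [litVal, dset, mem_filter, mem_univ, true_and]
  cases s <;> cases h1 : σ v <;> cases h2 : τ v <;> simp

lemma card_unsat2 {n k : ℕ} (σ τ : Assignment n) :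
    (univ.filter fun C : Clause n k => ¬ satC σ C ∧ ¬ satC τ C).card = (n - hdist σ τ) ^ k := by
  have : (univ.filter fun C : Clause n k => ¬ satC σ C ∧ ¬ satC τ C) =
      Fintype.piFinset (fun _ : Fin k => LS σ false (dset σ τ)ᶜ) := by
    ext C
    simp only [satC, mem_filter, mem_univ, true_and, not_exists, Fintype.mem_piFinset, mem_LS,
      mem_compl, Bool.not_eq_true]
    constructor
    · rintro ⟨h1, h2⟩ j
      refine ⟨h1 j, fun hj => ?_⟩
      have := litVal_flip σ τ (C j)
      rw [if_pos hj, h1 j, h2 j] at this; simp at this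
    · intro h
      refine ⟨fun j => (h j).1, fun j => ?_⟩
      rw [litVal_flip σ τ, if_neg (h j).2]; exact (h j).1
  rw [this, Fintype.card_piFinset]
  simp [card_LS, card_compl, card_dset]

lemma card_sat2 {n k : ℕ} (σ τ : Assignment n) :
    ((univ.filter fun C : Clause n k => satC σ C ∧ satC τ C).card : ℝ) =
      (2 ^ k - 2) * (n : ℝ) ^ k + ((n : ℝ) - hdist σ τ) ^ k := by
  have h1 := Finset.card_filter_add_card_filter_not (s := (univ.filter fun C : Clause n k => satC σ C)) (satC τ)
  have h2 := Finset.card_filter_add_card_filter_not (s := (univ.filter fun C : Clause n k => ¬ satC τ C)) (satC σ)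
  rw [card_unsat] at h2
  have h3 := card_unsat2 (k := k) σ τ
  have h4 := card_sat (k := k) σ
  have hle : hdist σ τ ≤ n := by
    rw [← card_dset]; simpa using Finset.card_le_univ (dset σ τ)
  simp only [Finset.filter_filter] at h1 h2
  have e1 : (univ.filter fun C : Clause n k => ¬ satC τ C ∧ satC σ C) =
    (univ.filter fun C : Clause n k => satC σ C ∧ ¬ satC τ C) := by
    ext C; simp [and_comm]
  have e2 : (univ.filter fun C : Clause n k => ¬ satC τ C ∧ ¬ satC σ C) =
    (univ.filter fun C : Clause n k => ¬ satC σ C ∧ ¬ satC τ C) := by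
    ext C; simp [and_comm]
  rw [e1, e2, h3] at h2
  have h1' := congrArg (Nat.cast : ℕ → ℝ) h1
  have h2' := congrArg (Nat.cast : ℕ → ℝ) h2
  push_cast [Nat.cast_sub hle] at h1' h2'
  rw [h4] at h1'
  linarith

/-- critical variable of a clause -/
def isCrit {n k : ℕ} (σ : Assignment n) (C : Clause n k) (j : Fin k) : Prop :=
  litVal σ (C j) = true ∧ ∀ i, i ≠ j → litVal σ (C i) = false

def crit {n k : ℕ} (σ : Assignment n) (C : Clause n k) : Option (Fin n) :=
  if h : ∃ j, isCrit σ C j then some (C h.choose).1 else none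

lemma isCrit_unique {n k : ℕ} {σ : Assignment n} {C : Clause n k} {i j : Fin k}
    (hi : isCrit σ C i) (hj : isCrit σ C j) : i = j := by
  by_contra h
  have := hj.2 i h
  rw [hi.1] at this; simp at this

lemma crit_eq_some {n k : ℕ} (σ : Assignment n) (C : Clause n k) (v : Fin n) :
    crit σ C = some v ↔ ∃ j, isCrit σ C j ∧ (C j).1 = v := by
  unfold crit
  constructor
  · intro h
    split_ifs at h with h'
    exact ⟨_, h'.choose_spec, by simpa using h⟩
  · rintro ⟨j, hj, hv⟩
    have h' : ∃ j, isCrit σ C j := ⟨j, hj⟩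
    rw [dif_pos h', isCrit_unique h'.choose_spec hj, hv]

lemma crit_sat {n k : ℕ} {σ : Assignment n} {C : Clause n k} {v : Fin n}
    (h : crit σ C = some v) : satC σ C := by
  obtain ⟨j, hj, _⟩ := (crit_eq_some σ C v).1 h
  exact ⟨j, hj.1⟩

lemma prod_two {k : ℕ} (j : Fin k) (a b : ℕ) :
    ∏ i : Fin k, (if i = j then a else b) = a * b ^ (k - 1) := by
  rw [← Finset.mul_prod_erase univ _ (mem_univ j)]
  rw [if_pos rfl]
  congr 1
  rw [Finset.prod_congr rfl (g := fun _ => b)]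
  · simp [Finset.card_erase_of_mem]
  · intro i hi; rw [if_neg (Finset.ne_of_mem_erase hi)]

lemma card_crit {n k : ℕ} (σ : Assignment n) (v : Fin n) :
    (univ.filter fun C : Clause n k => crit σ C = some v).card = k * n ^ (k - 1) := by
  have : (univ.filter fun C : Clause n k => crit σ C = some v) =
      (univ : Finset (Fin k)).biUnion fun j => Fintype.piFinset (fun i : Fin k =>
        if i = j then LS σ true {v} else LS σ false univ) := by
    ext C
    simp only [mem_filter, mem_univ, true_and, crit_eq_some, mem_biUnion, Fintype.mem_piFinset, isCrit]
    refine exists_congr fun j => ?_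
    constructor
    · rintro ⟨⟨h1, h2⟩, h3⟩ i
      split_ifs with h
      · subst h; simp [mem_LS, h1, h3]
      · simp [mem_LS, h2 i h]
    · intro h
      refine ⟨⟨?_, fun i hi => ?_⟩, ?_⟩
      · have := h j; rw [if_pos rfl, mem_LS] at this; exact this.1
      · have := h i; rw [if_neg hi, mem_LS] at this; exact this.1
      · have := h j; rw [if_pos rfl, mem_LS] at this; simpa using this.2
  rw [this, Finset.card_biUnion]
  · simp only [Fintype.card_piFinset]
    rw [Finset.sum_congr rfl (g := fun _ => n ^ (k - 1))]
    · simp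
    · intro j _
      have := prod_two j 1 n
      rw [one_mul] at this; rw [← this]
      refine Finset.prod_congr rfl fun i _ => ?_
      split_ifs <;> simp [card_LS]
  · intro i _ j _ hij
    change Disjoint _ _
    rw [Finset.disjoint_left]
    intro C h1 h2
    rw [Fintype.mem_piFinset] at h1 h2
    have a := h1 i; have b := h2 i
    rw [if_pos rfl, mem_LS] at a
    rw [if_neg hij, mem_LS] at b
    rw [a.1] at b; simp at b

lemma card_crit_flip {n k : ℕ} (σ τ : Assignment n) (v : Fin n) (hv : v ∈ dset σ τ) :
    (univ.filter fun C : Clause n k => crit σ C = some v ∧ satC τ C).card ≤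
      k * ((k - 1) * (hdist σ τ * n ^ (k - 2))) := by
  have : (univ.filter fun C : Clause n k => crit σ C = some v ∧ satC τ C) ⊆
      (univ : Finset (Fin k)).biUnion fun j => (univ.erase j).biUnion fun j' =>
        Fintype.piFinset (fun i : Fin k =>
        if i = j then LS σ true {v} else if i = j' then LS σ false (dset σ τ) else LS σ false univ) := by
    intro C
    simp only [mem_filter, mem_univ, true_and, crit_eq_some, mem_biUnion, Fintype.mem_piFinset, isCrit]
    rintro ⟨⟨j, ⟨h1, h2⟩, h3⟩, ⟨j', h4⟩⟩
    have hne : j' ≠ j := by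
      rintro rfl
      rw [litVal_flip σ τ, h3, if_pos hv, h1] at h4; simp at h4
    refine ⟨j, j', by simp [hne], fun i => ?_⟩
    split_ifs with h h'
    · subst h; simp [mem_LS, h1, h3]
    · subst h'
      rw [mem_LS]; refine ⟨h2 _ hne, ?_⟩
      by_contra hc
      rw [litVal_flip σ τ, if_neg hc, h2 _ hne] at h4; simp at h4
    · simp [mem_LS, h2 i h]
  refine (Finset.card_le_card this).trans ?_
  refine (Finset.card_biUnion_le).trans ?_
  have : ∀ j : Fin k, (((univ : Finset (Fin k)).erase j).biUnion fun j' =>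
        Fintype.piFinset (fun i : Fin k =>
        if i = j then LS σ true {v} else if i = j' then LS σ false (dset σ τ) else LS σ false univ)).card
        ≤ (k - 1) * (hdist σ τ * n ^ (k - 2)) := by
    intro j
    refine (Finset.card_biUnion_le).trans ?_
    refine (Finset.sum_le_card_nsmul _ _ (hdist σ τ * n ^ (k - 2)) ?_).trans ?_
    · intro j' hj'
      have hne := Finset.ne_of_mem_erase hj'
      rw [Fintype.card_piFinset, ← Finset.mul_prod_erase univ _ (mem_univ j),
        ← Finset.mul_prod_erase _ _ hj']
      rw [if_pos rfl, if_neg hne, if_pos rfl, card_LS, card_LS, card_dset]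
      simp only [card_singleton, one_mul]
      apply Nat.mul_le_mul_left
      apply le_of_eq
      rw [Finset.prod_congr rfl (g := fun _ => n)]
      · rw [Finset.prod_const, Finset.card_erase_of_mem hj', Finset.card_erase_of_mem (mem_univ j)]
        simp [Nat.sub_sub]
      · intro i hi
        rw [Finset.mem_erase, Finset.mem_erase] at hi
        rw [if_neg hi.2.1, if_neg hi.1, card_LS]; simp
    · rw [Finset.card_erase_of_mem (mem_univ j)]; simp
  refine (Finset.sum_le_card_nsmul _ _ _ fun j _ => this j).trans ?_
  simp
end

section
/-! Part B2: local cluster -/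

def Aw {n : ℕ} (k : ℕ) (σ : Assignment n) (o : Option (Fin n)) : ℝ :=
  ∑ C with crit (k := k) σ C = o, if satC σ C then (1:ℝ) else 0

def Nc {n m : ℕ} (c : Fin m → Option (Fin n)) (v : Fin n) : ℕ :=
  (univ.filter fun i => c i = some v).card

def bo {n : ℕ} (b : Fin n → ℝ) (o : Option (Fin n)) : ℝ := o.elim 1 b

lemma prod_bo {n m : ℕ} (b : Fin n → ℝ) (c : Fin m → Option (Fin n)) :
    ∏ i, bo b (c i) = ∏ v, b v ^ Nc c v := by
  have : ∀ v, b v ^ Nc c v = ∏ i, (if c i = some v then b v else 1) := by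
    intro v
    rw [Finset.prod_ite]; simp [Nc]
  simp_rw [this]
  rw [Finset.prod_comm]
  refine Finset.prod_congr rfl fun i _ => ?_
  rcases h : c i with _ | v
  · simp [bo]
  · simp [bo, Finset.prod_ite_eq]

lemma sum_Aw {n : ℕ} (k : ℕ) (σ : Assignment n) :
    ∑ o, Aw k σ o = (2 ^ k - 1) * (n : ℝ) ^ k := by
  unfold Aw
  rw [Finset.sum_fiberwise, ← card_sat σ]
  simp

lemma Aw_some {n : ℕ} (k : ℕ) (σ : Assignment n) (v : Fin n) :
    Aw k σ (some v) = k * (n : ℝ) ^ (k - 1) := by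
  unfold Aw
  rw [Finset.sum_congr rfl (g := fun _ => (1:ℝ))]
  · rw [Finset.sum_const, nsmul_eq_mul, mul_one, card_crit]; push_cast; rfl
  · intro C hC
    rw [if_pos (crit_sat (Finset.mem_filter.1 hC).2)]

lemma Aw_nonneg {n : ℕ} (k : ℕ) (σ : Assignment n) (o : Option (Fin n)) : 0 ≤ Aw k σ o :=
  Finset.sum_nonneg fun C _ => by split_ifs <;> norm_num

def Qc {n m : ℕ} (θ : ℝ) (c : Fin m → Option (Fin n)) : ℝ := ∏ v, (1 + θ ^ Nc c v)

lemma Aw_flip {n k : ℕ} (hk : 2 ≤ k) (σ τ : Assignment n) (α : ℝ)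
    (h : (hdist σ τ : ℝ) ≤ α * n) (o : Option (Fin n)) :
    ∑ C with crit (k := k) σ C = o, (if satC σ C ∧ satC τ C then (1:ℝ) else 0) ≤
      Aw k σ o * bo (fun v => if v ∈ dset σ τ then (k - 1) * α else 1) o := by
  have triv : ∑ C with crit (k := k) σ C = o, (if satC σ C ∧ satC τ C then (1:ℝ) else 0) ≤
      Aw k σ o := by
    apply Finset.sum_le_sum; intro C _
    split_ifs <;> simp_all
  rcases o with _ | v
  · simpa [bo] using triv
  · by_cases hv : v ∈ dset σ τ
    · simp only [bo, Option.elim, if_pos hv]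
      rw [Aw_some]
      have h1 := card_crit_flip (k := k) σ τ v hv
      have h2 : ∑ C with crit (k := k) σ C = some v, (if satC σ C ∧ satC τ C then (1:ℝ) else 0) =
         ((univ.filter fun C : Clause n k => crit σ C = some v ∧ satC τ C).card : ℝ) := by
        rw [Finset.sum_ite, Finset.filter_filter]
        simp only [sum_const_zero, add_zero, sum_const, nsmul_eq_mul, mul_one]
        congr 2
        ext C; simp only [mem_filter, mem_univ, true_and]
        constructor
        · rintro ⟨a, b, c⟩; exact ⟨a, c⟩
        · rintro ⟨a, c⟩; exact ⟨a, crit_sat a, c⟩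
      rw [h2]
      have h3 : ((univ.filter fun C : Clause n k => crit σ C = some v ∧ satC τ C).card : ℝ) ≤
        ((k * ((k - 1) * (hdist σ τ * n ^ (k - 2))) : ℕ) : ℝ) := by exact_mod_cast h1
      refine h3.trans ?_
      push_cast [Nat.cast_sub (by omega : 1 ≤ k)]
      have e : (n : ℝ) ^ (k - 1) = n * n ^ (k - 2) := by
        rw [← pow_succ']; congr 1; omega
      rw [e]
      have hk1 : (0:ℝ) ≤ (k:ℝ) - 1 := by
        have : (2:ℝ) ≤ k := by exact_mod_cast hk
        linarith
      calc (k:ℝ) * ((k - 1) * (hdist σ τ * n ^ (k - 2)))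
          ≤ (k:ℝ) * ((k - 1) * ((α * n) * n ^ (k - 2))) := by gcongr
        _ = _ := by ring
    · simpa [bo, hv] using triv

lemma flip_sum {n : ℕ} (σ : Assignment n) (f : Finset (Fin n) → ℝ) :
    ∑ τ : Assignment n, f (dset σ τ) = ∑ U ∈ (univ : Finset (Fin n)).powerset, f U := by
  apply Finset.sum_bij (fun τ _ => dset σ τ)
  · intro τ _; simp
  · intro a _ b _ h
    ext x
    have : x ∈ dset σ a ↔ x ∈ dset σ b := by rw [h]
    simp only [dset, mem_filter, mem_univ, true_and] at this
    cases h1 : σ x <;> cases h2 : a x <;> cases h3 : b x <;> simp_all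
  · intro U _
    refine ⟨fun x => if x ∈ U then !(σ x) else σ x, mem_univ _, ?_⟩
    ext x
    simp only [dset, mem_filter, mem_univ, true_and]
    split_ifs with h <;> simp [h]
  · intro τ _; rfl

def clLoc {n k m : ℕ} (α : ℝ) (Φ : Formula n k m) (σ : Assignment n) : ℝ :=
  ∑ τ : Assignment n, if (hdist σ τ : ℝ) ≤ α * n ∧ Satisfies τ Φ then 1 else 0

lemma prod_ind {m : ℕ} (p : Fin m → Prop) [DecidablePred p] [Decidable (∀ i, p i)] :
    ∏ i, (if p i then (1:ℝ) else 0) = if ∀ i, p i then 1 else 0 := by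
  rw [Finset.prod_ite_zero]; simp

lemma local_sum {n k m : ℕ} (hk : 2 ≤ k) (σ : Assignment n) (α : ℝ) (hα : 0 ≤ α)
    (F : (Fin m → Option (Fin n)) → ℝ) (hF : ∀ c, 0 ≤ F c) :
    ∑ Φ : Formula n k m, (if Satisfies σ Φ then (1:ℝ) else 0) *
      F (fun i => crit σ (Φ i)) * clLoc α Φ σ ≤
    ∑ c : Fin m → Option (Fin n), F c * Qc ((k-1) * α) c * ∏ i, Aw k σ (c i) := by
  have hk1 : (0:ℝ) ≤ (k:ℝ) - 1 := by
    have : (2:ℝ) ≤ k := by exact_mod_cast hk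
    linarith
  set θ : ℝ := ((k:ℝ) - 1) * α with hθ
  have hθ0 : 0 ≤ θ := by positivity
  have hQ : ∀ c : Fin m → Option (Fin n), Qc θ c =
      ∑ τ : Assignment n, ∏ i, bo (fun v => if v ∈ dset σ τ then θ else 1) (c i) := by
    intro c
    simp_rw [prod_bo]
    rw [flip_sum σ (fun U => ∏ v, (if v ∈ U then θ else 1) ^ Nc c v)]
    unfold Qc
    rw [Finset.prod_one_add]
    refine Finset.sum_congr rfl fun U _ => ?_
    have : ∀ v, (if v ∈ U then θ else 1) ^ Nc c v = if v ∈ U then θ ^ Nc c v else 1 := by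
      intro v; split_ifs <;> simp
    simp_rw [this]
    rw [Finset.prod_ite_mem]; simp
  have hbo : ∀ τ : Assignment n, ∀ o, 0 ≤ bo (fun v => if v ∈ dset σ τ then θ else 1) o := by
    intro τ o
    rcases o with _ | v
    · simp [bo]
    · simp only [bo, Option.elim]; split_ifs <;> [exact hθ0; norm_num]
  calc _ = ∑ τ : Assignment n, if (hdist σ τ : ℝ) ≤ α * n then
        ∑ Φ : Formula n k m, F (fun i => crit σ (Φ i)) *
          ∏ i, (if satC σ (Φ i) ∧ satC τ (Φ i) then (1:ℝ) else 0) else 0 := by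
        unfold clLoc
        simp_rw [Finset.mul_sum]
        rw [Finset.sum_comm]
        refine Finset.sum_congr rfl fun τ _ => ?_
        by_cases hτ : (hdist σ τ : ℝ) ≤ α * n
        · rw [if_pos hτ]
          refine Finset.sum_congr rfl fun Φ _ => ?_
          rw [prod_ind (fun i => satC σ (Φ i) ∧ satC τ (Φ i))]
          have e : (∀ i, satC σ (Φ i) ∧ satC τ (Φ i)) ↔ Satisfies σ Φ ∧ Satisfies τ Φ := forall_and
          simp only [e, hτ, true_and]
          by_cases h1 : Satisfies σ Φ <;> by_cases h2 : Satisfies τ Φ <;> simp [h1, h2]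
        · rw [if_neg hτ]
          refine Finset.sum_eq_zero fun Φ _ => ?_
          rw [if_neg (c := (hdist σ τ : ℝ) ≤ α * n ∧ Satisfies τ Φ) (fun h => hτ h.1)]; simp
    _ ≤ ∑ τ : Assignment n, ∑ c : Fin m → Option (Fin n), F c *
          ((∏ i, Aw k σ (c i)) * ∏ i, bo (fun v => if v ∈ dset σ τ then θ else 1) (c i)) := by
        refine Finset.sum_le_sum fun τ _ => ?_
        split_ifs with hτ
        · rw [push_sum m (crit σ) (fun C : Clause n k => if satC σ C ∧ satC τ C then (1:ℝ) else 0) F]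
          refine Finset.sum_le_sum fun c _ => ?_
          refine mul_le_mul_of_nonneg_left ?_ (hF c)
          rw [← Finset.prod_mul_distrib]
          refine Finset.prod_le_prod (fun i _ => Finset.sum_nonneg fun C _ => by split_ifs <;> norm_num) fun i _ => ?_
          exact Aw_flip hk σ τ α hτ (c i)
        · exact Finset.sum_nonneg fun c _ => mul_nonneg (hF c) (mul_nonneg
            (Finset.prod_nonneg fun i _ => Aw_nonneg k σ _) (Finset.prod_nonneg fun i _ => hbo τ _))
    _ = _ := by
        rw [Finset.sum_comm]
        refine Finset.sum_congr rfl fun c _ => ?_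
        rw [hQ c, ← Finset.mul_sum, ← Finset.mul_sum]
        ring

lemma sat_push {n k m : ℕ} (σ : Assignment n) (F : (Fin m → Option (Fin n)) → ℝ) :
    ∑ Φ : Formula n k m, (if Satisfies σ Φ then (1:ℝ) else 0) * F (fun i => crit σ (Φ i)) =
    ∑ c : Fin m → Option (Fin n), F c * ∏ i, Aw k σ (c i) := by
  rw [show (∑ c : Fin m → Option (Fin n), F c * ∏ i, Aw k σ (c i)) = _ from
    (push_sum m (crit σ) (fun C : Clause n k => if satC σ C then (1:ℝ) else 0) F).symm]
  refine Finset.sum_congr rfl fun Φ _ => ?_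
  rw [prod_ind (fun i => satC σ (Φ i)), mul_comm]; congr 1
  exact if_congr Iff.rfl rfl rfl

def lam (n k m : ℕ) : ℝ := m * (k / ((2 ^ k - 1) * n))

lemma moment_Q {n k m : ℕ} (hk : 2 ≤ k) (hn : 1 ≤ n) (σ : Assignment n) (x η : ℝ) (hx : 0 ≤ x)
    (hη : 0 ≤ η) (hη1 : η ≤ 1) :
    ∑ c : Fin m → Option (Fin n), (∏ v, (1 + x * 0 ^ Nc c v + η * η ^ Nc c v)) *
      ∏ i, Aw k σ (c i) ≤
    ((2 ^ k - 1) * (n : ℝ) ^ k) ^ m *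
      Real.exp (n * (x * Real.exp (- lam n k m) + η * Real.exp (- (lam n k m * (1 - η))))) := by
  set S : ℝ := (2 ^ k - 1) * (n : ℝ) ^ k with hS
  have hn0 : (0:ℝ) < n := by exact_mod_cast hn
  have h2k : (1:ℝ) < 2 ^ k := one_lt_pow₀ (by norm_num) (by omega)
  have hS0 : 0 < S := by
    apply mul_pos; linarith; positivity
  set cf : Fin 3 → ℝ := ![1, x, η] with hcf
  set bs : Fin 3 → ℝ := ![1, 0, η] with hbs
  have hcf0 : ∀ a, 0 ≤ cf a := by intro a; fin_cases a <;> simp [hcf, hx, hη]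
  have hbs0 : ∀ a, 0 ≤ bs a := by intro a; fin_cases a <;> simp [hbs, hη]
  have hbs1 : ∀ a, bs a ≤ 1 := by intro a; fin_cases a <;> simp [hbs, hη1]
  have e1 : ∀ c : Fin m → Option (Fin n), (∏ v, (1 + x * 0 ^ Nc c v + η * η ^ Nc c v)) =
      ∑ w : Fin n → Fin 3, (∏ v, cf (w v)) * ∏ i, bo (fun v => bs (w v)) (c i) := by
    intro c
    have : ∀ v, (1 + x * 0 ^ Nc c v + η * η ^ Nc c v) = ∑ a, cf a * bs a ^ Nc c v := by
      intro v; simp [Fin.sum_univ_three, hcf, hbs]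
    simp_rw [this]
    rw [← sum_prod_eq]
    refine Finset.sum_congr rfl fun w _ => ?_
    rw [Finset.prod_mul_distrib, prod_bo]
  have e2 : ∀ w : Fin n → Fin 3, ∑ o, Aw k σ o * bo (fun v => bs (w v)) o ≤
      S * Real.exp (- ((k / ((2 ^ k - 1) * n)) * ∑ v, (1 - bs (w v)))) := by
    intro w
    have : ∑ o, Aw k σ o * bo (fun v => bs (w v)) o =
        S - (k * (n : ℝ) ^ (k - 1)) * ∑ v, (1 - bs (w v)) := by
      have s := sum_Aw k σ
      rw [Fintype.sum_option] at s ⊢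
      simp only [Aw_some] at s ⊢
      simp only [bo, Option.elim, mul_one]
      rw [hS, ← s, Finset.mul_sum]
      rw [add_sub_assoc, ← Finset.sum_sub_distrib]
      congr 1
      exact Finset.sum_congr rfl fun v _ => by ring
    rw [this]
    have e3 : (k * (n : ℝ) ^ (k - 1)) = S * (k / ((2 ^ k - 1) * n)) := by
      have : (n:ℝ) ^ k = n ^ (k-1) * n := by rw [← pow_succ]; congr 1; omega
      rw [hS, this]; field_simp
      rw [div_self (by linarith)]
    rw [e3]
    have := Real.add_one_le_exp (- ((k / ((2 ^ k - 1) * n)) * ∑ v, (1 - bs (w v))))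
    nlinarith
  have hbo : ∀ w : Fin n → Fin 3, ∀ o, 0 ≤ bo (fun v => bs (w v)) o := by
    intro w o; rcases o with _ | v <;> simp [bo, hbs0]
  calc _ = ∑ w : Fin n → Fin 3, (∏ v, cf (w v)) * (∑ o, Aw k σ o * bo (fun v => bs (w v)) o) ^ m := by
        simp_rw [e1, Finset.sum_mul]
        rw [Finset.sum_comm]
        refine Finset.sum_congr rfl fun w _ => ?_
        have := sum_prod_eq (ι := Fin m) (fun _ o => Aw k σ o * bo (fun v => bs (w v)) o)
        rw [Finset.prod_const, Finset.card_univ, Fintype.card_fin] at this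
        rw [← this, Finset.mul_sum]
        refine Finset.sum_congr rfl fun c _ => ?_
        rw [Finset.prod_mul_distrib]; ring
    _ ≤ ∑ w : Fin n → Fin 3, (∏ v, cf (w v)) *
          (S * Real.exp (- ((k / ((2 ^ k - 1) * n)) * ∑ v, (1 - bs (w v))))) ^ m := by
        refine Finset.sum_le_sum fun w _ => ?_
        refine mul_le_mul_of_nonneg_left ?_ (Finset.prod_nonneg fun v _ => hcf0 _)
        refine pow_le_pow_left₀ (Finset.sum_nonneg fun o _ => mul_nonneg (Aw_nonneg _ _ _) (hbo w o)) (e2 w) m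
    _ = S ^ m * ∑ w : Fin n → Fin 3, ∏ v, (cf (w v) * Real.exp (- (lam n k m * (1 - bs (w v))))) := by
        rw [Finset.mul_sum]
        refine Finset.sum_congr rfl fun w _ => ?_
        rw [Finset.prod_mul_distrib, ← Real.exp_sum, mul_pow, ← Real.exp_nat_mul]
        rw [mul_left_comm]
        congr 3
        rw [Finset.sum_neg_distrib, ← Finset.mul_sum, lam]; ring
    _ = S ^ m * (1 + x * Real.exp (- lam n k m) + η * Real.exp (- (lam n k m * (1 - η)))) ^ n := by
        rw [sum_prod_eq (ι := Fin n) (fun _ a => cf a * Real.exp (- (lam n k m * (1 - bs a))))]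
        rw [Finset.prod_const, Finset.card_univ, Fintype.card_fin]
        simp [Fin.sum_univ_three, hcf, hbs]
    _ ≤ _ := by
        refine mul_le_mul_of_nonneg_left ?_ (by positivity)
        rw [Real.exp_nat_mul]
        refine pow_le_pow_left₀ (by positivity) ?_ n
        have := Real.add_one_le_exp (x * Real.exp (- lam n k m) + η * Real.exp (- (lam n k m * (1 - η))))
        linarith

lemma Q_rpow {n m : ℕ} (θ s : ℝ) (hθ : 0 ≤ θ) (hθ1 : θ ≤ 1) (hs : 0 ≤ s) (hs1 : s ≤ 1)
    (c : Fin m → Option (Fin n)) :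
    Qc θ c ^ s ≤ ∏ v, (1 + (2 ^ s - 1) * 0 ^ Nc c v + Real.sqrt θ * Real.sqrt θ ^ Nc c v) := by
  unfold Qc
  rw [← Real.finsetProd_rpow _ _ (fun v _ => by positivity)]
  refine Finset.prod_le_prod (fun v _ => by positivity) fun v _ => ?_
  have h0 := Real.sqrt_nonneg θ
  have h1 : Real.sqrt θ ≤ 1 := by rw [Real.sqrt_le_one]; exact hθ1
  rcases Nat.eq_zero_or_pos (Nc c v) with h | h
  · rw [h]; simp only [pow_zero, mul_one]
    norm_num
  · rw [zero_pow (by omega), mul_zero, add_zero]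
    have e : θ ^ Nc c v = Real.sqrt θ ^ Nc c v * Real.sqrt θ ^ Nc c v := by
      rw [← mul_pow, Real.mul_self_sqrt hθ]
    calc (1 + θ ^ Nc c v) ^ s ≤ (1 + θ ^ Nc c v) ^ (1:ℝ) :=
          Real.rpow_le_rpow_of_exponent_le (by have : 0 ≤ θ ^ Nc c v := by positivity
                                               linarith) hs1
      _ = 1 + θ ^ Nc c v := Real.rpow_one _
      _ ≤ _ := by
        rw [e]
        gcongr
        calc Real.sqrt θ ^ Nc c v ≤ Real.sqrt θ ^ 1 := pow_le_pow_of_le_one h0 h1 h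
          _ = _ := pow_one _

lemma loc_bound {n k m : ℕ} (hk : 2 ≤ k) (hn : 1 ≤ n) (σ : Assignment n) (α s T1 T : ℝ)
    (hα : 0 ≤ α) (hθ1 : ((k:ℝ) - 1) * α ≤ 1) (hs : 0 ≤ s) (hs1 : s ≤ 1) (hT1 : 0 < T1) (hT : 0 < T) :
    ((univ.filter fun Φ : Formula n k m => Satisfies σ Φ ∧ T < clLoc α Φ σ).card : ℝ) ≤
    ((2 ^ k - 1) * (n : ℝ) ^ k) ^ m * (T1 ^ (-s) *
      Real.exp (n * ((2 ^ s - 1) * Real.exp (- lam n k m) + Real.sqrt (((k:ℝ) - 1) * α) *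
        Real.exp (- (lam n k m * (1 - Real.sqrt (((k:ℝ) - 1) * α)))))) + T1 / T) := by
  have hk1 : (0:ℝ) ≤ (k:ℝ) - 1 := by
    have : (2:ℝ) ≤ k := by exact_mod_cast hk
    linarith
  set θ : ℝ := ((k:ℝ) - 1) * α with hθ
  have hθ0 : 0 ≤ θ := by positivity
  have hQ0 : ∀ c : Fin m → Option (Fin n), 0 < Qc θ c := fun c =>
    Finset.prod_pos fun v _ => by positivity
  have hAw : ∀ c : Fin m → Option (Fin n), 0 ≤ ∏ i, Aw k σ (c i) := fun c =>
    Finset.prod_nonneg fun i _ => Aw_nonneg k σ _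
  have hsumA : ∑ c : Fin m → Option (Fin n), ∏ i, Aw k σ (c i) = ((2 ^ k - 1) * (n : ℝ) ^ k) ^ m := by
    rw [sum_prod_eq (ι := Fin m) (fun _ o => Aw k σ o), Finset.prod_const, Finset.card_univ,
      Fintype.card_fin, sum_Aw]
  have hcl : ∀ Φ : Formula n k m, 0 ≤ clLoc α Φ σ := fun Φ => Finset.sum_nonneg fun τ _ => by
    split_ifs <;> norm_num
  have e0 : ((univ.filter fun Φ : Formula n k m => Satisfies σ Φ ∧ T < clLoc α Φ σ).card : ℝ) ≤
      ∑ Φ : Formula n k m, (if Satisfies σ Φ then (1:ℝ) else 0) *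
        (if T1 < Qc θ (fun i => crit σ (Φ i)) then (1:ℝ) else 0) +
      (∑ Φ : Formula n k m, (if Satisfies σ Φ then (1:ℝ) else 0) *
        (if T1 < Qc θ (fun i => crit σ (Φ i)) then (0:ℝ) else 1) * clLoc α Φ σ) / T := by
    rw [Finset.sum_div, ← Finset.sum_add_distrib, Finset.card_filter]
    push_cast
    refine Finset.sum_le_sum fun Φ _ => ?_
    by_cases h1 : Satisfies σ Φ
    · simp only [h1, true_and, if_true, one_mul]
      by_cases h2 : T1 < Qc θ (fun i => crit σ (Φ i))
      · simp only [h2, if_true]; split_ifs <;> norm_num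
      · simp only [h2, if_false, one_mul, zero_add]
        split_ifs with h3
        · rw [le_div_iff₀ hT]; linarith
        · exact div_nonneg (hcl Φ) hT.le
    · simp [h1]
  refine e0.trans ?_
  rw [mul_add]
  apply add_le_add
  · rw [sat_push σ (fun c => if T1 < Qc θ c then (1:ℝ) else 0)]
    calc _ ≤ ∑ c : Fin m → Option (Fin n), T1 ^ (-s) * ((∏ v, (1 + (2 ^ s - 1) * 0 ^ Nc c v + Real.sqrt θ * Real.sqrt θ ^ Nc c v)) *
            ∏ i, Aw k σ (c i)) := by
          refine Finset.sum_le_sum fun c _ => ?_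
          rw [← mul_assoc]
          refine mul_le_mul_of_nonneg_right ?_ (hAw c)
          refine le_trans ?_ (mul_le_mul_of_nonneg_left (Q_rpow θ s hθ0 hθ1 hs hs1 c) (by positivity))
          split_ifs with h
          · rw [Real.rpow_neg hT1.le, inv_mul_eq_div, le_div_iff₀ (by positivity), one_mul]
            exact Real.rpow_le_rpow hT1.le h.le hs
          · have := hQ0 c; positivity
      _ ≤ _ := by
          rw [← Finset.mul_sum, mul_left_comm]
          refine mul_le_mul_of_nonneg_left ?_ (by positivity)
          apply moment_Q hk hn σ _ _ _ (Real.sqrt_nonneg _)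
          · rw [Real.sqrt_le_one]; exact hθ1
          · have := Real.one_le_rpow (by norm_num : (1:ℝ) ≤ 2) hs
            linarith
  · rw [mul_div_assoc']
    apply div_le_div_of_nonneg_right _ hT.le
    refine (local_sum hk σ α hα (fun c => if T1 < Qc θ c then (0:ℝ) else 1)
      (fun c => by split_ifs <;> norm_num)).trans ?_
    rw [← hsumA, Finset.sum_mul]
    refine Finset.sum_le_sum fun c _ => ?_
    rw [mul_comm _ T1]
    refine mul_le_mul_of_nonneg_right ?_ (hAw c)
    split_ifs with h
    · simp [hT1.le]
    · rw [one_mul]; exact not_lt.1 h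
end

section
/-! Part B3: intermediate distances -/

lemma mid_sum {n k m : ℕ} (hn : 1 ≤ n) (σ : Assignment n) (P : ℕ → Prop) (M : ℝ)
    (hM : ∀ h ≤ n, P h → (n.choose h : ℝ) * ((2 ^ k - 2) + (1 - (h:ℝ) / n) ^ k) ^ m ≤ (2 ^ k - 1) ^ m * M)
    (hM0 : 0 ≤ M) :
    ∑ Φ : Formula n k m, (∑ τ : Assignment n,
      if P (hdist σ τ) ∧ Satisfies σ Φ ∧ Satisfies τ Φ then (1:ℝ) else 0) ≤
    ((2 ^ k - 1) * (n : ℝ) ^ k) ^ m * ((n + 1) * M) := by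
  have hn0 : (0:ℝ) < n := by exact_mod_cast hn
  rw [Finset.sum_comm]
  have e1 : ∀ τ : Assignment n, (∑ Φ : Formula n k m,
      if P (hdist σ τ) ∧ Satisfies σ Φ ∧ Satisfies τ Φ then (1:ℝ) else 0) =
      (fun U : Finset (Fin n) => (fun h : ℕ => if P h then ((n : ℝ) ^ k * ((2 ^ k - 2) + (1 - (h:ℝ) / n) ^ k)) ^ m else 0) U.card) (dset σ τ) := by
    intro τ
    simp only [card_dset]
    by_cases hP : P (hdist σ τ)
    · simp only [hP, true_and, if_true]
      have : ∀ Φ : Formula n k m, (if Satisfies σ Φ ∧ Satisfies τ Φ then (1:ℝ) else 0) =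
          ∏ i, (if satC σ (Φ i) ∧ satC τ (Φ i) then (1:ℝ) else 0) := by
        intro Φ
        rw [prod_ind (fun i => satC σ (Φ i) ∧ satC τ (Φ i))]
        exact if_congr (forall_and).symm rfl rfl
      simp_rw [this]
      rw [sum_prod_eq (ι := Fin m) (fun _ C => if satC σ C ∧ satC τ C then (1:ℝ) else 0), Finset.prod_const,
        Finset.card_univ, Fintype.card_fin]
      congr 1
      rw [Finset.sum_boole, card_sat2, mul_add, ← mul_pow]
      congr 1
      · ring
      · congr 1; field_simp
    · simp [hP]
  rw [Finset.sum_congr rfl fun τ _ => e1 τ]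
  have e2 := flip_sum σ (fun U : Finset (Fin n) => (fun h : ℕ => if P h then ((n : ℝ) ^ k * ((2 ^ k - 2) + (1 - (h:ℝ) / n) ^ k)) ^ m else 0) U.card)
  refine (le_of_eq e2).trans ?_
  have e3 := Finset.sum_powerset_apply_card (x := (univ : Finset (Fin n))) (fun h : ℕ => if P h then ((n : ℝ) ^ k * ((2 ^ k - 2) + (1 - (h:ℝ) / n) ^ k)) ^ m else 0)
  refine (le_of_eq e3).trans ?_
  simp only [Finset.card_univ, Fintype.card_fin, nsmul_eq_mul]
  have : ∀ h ∈ Finset.range (n+1), (n.choose h : ℝ) * (if P h then ((n : ℝ) ^ k * ((2 ^ k - 2) + (1 - (h:ℝ) / n) ^ k)) ^ m else 0) ≤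
      ((2 ^ k - 1) * (n : ℝ) ^ k) ^ m * M := by
    intro h hh
    have hhn : h ≤ n := by have := Finset.mem_range.1 hh; omega
    split_ifs with hP
    · have := hM h hhn hP
      rw [mul_pow, mul_pow]
      have hp : (0:ℝ) ≤ ((n:ℝ) ^ k) ^ m := by positivity
      nlinarith [mul_le_mul_of_nonneg_left this hp]
    · have : (1:ℝ) ≤ 2 ^ k := one_le_pow₀ (by norm_num)
      have : (0:ℝ) ≤ 2 ^ k - 1 := by linarith
      simp; positivity
  refine (Finset.sum_le_card_nsmul _ _ _ this).trans (le_of_eq ?_)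
  simp; ring

lemma choose_le_exp {n h : ℕ} (hh : 1 ≤ h) (hn : h ≤ n) :
    (n.choose h : ℝ) ≤ Real.exp (n * ((h / n : ℝ) - (h / n : ℝ) * Real.log (h / n))) := by
  have hh0 : (0:ℝ) < h := by exact_mod_cast hh
  have hn0 : (0:ℝ) < n := by exact_mod_cast (by omega : 0 < n)
  have h1 := Nat.choose_le_pow_div (α := ℝ) h n
  have h2 := Real.pow_div_factorial_le_exp (h:ℝ) hh0.le h
  have e : Real.exp (n * ((h / n : ℝ) - (h / n : ℝ) * Real.log (h / n))) = Real.exp h * ((n:ℝ) / h) ^ h := by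
    rw [← Real.exp_log (show (0:ℝ) < (n:ℝ)/h by positivity), ← Real.exp_nat_mul, ← Real.exp_add]
    congr 1
    rw [Real.log_div hh0.ne' hn0.ne', Real.log_div hn0.ne' hh0.ne']
    field_simp
    ring
  rw [e]
  refine h1.trans ?_
  have : (n:ℝ) ^ h / (h.factorial : ℝ) = ((h:ℝ) ^ h / h.factorial) * ((n:ℝ)/h) ^ h := by
    rw [div_pow]; field_simp
  rw [this]
  gcongr

lemma choose_le_gauss {n h : ℕ} (hn0 : 1 ≤ n) (hn : h ≤ n) :
    (n.choose h : ℝ) ≤ Real.exp (n * (Real.log 2 - 2 * (1 / 2 - (h:ℝ) / n) ^ 2)) := by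
  have hn0 : (0:ℝ) < n := by exact_mod_cast hn0
  set t : ℝ := 1 - 2 * ((h:ℝ) / n) with ht
  have h1 : (n.choose h : ℝ) * Real.exp (t * (n - 2 * h)) ≤ (2 * Real.cosh t) ^ n := by
    have : 2 * Real.cosh t = Real.exp (-t) + Real.exp t := by rw [Real.cosh_eq]; ring
    rw [this, add_pow]
    have := Finset.single_le_sum (f := fun i => Real.exp (-t) ^ i * Real.exp t ^ (n - i) * (n.choose i : ℝ))
      (s := Finset.range (n+1)) (fun i _ => by positivity) (Finset.mem_range.2 (by omega : h < n + 1))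
    refine le_trans (le_of_eq ?_) this
    rw [← Real.exp_nat_mul, ← Real.exp_nat_mul, ← Real.exp_add, mul_comm]
    congr 2
    push_cast [Nat.cast_sub hn]; ring
  have h2 : (2 * Real.cosh t) ^ n ≤ Real.exp (n * (Real.log 2 + t ^ 2 / 2)) := by
    rw [Real.exp_nat_mul, Real.exp_add, Real.exp_log (by norm_num)]
    apply pow_le_pow_left₀ (by have := Real.cosh_pos t; positivity)
    exact mul_le_mul_of_nonneg_left (Real.cosh_le_exp_half_sq t) (by norm_num)
  have h3 : (n.choose h : ℝ) ≤ Real.exp (n * (Real.log 2 + t ^ 2 / 2)) * Real.exp (-(t * (n - 2 * h))) := by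
    rw [Real.exp_neg, ← div_eq_mul_inv, le_div_iff₀ (Real.exp_pos _)]
    exact h1.trans h2
  refine h3.trans (le_of_eq ?_)
  rw [← Real.exp_add]
  congr 1
  rw [ht]; field_simp; ring

set_option maxHeartbeats 1000000 in
lemma mid_core (k : ℕ) (R : ℝ) (hk : 3 ≤ k) (hR : Real.log 2 - k / 2 ^ k ≤ R) (hR2 : R ≤ Real.log 2)
    (c1 : 1 + 6 * Real.log k ≤ 0.3 * k) (c2 : (k:ℝ) / 2 ^ k ≤ 0.05)
    (c3 : (7 / 8 : ℝ) ^ k + k / 2 ^ k ≤ 2 / (k:ℝ) ^ 2)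
    {n h : ℕ} (hn : h ≤ n) (hn1 : 1 ≤ n) (hα : (k:ℝ) ^ (-6 : ℤ) * n < h)
    (hmid : ¬(1 / 2 - (k : ℝ) ^ 2 * (2 : ℝ) ^ (-(k : ℝ) / 2) ≤ (h : ℝ) / n ∧
      (h : ℝ) / n ≤ 1 / 2 + (k : ℝ) ^ 2 * (2 : ℝ) ^ (-(k : ℝ) / 2))) :
    (n.choose h : ℝ) ≤ Real.exp (n * (R * (1 - (1 - (h:ℝ) / n) ^ k))) := by
  have hn0 : (0:ℝ) < n := by exact_mod_cast hn1
  have hk0 : (3:ℝ) ≤ k := by exact_mod_cast hk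
  have hk6 : (0:ℝ) < (k:ℝ) ^ (-6 : ℤ) := by positivity
  have hh0 : (0:ℝ) < h := lt_trans (by positivity) hα
  have hh1 : 1 ≤ h := by exact_mod_cast hh0
  set α : ℝ := (h:ℝ) / n with hαdef
  have hα0 : 0 < α := by positivity
  have hα1 : α ≤ 1 := by rw [hαdef, div_le_one hn0]; exact_mod_cast hn
  have hα6 : (k:ℝ) ^ (-6 : ℤ) < α := by rw [hαdef, lt_div_iff₀ hn0]; exact hα
  have l2 := Real.log_two_gt_d9
  have l2' := Real.log_two_lt_d9
  have hRl : 0.64 ≤ R := by norm_num at c2 l2 ⊢; linarith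
  have hpow : (1 - α) ^ k ≤ Real.exp (-(k * α)) := by
    rw [← mul_neg, Real.exp_nat_mul]
    exact pow_le_pow_left₀ (by linarith) (Real.one_sub_le_exp_neg α) k
  have hpow0 : 0 ≤ (1 - α) ^ k := pow_nonneg (by linarith) k
  by_cases r1 : α ≤ 1 / k
  · -- range 1
    refine (choose_le_exp hh1 hn).trans (Real.exp_le_exp.2 (mul_le_mul_of_nonneg_left ?_ hn0.le))
    rw [← hαdef]
    have ht1 : k * α ≤ 1 := by rw [le_div_iff₀ (by linarith)] at r1; linarith
    have ht0 : 0 ≤ k * α := by positivity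
    have hl : -(6 * Real.log k) ≤ Real.log α := by
      have := Real.log_le_log hk6 hα6.le
      rw [Real.log_zpow] at this; push_cast at this; linarith
    have h3 : Real.exp (-(k * α)) ≤ 1 - k * α / 2 := by
      have a := Real.add_one_le_exp (k * α)
      rw [Real.exp_neg]
      calc (Real.exp (k * α))⁻¹ ≤ (k * α + 1)⁻¹ := by gcongr
        _ ≤ _ := by rw [inv_le_iff_one_le_mul₀ (by linarith)]; nlinarith
    have h4 : k * α / 2 ≤ 1 - (1 - α) ^ k := by linarith
    have h5 : 0.64 * (k * α / 2) ≤ R * (1 - (1 - α) ^ k) := by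
      apply mul_le_mul hRl h4 (by positivity) (by linarith)
    nlinarith
  by_cases r2 : α ≤ 1 / 8
  · refine (choose_le_exp hh1 hn).trans (Real.exp_le_exp.2 (mul_le_mul_of_nonneg_left ?_ hn0.le))
    rw [← hαdef]
    have h1 : α - α * Real.log α ≤ α * Real.log 8 + 1 / 8 := by
      have := Real.log_le_sub_one_of_pos (show (0:ℝ) < 1 / (8 * α) by positivity)
      rw [Real.log_div (by norm_num) (by positivity), Real.log_one, Real.log_mul (by norm_num) hα0.ne'] at this
      have h2 := mul_le_mul_of_nonneg_left this hα0.le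
      have h3 : α * (1 / (8 * α) - 1) = 1 / 8 - α := by field_simp
      rw [h3] at h2
      nlinarith
    have h8 : Real.log 8 = 3 * Real.log 2 := by
      rw [show (8:ℝ) = 2 ^ 3 by norm_num, Real.log_pow]; norm_num
    have hka : 1 ≤ k * α := by
      have := not_le.1 r1
      rw [div_lt_iff₀ (by linarith)] at this; linarith
    have h4 : Real.exp (-(k * α)) ≤ 0.37 := by
      have : Real.exp (-(k*α)) ≤ Real.exp (-1) := Real.exp_le_exp.2 (by linarith)
      have := Real.exp_neg_one_lt_d9
      norm_num at this ⊢; linarith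
    have h5 : 0.64 * 0.63 ≤ R * (1 - (1 - α) ^ k) := by
      apply mul_le_mul hRl _ (by norm_num) (by linarith)
      norm_num at h4 ⊢; linarith
    rw [h8] at h1
    norm_num at h5 l2' ⊢
    nlinarith
  -- gaussian ranges
  have hR1 : R ≤ 1 := by linarith
  have key : (k:ℝ) / 2 ^ k + (1 - α) ^ k ≤ 2 * (1 / 2 - α) ^ 2 := by
    have hε2 : ((k : ℝ) ^ 2 * (2 : ℝ) ^ (-(k : ℝ) / 2)) ^ 2 = k ^ 4 / 2 ^ k := by
      rw [mul_pow, ← Real.rpow_natCast ((2:ℝ) ^ (-(k : ℝ) / 2)), ← Real.rpow_mul (by norm_num)]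
      rw [show -(k:ℝ) / 2 * ((2:ℕ):ℝ) = -(k:ℝ) by push_cast; ring, Real.rpow_neg (by norm_num), Real.rpow_natCast]
      ring
    have hεpos : 0 < (k : ℝ) ^ 2 * (2 : ℝ) ^ (-(k : ℝ) / 2) := by positivity
    set ε : ℝ := (k : ℝ) ^ 2 * (2 : ℝ) ^ (-(k : ℝ) / 2) with hε
    have hk4 : (k:ℝ) + 8 ≤ 2 * k ^ 4 := by
      have : (27:ℝ) ≤ k ^ 3 := by
        calc (27:ℝ) = 3 ^ 3 := by norm_num
          _ ≤ k ^ 3 := by gcongr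
      have e : (k:ℝ) ^ 4 = k * k ^ 3 := by ring
      rw [e]; nlinarith
    have h2k : (0:ℝ) < 2 ^ k := by positivity
    by_cases r3 : 1 / 2 < α
    · have hlt : ε < α - 1 / 2 := by
        by_contra hc
        apply hmid
        constructor <;> linarith
      have hsq : ε ^ 2 ≤ (1 / 2 - α) ^ 2 := by
        have : (1 / 2 - α) ^ 2 = (α - 1 / 2) ^ 2 := by ring
        rw [this]; exact pow_le_pow_left₀ hεpos.le hlt.le 2
      have hp : (1 - α) ^ k ≤ 1 / 2 ^ k := by
        rw [← one_div_pow]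
        exact pow_le_pow_left₀ (by linarith) (by linarith) k
      calc (k:ℝ) / 2 ^ k + (1 - α) ^ k ≤ (k + 1) / 2 ^ k := by rw [add_div]; linarith
        _ ≤ (2 * k ^ 4) / 2 ^ k := by gcongr; linarith
        _ = 2 * ε ^ 2 := by rw [hε2]; ring
        _ ≤ _ := by linarith
    · have hlt : ε < 1 / 2 - α := by
        by_contra hc
        apply hmid
        constructor <;> linarith
      have hsq : ε ^ 2 ≤ (1 / 2 - α) ^ 2 := pow_le_pow_left₀ hεpos.le hlt.le 2
      by_cases r4 : 1 / 2 - α ≤ 1 / k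
      · have hp : (1 - α) ^ k ≤ 8 / 2 ^ k := by
          have : (1 - α) ^ k = (1 + 2 * (1 / 2 - α)) ^ k / 2 ^ k := by
            rw [← div_pow]; congr 1; ring
          rw [this]
          gcongr
          have h1 : (1 + 2 * (1 / 2 - α)) ^ k ≤ Real.exp (k * (2 * (1 / 2 - α))) := by
            rw [Real.exp_nat_mul]
            apply pow_le_pow_left₀ (by linarith)
            have := Real.add_one_le_exp (2 * (1/2 - α)); linarith
          have h2 : k * (2 * (1 / 2 - α)) ≤ 2 := by
            rw [le_div_iff₀ (by linarith)] at r4; linarith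
          have h3 : Real.exp (k * (2 * (1 / 2 - α))) ≤ Real.exp 2 := Real.exp_le_exp.2 h2
          have h4 : Real.exp 2 ≤ 8 := by
            have : Real.exp 2 = Real.exp 1 ^ 2 := by rw [← Real.exp_nat_mul]; norm_num
            rw [this]
            have := Real.exp_one_lt_d9
            have h0 := Real.exp_pos 1
            have : Real.exp 1 ≤ 2.8 := by norm_num at this ⊢; linarith
            calc Real.exp 1 ^ 2 ≤ 2.8 ^ 2 := by gcongr
              _ ≤ 8 := by norm_num
          linarith
        calc (k:ℝ) / 2 ^ k + (1 - α) ^ k ≤ (k + 8) / 2 ^ k := by rw [add_div]; linarith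
          _ ≤ (2 * k ^ 4) / 2 ^ k := by gcongr
          _ = 2 * ε ^ 2 := by rw [hε2]; ring
          _ ≤ _ := by linarith
      · have h1 : (1 - α) ^ k ≤ (7/8) ^ k := pow_le_pow_left₀ (by linarith) (by linarith) k
        have h2 : (1 / (k:ℝ)) ^ 2 ≤ (1 / 2 - α) ^ 2 := pow_le_pow_left₀ (by positivity) (by linarith) 2
        have h3 : 2 / (k:ℝ) ^ 2 = 2 * (1 / (k:ℝ)) ^ 2 := by rw [one_div_pow]; ring
        rw [h3] at c3; linarith
  refine (choose_le_gauss hn1 hn).trans (Real.exp_le_exp.2 (mul_le_mul_of_nonneg_left ?_ hn0.le))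
  rw [← hαdef]
  nlinarith

lemma mid_ana (k : ℕ) (r : ℝ) (hk : 3 ≤ k) (hR : Real.log 2 - k / 2 ^ k ≤ r / 2 ^ k) (hR2 : r / 2 ^ k ≤ Real.log 2)
    (c1 : 1 + 6 * Real.log k ≤ 0.3 * k) (c2 : (k:ℝ) / 2 ^ k ≤ 0.05)
    (c3 : (7 / 8 : ℝ) ^ k + k / 2 ^ k ≤ 2 / (k:ℝ) ^ 2)
    {n h : ℕ} (hn : h ≤ n) (hn1 : 1 ≤ n) (hα : (k:ℝ) ^ (-6 : ℤ) * n < h)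
    (hmid : ¬(1 / 2 - (k : ℝ) ^ 2 * (2 : ℝ) ^ (-(k : ℝ) / 2) ≤ (h : ℝ) / n ∧
      (h : ℝ) / n ≤ 1 / 2 + (k : ℝ) ^ 2 * (2 : ℝ) ^ (-(k : ℝ) / 2))) :
    (n.choose h : ℝ) * ((2 ^ k - 2) + (1 - (h:ℝ) / n) ^ k) ^ ⌊r * n⌋₊ ≤ (2 ^ k - 1) ^ ⌊r * n⌋₊ * 3 := by
  have core := mid_core k (r / 2 ^ k) hk hR hR2 c1 c2 c3 hn hn1 hα hmid
  have hn0 : (0:ℝ) < n := by exact_mod_cast hn1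
  set y : ℝ := (1 - (h:ℝ) / n) ^ k with hy
  have ha : (h:ℝ) / n ≤ 1 := by rw [div_le_one hn0]; exact_mod_cast hn
  have hy0 : 0 ≤ y := pow_nonneg (by linarith) k
  have hy1 : y ≤ 1 := pow_le_one₀ (by linarith) (by have : 0 ≤ (h:ℝ)/n := by positivity
                                                    linarith)
  set m := ⌊r * n⌋₊ with hm
  have hmr : r * n < m + 1 := Nat.lt_floor_add_one _
  have h2k : (8:ℝ) ≤ 2 ^ k := by
    calc (8:ℝ) = 2 ^ 3 := by norm_num
      _ ≤ 2 ^ k := pow_le_pow_right₀ (by norm_num) hk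
  have h1 : (2 ^ k - 2) + y ≤ (2 ^ k - 1) * Real.exp (-((1 - y) / 2 ^ k)) := by
    have := Real.add_one_le_exp (-((1 - y) / 2 ^ k))
    have h3 : (2 ^ k - 1) * (-((1 - y) / 2 ^ k) + 1) ≤ (2 ^ k - 1) * Real.exp (-((1 - y) / 2 ^ k)) :=
      mul_le_mul_of_nonneg_left this (by linarith)
    refine le_trans ?_ h3
    have : (2 ^ k - 1) * ((1 - y) / 2 ^ k) ≤ 1 - y := by
      rw [mul_div_assoc', div_le_iff₀ (by linarith)]; nlinarith
    linarith
  have h2 : ((2 ^ k - 2) + y) ^ m ≤ (2 ^ k - 1) ^ m * Real.exp (-(m * ((1 - y) / 2 ^ k))) := by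
    rw [← mul_neg, Real.exp_nat_mul, ← mul_pow]
    exact pow_le_pow_left₀ (by linarith) h1 m
  have hp : (0:ℝ) ≤ (2 ^ k - 1) ^ m := pow_nonneg (by linarith) _
  calc _ ≤ Real.exp (n * (r / 2 ^ k * (1 - y))) * ((2 ^ k - 1) ^ m * Real.exp (-(m * ((1 - y) / 2 ^ k)))) := by
        apply mul_le_mul core h2 (pow_nonneg (by linarith) _) (Real.exp_pos _).le
    _ = (2 ^ k - 1) ^ m * Real.exp ((r * n - m) * ((1 - y) / 2 ^ k)) := by
        rw [mul_left_comm, ← Real.exp_add]; congr 2; ring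
    _ ≤ (2 ^ k - 1) ^ m * 3 := by
        apply mul_le_mul_of_nonneg_left _ hp
        have : (r * n - m) * ((1 - y) / 2 ^ k) ≤ 1 := by
          have a : (1 - y) / 2 ^ k ≤ 1 := by rw [div_le_one (by linarith)]; linarith
          have b : 0 ≤ (1 - y) / 2 ^ k := div_nonneg (by linarith) (by linarith)
          nlinarith
        have e := Real.exp_one_lt_d9
        have := Real.exp_le_exp.2 this
        norm_num at e; linarith
end

section
/-! Part B4: the cluster bound -/

/-- the properties of large `k` needed in part B -/
structure KB (k : ℕ) : Prop where
  h4 : 10 ^ 4 ≤ k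
  c1 : 1 + 6 * Real.log k ≤ 0.3 * k
  c2 : (k:ℝ) / 2 ^ k ≤ 0.05
  c3 : (7 / 8 : ℝ) ^ k + k / 2 ^ k ≤ 2 / (k:ℝ) ^ 2
  c4 : 2 * (k:ℝ) ^ 4 ≤ 2 ^ k

lemma tendsto_pow_mul_geom (j : ℕ) (x : ℝ) (h0 : 0 ≤ x) (h1 : x < 1) :
    Tendsto (fun k : ℕ => (k:ℝ) ^ j * x ^ k) atTop (nhds 0) :=
  tendsto_pow_const_mul_const_pow_of_lt_one j h0 h1

lemma KB_eventually : ∀ᶠ k : ℕ in atTop, KB k := by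
  have e1 : ∀ᶠ k : ℕ in atTop, 10 ^ 4 ≤ k := eventually_ge_atTop _
  have e2 : ∀ᶠ k : ℕ in atTop, 1 + 6 * Real.log k ≤ 0.3 * k := by
    have h := Real.isLittleO_log_id_atTop.bound (show (0:ℝ) < 0.01 by norm_num)
    have h' := tendsto_natCast_atTop_atTop (R := ℝ) |>.eventually h
    filter_upwards [h', e1] with k hk hk1
    have h2 : (10000:ℝ) ≤ k := by exact_mod_cast hk1
    have h3 := le_abs_self (Real.log k)
    simp only [id, Real.norm_eq_abs] at hk
    rw [abs_of_nonneg (by positivity : (0:ℝ) ≤ (k:ℝ))] at hk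
    linarith
  have e3 : ∀ᶠ k : ℕ in atTop, (k:ℝ) / 2 ^ k ≤ 0.05 := by
    have := tendsto_pow_mul_geom 1 (1/2) (by norm_num) (by norm_num)
    filter_upwards [this.eventually_le_const (show (0:ℝ) < 0.05 by norm_num)] with k hk
    rw [one_div_pow, pow_one, mul_one_div] at hk; exact hk
  have e4 : ∀ᶠ k : ℕ in atTop, (7 / 8 : ℝ) ^ k + k / 2 ^ k ≤ 2 / (k:ℝ) ^ 2 := by
    have a := tendsto_pow_mul_geom 2 (7/8) (by norm_num) (by norm_num)
    have b := tendsto_pow_mul_geom 3 (1/2) (by norm_num) (by norm_num)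
    filter_upwards [a.eventually_le_const (show (0:ℝ) < 1 by norm_num),
      b.eventually_le_const (show (0:ℝ) < 1 by norm_num), e1] with k h1 h2 h3
    have h3' : (0:ℝ) < k := by exact_mod_cast (by omega : 0 < k)
    rw [le_div_iff₀ (by positivity)]
    rw [one_div_pow] at h2
    have : ((7 / 8 : ℝ) ^ k + k / 2 ^ k) * k ^ 2 = (k:ℝ) ^ 2 * (7/8) ^ k + (k:ℝ) ^ 3 * (1 / 2 ^ k) := by ring
    rw [this]; linarith
  have e5 : ∀ᶠ k : ℕ in atTop, 2 * (k:ℝ) ^ 4 ≤ 2 ^ k := by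
    have b := tendsto_pow_mul_geom 4 (1/2) (by norm_num) (by norm_num)
    filter_upwards [b.eventually_le_const (show (0:ℝ) < 1/2 by norm_num)] with k hk
    rw [one_div_pow, mul_one_div, div_le_iff₀ (by positivity)] at hk; linarith
  filter_upwards [e1, e2, e3, e4, e5] with k h1 h2 h3 h4 h5
  exact ⟨h1, h2, h3, h4, h5⟩

def del (k : ℕ) : ℝ := (k:ℝ) ^ (-(1/4) : ℝ)

lemma del_pow4 {k : ℕ} : del k ^ 4 = 1 / k := by
  unfold del
  rw [← Real.rpow_natCast, ← Real.rpow_mul (by positivity)]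
  norm_num [Real.rpow_neg_one]

lemma del_pos {k : ℕ} (hk : 1 ≤ k) : 0 < del k := by
  have : (0:ℝ) < k := by exact_mod_cast hk
  unfold del; positivity

lemma del_le {k : ℕ} (hk : 10 ^ 4 ≤ k) : del k ≤ 1 / 10 := by
  by_contra h
  push Not at h
  have h2 : (1/10:ℝ) ^ 4 < del k ^ 4 := by gcongr
  rw [del_pow4] at h2
  have h3 : (10000:ℝ) ≤ k := by exact_mod_cast hk
  rw [lt_div_iff₀ (by linarith)] at h2
  linarith

lemma log_one_sub_le {x : ℝ} (h0 : 0 ≤ x) (h1 : x < 1) : Real.log (1 - x) ≤ -x - x ^ 2 / 2 := by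
  have h := Real.hasSum_pow_div_log_of_abs_lt_one (abs_lt.2 ⟨by linarith, h1⟩)
  have := sum_le_hasSum (Finset.range 2) (fun i _ => by positivity) h
  simp [Finset.sum_range_succ] at this
  norm_num at this
  linarith

section
variable {k : ℕ} {r : ℝ}

lemma r_facts (K : KB k) (hr : rbal k < r) (hr2 : r < 2 ^ k * Real.log 2 - (3/2) * Real.log 2 - del k) :
    Real.log 2 - k / 2 ^ k ≤ r / 2 ^ k ∧ r / 2 ^ k ≤ Real.log 2 ∧ 1 ≤ r := by
  have hk : (10000:ℝ) ≤ k := by exact_mod_cast K.h4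
  have hd := del_pos (by have := K.h4; omega : 1 ≤ k)
  have l2 := Real.log_two_gt_d9
  have l2' := Real.log_two_lt_d9
  have h2k : (0:ℝ) < 2 ^ k := by positivity
  have hlow : 2 ^ k * Real.log 2 - k ≤ r := by
    unfold rbal at hr; norm_num at l2'; nlinarith
  refine ⟨?_, ?_, ?_⟩
  · rw [le_div_iff₀ h2k, sub_mul, div_mul_cancel₀ _ h2k.ne']; linarith
  · rw [div_le_iff₀ h2k]; linarith
  · have := K.c2
    rw [div_le_iff₀ h2k] at this
    norm_num at this l2
    nlinarith

lemma EZ_bound (K : KB k) (hr : rbal k < r) (hr2 : r < 2 ^ k * Real.log 2 - (3/2) * Real.log 2 - del k)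
    (n : ℕ) :
    (2:ℝ) ^ n * (1 - 1 / 2 ^ k) ^ ⌊r * n⌋₊ ≤
      2 * Real.exp (n / 2 ^ k * ((2 ^ k * Real.log 2 - r) - Real.log 2 / 2 + 1 / k)) := by
  obtain ⟨h1, h2, h3⟩ := r_facts K hr hr2
  have hk : (10000:ℝ) ≤ k := by exact_mod_cast K.h4
  have hk0 : (0:ℝ) < k := by linarith
  have h2k : (0:ℝ) < 2 ^ k := by positivity
  have c2 := K.c2
  have c4 := K.c4
  set x : ℝ := 1 / 2 ^ k with hx
  have hx0 : 0 < x := by positivity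
  have hkx : (k:ℝ) * x ≤ 0.05 := by rw [hx, mul_one_div]; exact c2
  have hx1 : x ≤ 0.05 := by
    nlinarith
  have hlog := log_one_sub_le hx0.le (by linarith)
  have hm : r * n - 1 ≤ (⌊r * n⌋₊ : ℝ) := by have := Nat.lt_floor_add_one (r * n); linarith
  have hm0 : (0:ℝ) ≤ (⌊r * n⌋₊ : ℝ) := by positivity
  have e : (2:ℝ) ^ n * (1 - x) ^ ⌊r * n⌋₊ = Real.exp (n * Real.log 2 + ⌊r * n⌋₊ * Real.log (1 - x)) := by
    rw [Real.exp_add, Real.exp_nat_mul, Real.exp_nat_mul, Real.exp_log (by norm_num), Real.exp_log (by linarith)]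
  rw [e]
  have hL2 : Real.exp (1/2) ≤ 2 := by
    have : Real.exp (1/2) ≤ Real.exp (Real.log 2) := Real.exp_le_exp.2 (by have := Real.log_two_gt_d9; norm_num at this; linarith)
    rwa [Real.exp_log (by norm_num)] at this
  refine le_trans ?_ (mul_le_mul_of_nonneg_right hL2 (Real.exp_pos _).le)
  rw [← Real.exp_add, Real.exp_le_exp]
  have hR1 : r / 2 ^ k = r * x := by rw [hx]; ring
  have hR3 : (k:ℝ) / 2 ^ k = k * x := by rw [hx]; ring
  rw [hR1, hR3] at h1
  have hn0 : (0:ℝ) ≤ n := by positivity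
  have a1 : (⌊r * n⌋₊ : ℝ) * Real.log (1 - x) ≤ (r * n - 1) * (-x - x ^ 2 / 2) := by
    calc _ ≤ (⌊r * n⌋₊ : ℝ) * (-x - x^2/2) := mul_le_mul_of_nonneg_left hlog hm0
      _ ≤ _ := by
        have : (-x - x^2/2) ≤ 0 := by nlinarith
        exact mul_le_mul_of_nonpos_right hm this
  have e2 : (n:ℝ) / 2 ^ k * ((2 ^ k * Real.log 2 - r) - Real.log 2 / 2 + 1 / k) =
      n * Real.log 2 - n * (r * x) - n * x * (Real.log 2 / 2) + n * x * (1 / k) := by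
    rw [hx]; field_simp
  rw [e2]
  have hkk : k * x ≤ 2 * (1 / k) := by
    rw [hx, mul_one_div, mul_one_div, div_le_div_iff₀ h2k hk0]
    have : (1:ℝ) ≤ k := by linarith
    nlinarith [pow_le_pow_right₀ this (show 2 ≤ 4 by norm_num)]
  have a2 : n * x * (Real.log 2 - k * x) ≤ n * x * (r * x) := by gcongr
  have a3 : n * x * (k * x) ≤ n * x * (2 * (1 / k)) := by gcongr
  nlinarith

set_option maxHeartbeats 2000000 in
/-- Markov step and combination. -/
lemma cluster_main (K : KB k) (hr : rbal k < r) (hr2 : r < 2 ^ k * Real.log 2 - (3/2) * Real.log 2 - del k)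
    (n : ℕ) (hn : 1 ≤ n) (σ : Assignment n) (L : ℝ)
    (hL : L = Real.exp (n / 2 ^ k * ((2 ^ k * Real.log 2 - r) - Real.log 2 / 2 - 1 / k))) :
    ((univ.filter fun Φ : Formula n k ⌊r * n⌋₊ => Satisfies σ Φ ∧ L < clusterSize n k _ Φ σ).card : ℝ) ≤
    ((2 ^ k - 1) * (n : ℝ) ^ k) ^ ⌊r * n⌋₊ * ((9 + 6 * n) * Real.exp (-(n / 2 ^ k * (5 / k)))) := by
  obtain ⟨hR1, hR2, hr1⟩ := r_facts K hr hr2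
  set m := ⌊r * (n:ℝ)⌋₊ with hmdef
  set α : ℝ := (k:ℝ) ^ (-6 : ℤ) with hα
  set P : ℕ → Prop := fun h => α * n < h ∧ ¬(1 / 2 - (k : ℝ) ^ 2 * (2 : ℝ) ^ (-(k : ℝ) / 2) ≤ (h : ℝ) / n ∧
      (h : ℝ) / n ≤ 1 / 2 + (k : ℝ) ^ 2 * (2 : ℝ) ^ (-(k : ℝ) / 2)) with hP
  have hkN := K.h4
  have hk : (10000:ℝ) ≤ k := by exact_mod_cast K.h4
  have hk0 : (0:ℝ) < k := by linarith
  have hk1 : (1:ℝ) ≤ k := by linarith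
  have h2k : (0:ℝ) < 2 ^ k := by positivity
  have hn0 : (0:ℝ) < n := by exact_mod_cast hn
  have hn1 : (1:ℝ) ≤ n := by exact_mod_cast hn
  set q := del k with hq
  have hq0 : 0 < q := del_pos (by omega)
  have hq1 : q ≤ 1 / 10 := del_le K.h4
  have hq4 : q ^ 4 = 1 / k := del_pow4
  have hα0 : 0 < α := by positivity
  have hLpos : 0 < L := by rw [hL]; positivity
  have hT : 0 < L / 2 := by linarith
  set S : ℝ := ((2 ^ k - 1) * (n : ℝ) ^ k) ^ m with hS
  have h2k1 : (1:ℝ) ≤ 2 ^ k := one_le_pow₀ (by norm_num)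
  have hS0 : 0 ≤ S := pow_nonneg (mul_nonneg (by linarith) (by positivity)) _
  -- splitting
  set mid : Formula n k m → ℝ := fun Φ => ∑ τ : Assignment n,
      if P (hdist σ τ) ∧ Satisfies σ Φ ∧ Satisfies τ Φ then (1:ℝ) else 0 with hmid
  have hmid0 : ∀ Φ, 0 ≤ mid Φ := fun Φ => Finset.sum_nonneg fun τ _ => by split_ifs <;> norm_num
  have hsplit : ∀ Φ : Formula n k m, Satisfies σ Φ → (clusterSize n k m Φ σ : ℝ) ≤ clLoc α Φ σ + mid Φ := by
    intro Φ hΦ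
    unfold clusterSize clLoc
    rw [hmid, ← Finset.sum_add_distrib, Finset.card_filter]
    push_cast
    refine Finset.sum_le_sum fun τ _ => ?_
    by_cases hs : Satisfies τ Φ
    · by_cases hl : (hdist σ τ : ℝ) ≤ α * n
      · simp only [hs, hl, true_and, and_self, if_true, hΦ]
        have : (0:ℝ) ≤ if P (hdist σ τ) ∧ True then (1:ℝ) else 0 := by split_ifs <;> norm_num
        split_ifs <;> norm_num
      · simp only [hs, hΦ, hl, hP, true_and, not_le.1 hl, and_true, if_false, zero_add]
        simp
    · simp [hs]
  have hsub : ((univ.filter fun Φ : Formula n k m => Satisfies σ Φ ∧ L < clusterSize n k m Φ σ).card : ℝ) ≤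
      ((univ.filter fun Φ : Formula n k m => Satisfies σ Φ ∧ L / 2 < clLoc α Φ σ).card : ℝ) +
      (∑ Φ, mid Φ) / (L / 2) := by
    rw [Finset.card_filter, Finset.card_filter, Finset.sum_div]
    push_cast
    rw [← Finset.sum_add_distrib]
    refine Finset.sum_le_sum fun Φ _ => ?_
    have hq := div_nonneg (hmid0 Φ) hT.le
    by_cases hs : Satisfies σ Φ ∧ L < clusterSize n k m Φ σ
    · rw [if_pos hs]
      by_cases h2 : L / 2 < clLoc α Φ σ
      · rw [if_pos ⟨hs.1, h2⟩]; linarith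
      · have := hsplit Φ hs.1
        have h3 : 1 ≤ mid Φ / (L / 2) := by
          rw [le_div_iff₀ hT]; linarith [hs.2, not_lt.1 h2]
        split_ifs <;> linarith
    · rw [if_neg hs]
      split_ifs <;> linarith
  have hmidsum : (∑ Φ, mid Φ) ≤ S * ((n + 1) * 3) := by
    have h := mid_sum (k := k) (m := m) hn σ P 3 (fun h hh hPh =>
      mid_ana k r (by omega) hR1 hR2 K.c1 K.c2 K.c3 hh hn hPh.1 hPh.2) (by norm_num)
    rw [hmid]; convert h
  -- theta
  set θ : ℝ := ((k:ℝ) - 1) * α with hθ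
  have hθ0 : 0 ≤ θ := mul_nonneg (by linarith) hα0.le
  have hαq : α = q ^ 24 := by
    rw [show q ^ 24 = (q ^ 4) ^ 6 by ring, hq4, hα]; simp [zpow_neg]
  have hθq : θ ≤ q ^ 20 := by
    have : q ^ 20 = k * α := by
      rw [hαq, show q ^ 24 = q ^ 4 * q ^ 20 by ring, hq4]; field_simp
    rw [this, hθ]; nlinarith
  have hη : Real.sqrt θ ≤ q ^ 10 := by
    rw [Real.sqrt_le_left (by positivity)]
    calc θ ≤ q ^ 20 := hθq
      _ = _ := by ring
  have hη0 := Real.sqrt_nonneg θ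
  have hθ1 : θ ≤ 1 := hθq.trans (pow_le_one₀ hq0.le (by linarith))
  set s : ℝ := q / 4 with hs
  set T1 : ℝ := Real.exp (n / 2 ^ k * (Real.log 2 + q / 2)) with hT1
  have hloc := loc_bound (m := m) (by omega : 2 ≤ k) hn σ α s T1 (L / 2) hα0.le hθ1 (by positivity)
    (by rw [hs]; linarith) (by positivity) hT
  rw [← hθ] at hloc
  set η := Real.sqrt θ with hηdef
  -- lambda
  have l2 := Real.log_two_gt_d9
  have l2' := Real.log_two_lt_d9
  norm_num at l2 l2'
  have hkq : (k:ℝ) * q ^ 10 = q ^ 6 := by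
    have : (k:ℝ) * q ^ 4 = 1 := by rw [hq4]; field_simp
    calc (k:ℝ) * q ^ 10 = (k * q ^ 4) * q ^ 6 := by ring
      _ = _ := by rw [this, one_mul]
  have hk2 : 2 * (k:ℝ) ^ 2 / 2 ^ k ≤ q ^ 6 := by
    have h8 : q ^ 8 = 1 / k ^ 2 := by
      rw [show q ^ 8 = (q ^ 4) ^ 2 by ring, hq4, one_div_pow]
    have : 2 * (k:ℝ) ^ 2 / 2 ^ k ≤ q ^ 8 := by
      rw [h8, div_le_div_iff₀ h2k (by positivity)]
      have := K.c4
      calc 2 * (k:ℝ) ^ 2 * k ^ 2 = 2 * (k:ℝ)^4 := by ring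
        _ ≤ _ := by linarith
    refine this.trans (pow_le_pow_of_le_one hq0.le (by linarith) (by norm_num))
  have hlam : k * Real.log 2 - q ^ 6 ≤ lam n k m := by
    have hm1 : r * n - 1 ≤ m := by have := Nat.lt_floor_add_one (r * n); linarith
    have hA : (r - 1) / 2 ^ k * k ≤ lam n k m := by
      unfold lam
      have : (r - 1) * n ≤ m := by nlinarith
      calc (r - 1) / 2 ^ k * k = ((r - 1) * n) * (k / (2 ^ k * n)) := by field_simp
        _ ≤ m * (k / (2 ^ k * n)) := by gcongr
        _ ≤ _ := by
          have hh : (1:ℝ) < 2 ^ k := one_lt_pow₀ (by norm_num) (by omega)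
          have : 0 < 2 ^ k - (1:ℝ) := by linarith
          gcongr; linarith
    have hB : k * Real.log 2 - 2 * (k:ℝ) ^ 2 / 2 ^ k ≤ (r - 1) / 2 ^ k * k := by
      have : Real.log 2 - 2 * k / 2 ^ k ≤ (r - 1) / 2 ^ k := by
        rw [sub_div]
        have : (1:ℝ) / 2 ^ k ≤ k / 2 ^ k := by gcongr
        have e : 2 * (k:ℝ) / 2 ^ k = k / 2 ^ k + k / 2 ^ k := by ring
        linarith
      have := mul_le_mul_of_nonneg_right this hk0.le
      refine le_trans (le_of_eq ?_) this
      ring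
    linarith
  have hlam2 : k * Real.log 2 - 2 * q ^ 6 ≤ lam n k m * (1 - η) := by
    have h1η : 0 ≤ 1 - η := by
      have : q ^ 10 ≤ 1 := pow_le_one₀ hq0.le (by linarith)
      linarith
    have hkη : k * η ≤ q ^ 6 := by
      rw [← hkq]; gcongr
    have a := mul_le_mul_of_nonneg_right hlam h1η
    have q6 : 0 ≤ q ^ 6 := by positivity
    have : k * η * Real.log 2 ≤ k * η := mul_le_of_le_one_right (mul_nonneg hk0.le hη0) (by linarith)
    have b : 0 ≤ q ^ 6 * η := mul_nonneg q6 hη0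
    have e : (k * Real.log 2 - q ^ 6) * (1 - η) = k * Real.log 2 - q ^ 6 - k * η * Real.log 2 + q ^ 6 * η := by ring
    linarith
  have hexp : Real.exp (-(k * Real.log 2)) = 1 / 2 ^ k := by
    rw [Real.exp_neg, Real.exp_nat_mul, Real.exp_log (by norm_num), one_div]
  set Eq : ℝ := Real.exp (2 * q ^ 6) with hEq
  have q6 : 0 < q ^ 6 := by positivity
  have q6' : q ^ 6 ≤ 1 / 10 ^ 6 := by
    calc q ^ 6 ≤ (1/10) ^ 6 := by gcongr
      _ = _ := by norm_num
  have hE1 : Real.exp (-lam n k m) ≤ 1 / 2 ^ k * Eq := by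
    rw [← hexp, hEq, ← Real.exp_add, Real.exp_le_exp]; linarith
  have hE2 : Real.exp (-(lam n k m * (1 - η))) ≤ 1 / 2 ^ k * Eq := by
    rw [← hexp, hEq, ← Real.exp_add, Real.exp_le_exp]; linarith
  have hEq4 : Eq ≤ 1 + 4 * q ^ 6 := by
    have := Real.abs_exp_sub_one_le (x := 2 * q ^ 6) (by rw [abs_of_pos (by positivity)]; linarith [show (1:ℝ)/10^6 ≤ 1/2 by norm_num])
    rw [abs_of_pos (show 0 < 2 * q ^ 6 by positivity)] at this
    have := le_abs_self (Real.exp (2 * q ^ 6) - 1)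
    rw [hEq]; linarith
  have hEq0 : 0 < Eq := Real.exp_pos _
  have h2s : (2:ℝ) ^ s - 1 ≤ s * Real.log 2 + s ^ 2 := by
    rw [Real.rpow_def_of_pos (by norm_num)]
    have hx1 : |Real.log 2 * s| ≤ 1 := by
      rw [abs_of_nonneg (by positivity)]; rw [hs]; nlinarith
    have := Real.abs_exp_sub_one_sub_id_le hx1
    have := le_abs_self (Real.exp (Real.log 2 * s) - 1 - Real.log 2 * s)
    have : (Real.log 2 * s) ^ 2 ≤ s ^ 2 := by
      rw [mul_pow]
      have : Real.log 2 ^ 2 ≤ 1 := by nlinarith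
      nlinarith [sq_nonneg s]
    linarith
  have h2s0 : 0 ≤ (2:ℝ) ^ s - 1 := by
    have := Real.one_le_rpow (by norm_num : (1:ℝ) ≤ 2) (show 0 ≤ s by positivity)
    linarith
  have t1 : T1 ^ (-s) * Real.exp (n * ((2 ^ s - 1) * Real.exp (- lam n k m) + η *
        Real.exp (- (lam n k m * (1 - η))))) ≤ Real.exp (-(n / 2 ^ k * (5 / k))) := by
    rw [hT1, ← Real.exp_mul, ← Real.exp_add, Real.exp_le_exp]
    have hb : (2 ^ s - 1) * Real.exp (- lam n k m) + η * Real.exp (- (lam n k m * (1 - η))) ≤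
        1 / 2 ^ k * ((s * Real.log 2 + s ^ 2 + q ^ 10) * (1 + 4 * q ^ 6)) := by
      calc _ ≤ (s * Real.log 2 + s ^ 2) * (1 / 2 ^ k * Eq) + q ^ 10 * (1 / 2 ^ k * Eq) := by
            gcongr
        _ = 1 / 2 ^ k * ((s * Real.log 2 + s ^ 2 + q ^ 10) * Eq) := by ring
        _ ≤ _ := by gcongr
    have hc : (s * Real.log 2 + s ^ 2 + q ^ 10) * (1 + 4 * q ^ 6) - s * (Real.log 2 + q / 2) ≤ - (5 / k) := by
      have : (5:ℝ) / k = 5 * q ^ 4 := by rw [hq4]; ring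
      rw [this, hs]
      have q2 : q ^ 2 ≤ 1 / 100 := by nlinarith
      have p7 : q ^ 7 ≤ q ^ 4 * (1/1000) := by
        calc q ^ 7 = q ^ 4 * q ^ 3 := by ring
          _ ≤ q ^ 4 * (1/10) ^ 3 := by gcongr
          _ = _ := by norm_num
      have p8 : q ^ 8 ≤ q ^ 4 * (1/1000) := by
        calc q ^ 8 = q ^ 7 * q := by ring
          _ ≤ q ^ 7 * 1 := by gcongr; linarith
          _ ≤ _ := by linarith
      have p10 : q ^ 10 ≤ q ^ 4 * (1/1000) := by
        calc q ^ 10 = q ^ 7 * q ^ 3 := by ring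
          _ ≤ q ^ 7 * 1 := by gcongr; exact pow_le_one₀ hq0.le (by linarith)
          _ ≤ _ := by linarith
      have p16 : q ^ 16 ≤ q ^ 4 * (1/1000) := by
        calc q ^ 16 = q ^ 10 * q ^ 6 := by ring
          _ ≤ q ^ 10 * 1 := by gcongr; exact pow_le_one₀ hq0.le (by linarith)
          _ ≤ _ := by linarith
      have p4 : q ^ 4 ≤ q ^ 2 * (1/100) := by
        calc q ^ 4 = q ^ 2 * q ^ 2 := by ring
          _ ≤ _ := by gcongr
      have e : (q / 4 * Real.log 2 + (q / 4) ^ 2 + q ^ 10) * (1 + 4 * q ^ 6) - q / 4 * (Real.log 2 + q / 2) =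
        q ^ 7 * Real.log 2 + (-1/16) * q ^ 2 + q ^ 8 / 4 + q ^ 10 + 4 * q ^ 16 := by ring
      rw [e]
      have q4 : 0 < q ^ 4 := by positivity
      have q7 : 0 < q ^ 7 := by positivity
      have q7l : q ^ 7 * Real.log 2 ≤ q ^ 7 := mul_le_of_le_one_right q7.le (by linarith)
      linarith
    have hd := mul_le_mul_of_nonneg_left hb hn0.le
    have hf := mul_le_mul_of_nonneg_left hc (show 0 ≤ (n:ℝ) / 2 ^ k by positivity)
    have e3 : (n:ℝ) * (1 / 2 ^ k * ((s * Real.log 2 + s ^ 2 + q ^ 10) * (1 + 4 * q ^ 6))) =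
        n / 2 ^ k * ((s * Real.log 2 + s ^ 2 + q ^ 10) * (1 + 4 * q ^ 6)) := by ring
    rw [e3] at hd
    have e4 : (n:ℝ) / 2 ^ k * (Real.log 2 + q / 2) * -s = - (n / 2 ^ k * (s * (Real.log 2 + q / 2))) := by ring
    rw [e4]
    have e5 : (n:ℝ) / 2 ^ k * ((s * Real.log 2 + s ^ 2 + q ^ 10) * (1 + 4 * q ^ 6) - s * (Real.log 2 + q / 2)) =
      n / 2 ^ k * ((s * Real.log 2 + s ^ 2 + q ^ 10) * (1 + 4 * q ^ 6)) - n / 2 ^ k * (s * (Real.log 2 + q / 2)) := by ring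
    rw [e5, mul_neg] at hf
    linarith
  have hLlow : Real.exp (n / 2 ^ k * (Real.log 2 + q - 1 / k)) ≤ L := by
    rw [hL, Real.exp_le_exp]
    gcongr
    linarith
  have hq41 : q ^ 4 ≤ q * (1/1000) := by
    calc q ^ 4 = q * q ^ 3 := by ring
      _ ≤ q * (1/10) ^ 3 := by gcongr
      _ = _ := by norm_num
  have t2 : T1 / (L / 2) ≤ 2 * Real.exp (-(n / 2 ^ k * (5 / k))) := by
    rw [div_le_iff₀ hT]
    calc T1 ≤ Real.exp (-(n / 2 ^ k * (5 / k))) * Real.exp (n / 2 ^ k * (Real.log 2 + q - 1 / k)) := by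
          rw [hT1, ← Real.exp_add, Real.exp_le_exp, ← mul_neg, ← mul_add]
          apply mul_le_mul_of_nonneg_left _ (by positivity)
          have : (5:ℝ) / k = 5 * q ^ 4 := by rw [hq4]; ring
          rw [this, ← hq4]; linarith
      _ ≤ Real.exp (-(n / 2 ^ k * (5 / k))) * L := by gcongr
      _ = _ := by ring
  have t3 : (1:ℝ) ≤ Real.exp (-(n / 2 ^ k * (5 / k))) * L := by
    calc (1:ℝ) ≤ Real.exp (-(n / 2 ^ k * (5 / k))) * Real.exp (n / 2 ^ k * (Real.log 2 + q - 1 / k)) := by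
          rw [← Real.exp_add, ← mul_neg, ← mul_add]
          apply Real.one_le_exp
          apply mul_nonneg (by positivity)
          have : (5:ℝ) / k = 5 * q ^ 4 := by rw [hq4]; ring
          rw [this, ← hq4]; linarith
      _ ≤ _ := by gcongr
  have t4 : (∑ Φ, mid Φ) / (L / 2) ≤ S * ((6 * n + 6) * Real.exp (-(n / 2 ^ k * (5 / k)))) := by
    rw [div_le_iff₀ hT]
    calc _ ≤ S * ((n + 1) * 3) * 1 := by rw [mul_one]; exact hmidsum
      _ ≤ S * ((n + 1) * 3) * (Real.exp (-(n / 2 ^ k * (5 / k))) * L) := by gcongr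
      _ = _ := by ring
  calc _ ≤ _ := hsub
    _ ≤ S * (Real.exp (-(n / 2 ^ k * (5 / k))) + 2 * Real.exp (-(n / 2 ^ k * (5 / k)))) +
        S * ((6 * n + 6) * Real.exp (-(n / 2 ^ k * (5 / k)))) := by
        refine add_le_add (hloc.trans ?_) t4
        exact mul_le_mul_of_nonneg_left (add_le_add t1 t2) hS0
    _ = _ := by ring

lemma cluster_final (K : KB k) (hr : rbal k < r) (hr2 : r < 2 ^ k * Real.log 2 - (3/2) * Real.log 2 - del k)
    (n : ℕ) (hn : 1 ≤ n) (L : ℝ)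
    (hL : L = Real.exp (n / 2 ^ k * ((2 ^ k * Real.log 2 - r) - Real.log 2 / 2 - 1 / k))) :
    ∑ Φ : Formula n k ⌊r * n⌋₊,
      ((univ.filter fun σ : Assignment n => Satisfies σ Φ ∧ L < clusterSize n k _ Φ σ).card : ℝ) ≤
    (Fintype.card (Formula n k ⌊r * n⌋₊) : ℝ) * L * ((18 + 12 * n) * Real.exp (-(n / 2 ^ k * (3 / k)))) := by
  set m := ⌊r * (n:ℝ)⌋₊ with hmdef
  have hkN := K.h4
  have h2k : (0:ℝ) < 2 ^ k := by positivity
  have hEZ := EZ_bound K hr hr2 n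
  rw [← hmdef] at hEZ
  have e1 : ∑ Φ : Formula n k m,
      ((univ.filter fun σ : Assignment n => Satisfies σ Φ ∧ L < clusterSize n k _ Φ σ).card : ℝ) =
      ∑ σ : Assignment n, ((univ.filter fun Φ : Formula n k m => Satisfies σ Φ ∧ L < clusterSize n k _ Φ σ).card : ℝ) := by
    simp only [Finset.card_filter]
    push_cast
    rw [Finset.sum_comm]
  rw [e1]
  refine (Finset.sum_le_card_nsmul _ _ _ fun σ _ => cluster_main K hr hr2 n hn σ L hL).trans ?_
  rw [← hmdef, Finset.card_univ, card_Formula, nsmul_eq_mul]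
  have e2 : (Fintype.card (Assignment n) : ℝ) = 2 ^ n := by simp [Assignment]
  have e3 : ((2 ^ k - 1) * (n : ℝ) ^ k) ^ m = (((2 * n) ^ k) ^ m : ℝ) * (1 - 1 / 2 ^ k) ^ m := by
    rw [← mul_pow, mul_pow 2]; congr 1; field_simp
  rw [e2, e3]
  push_cast
  set W : ℝ := ((2 * n) ^ k) ^ m with hW
  have hW0 : 0 ≤ W := by positivity
  have e4 : 2 * Real.exp (n / 2 ^ k * ((2 ^ k * Real.log 2 - r) - Real.log 2 / 2 + 1 / k)) *
    Real.exp (-(n / 2 ^ k * (5 / k))) = L * (2 * Real.exp (-(n / 2 ^ k * (3 / k)))) := by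
    rw [hL, mul_assoc, ← Real.exp_add, mul_left_comm, ← Real.exp_add]
    congr 2; ring
  calc _ = W * ((9 + 6 * n) * ((2 ^ n * (1 - 1 / 2 ^ k) ^ m) * Real.exp (-(n / 2 ^ k * (5 / k))))) := by ring
    _ ≤ W * ((9 + 6 * n) * ((2 * Real.exp (n / 2 ^ k * ((2 ^ k * Real.log 2 - r) - Real.log 2 / 2 + 1 / k))) *
         Real.exp (-(n / 2 ^ k * (5 / k))))) := by gcongr
    _ = _ := by rw [e4]; ring
end
end

section
/-! Part C1: typical + reserve -/

section C1
variable {ι α : Type} [Fintype ι] [DecidableEq ι] [Fintype α]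

lemma Ex_coord (p : ι → α → ℝ) (h1 : ∀ i, ∑ a, p i a = 1) (i : ι) (g : α → ℝ) :
    Ex p (fun w => g (w i)) = ∑ a, p i a * g a := by
  have e : ∀ w : ι → α, PW p w * g (w i) = ∏ j, (p j (w j) * if j = i then g (w j) else 1) := by
    intro w
    rw [Finset.prod_mul_distrib, Finset.prod_ite_eq' univ i]
    simp [PW]
  unfold Ex
  rw [Finset.sum_congr rfl fun w _ => e w, sum_prod_eq (fun j a => p j a * if j = i then g a else 1)]
  rw [Finset.prod_eq_single i]
  · simp
  · intro j _ hj; simp [hj, h1]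
  · simp

lemma TR {Q : Type} [Fintype Q] [Inhabited α] (p : ι → α → ℝ)
    (hp : ∀ i a, 0 ≤ p i a) (h1 : ∀ i, ∑ a, p i a = 1) (J : Finset ι) (c : ℝ) (hc : 0 < c)
    (f : Q → ι → α → ℝ) (t : ℝ) (ht : 0 < t) (M : Q → ι → ℝ)
    (hM : ∀ q i a b, |f q i a - f q i b| ≤ M q i)
    (hV : ∑ q, ∑ i ∈ Jᶜ, M q i ^ 2 ≤ t ^ 2 / 2) (E : Finset (ι → α))
    (h : ∀ w : ι → α, (∀ i, 0 < p i (w i)) → (∀ q, |∑ i ∈ Jᶜ, (f q i (w i) - ∑ a, p i a * f q i a)| ≤ t) →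
      ∃ w' ∈ E, (∀ i, i ∉ J → w' i = w i) ∧ ∀ i ∈ J, c ≤ p i (w' i)) :
    c ^ J.card / 2 ≤ ∑ w ∈ E, PW p w := by
  set F : Q → (ι → α) → ℝ := fun q w => ∑ i ∈ Jᶜ, f q i (w i) with hF
  have hEF : ∀ q, Ex p (F q) = ∑ i ∈ Jᶜ, ∑ a, p i a * f q i a := by
    intro q
    rw [hF]; simp only
    rw [Ex_sum]
    exact Finset.sum_congr rfl fun i _ => Ex_coord p h1 i _
  have hvar : ∀ q, Ex p (fun w => F q w ^ 2) - (Ex p (F q)) ^ 2 ≤ ∑ i ∈ Jᶜ, M q i ^ 2 := by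
    intro q
    refine (efron_stein p hp h1 (fun _ => default) (F q)).trans ?_
    rw [← Finset.sum_add_sum_compl J]
    have z : ∑ i ∈ J, Ex p (fun w => (F q w - F q (Function.update w i default)) ^ 2) = 0 := by
      refine Finset.sum_eq_zero fun i hi => ?_
      have : (fun w => (F q w - F q (Function.update w i default)) ^ 2) = fun _ => (0:ℝ) := by
        ext w
        have : F q (Function.update w i default) = F q w := by
          refine Finset.sum_congr rfl fun j hj => ?_
          rw [Function.update_of_ne]
          rintro rfl; simp at hj; exact hj hi
        rw [this]; ring
      rw [this, Ex_const h1]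
    rw [z, zero_add]
    refine Finset.sum_le_sum fun i hi => ?_
    calc _ ≤ Ex p (fun _ => M q i ^ 2) := by
          refine Ex_mono hp fun w => ?_
          have : F q w - F q (Function.update w i default) = f q i (w i) - f q i default := by
            rw [hF]; simp only
            rw [← Finset.sum_sub_distrib, Finset.sum_eq_single i]
            · simp
            · intro j _ hj; rw [Function.update_of_ne hj]; ring
            · intro h; exact absurd hi h
          rw [this]
          exact sq_le_sq' (abs_le.1 (hM q i _ _)).1 (abs_le.1 (hM q i _ _)).2
      _ = _ := Ex_const h1 _
  set typ : Finset (ι → α) := univ.filter fun w => (∀ i, 0 < p i (w i)) ∧ ∀ q, |F q w - Ex p (F q)| ≤ t with htyp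
  have hbad : ∑ w ∈ typᶜ, PW p w ≤ 1 / 2 := by
    calc ∑ w ∈ typᶜ, PW p w ≤ ∑ q, Ex p (fun w => if t ≤ |F q w - Ex p (F q)| then 1 else 0) := by
          rw [← Ex_sum]
          change _ ≤ ∑ w, PW p w * _
          rw [← Finset.sum_add_sum_compl typᶜ]
          refine le_add_of_le_of_nonneg (Finset.sum_le_sum fun w hw => ?_)
            (Finset.sum_nonneg fun w _ => mul_nonneg (PW_nonneg hp w) (Finset.sum_nonneg fun q _ => by split_ifs <;> norm_num))
          by_cases hpos : ∀ i, 0 < p i (w i)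
          swap
          · push Not at hpos
            obtain ⟨i, hi⟩ := hpos
            have : PW p w = 0 := Finset.prod_eq_zero (Finset.mem_univ i) (le_antisymm hi (hp _ _))
            rw [this, zero_mul]
          refine le_mul_of_one_le_right (PW_nonneg hp w) ?_
          simp only [not_and, hpos, forall_const, implies_true, htyp, Finset.mem_compl, Finset.mem_filter, Finset.mem_univ, true_and, not_forall, not_le] at hw
          obtain ⟨q, hq⟩ := hw
          refine le_trans ?_ (Finset.single_le_sum (fun q _ => by split_ifs <;> norm_num) (Finset.mem_univ q))
          rw [if_pos hq.le]
      _ ≤ ∑ q, (∑ i ∈ Jᶜ, M q i ^ 2) / t ^ 2 :=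
          Finset.sum_le_sum fun q _ => chebyshev_Ex p hp h1 (F q) _ t ht (hvar q)
      _ ≤ 1 / 2 := by
          rw [← Finset.sum_div, div_le_iff₀ (by positivity)]; linarith
  have htot : ∑ w ∈ typ, PW p w + ∑ w ∈ typᶜ, PW p w = 1 := by
    rw [Finset.sum_add_sum_compl]
    have := Ex_const h1 1
    unfold Ex at this
    simpa using this
  have hr := reserve p hp h1 J c hc typ E (by
    intro w hw
    apply h w (Finset.mem_filter.1 hw).2.1
    intro q
    have := (Finset.mem_filter.1 hw).2.2 q
    rw [hEF q] at this
    rw [Finset.sum_sub_distrib]; exact this)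
  refine le_trans ?_ hr
  have : (1:ℝ) / 2 ≤ ∑ w ∈ typ, PW p w := by linarith
  calc c ^ J.card / 2 = c ^ J.card * (1 / 2) := by ring
    _ ≤ _ := by gcongr
end C1

/-- rounding lemma -/
lemma rounding {ι : Type} [DecidableEq ι] (s : Finset ι) (u : ι → ℝ) (B : ℤ) (hB : |(B:ℝ) - ∑ i ∈ s, u i| ≤ s.card) :
    ∃ c : ι → ℤ, (∀ i, |(c i : ℝ) - u i| ≤ 2) ∧ ∑ i ∈ s, c i = B := by
  -- floors have sum within card of target; distribute the difference
  set S : ℤ := ∑ i ∈ s, ⌊u i⌋ with hS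
  have hSle : (S:ℝ) ≤ ∑ i ∈ s, u i := by
    rw [hS]; push_cast; exact Finset.sum_le_sum fun i _ => Int.floor_le _
  have hSge : ∑ i ∈ s, u i ≤ S + s.card := by
    rw [hS]; push_cast
    rw [← nsmul_one, ← Finset.sum_const, ← Finset.sum_add_distrib]
    exact Finset.sum_le_sum fun i _ => (Int.lt_floor_add_one _).le
  have hb := abs_le.1 hB
  have h1 : B - S ≤ 2 * s.card := by
    have : ((B - S : ℤ) : ℝ) ≤ ((2 * s.card : ℤ) : ℝ) := by push_cast; linarith
    exact_mod_cast this
  have h2 : -(s.card : ℤ) ≤ B - S := by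
    have : ((-(s.card : ℤ) : ℤ) : ℝ) ≤ ((B - S : ℤ) : ℝ) := by push_cast; linarith
    exact_mod_cast this
  -- choose g i ∈ {-1,0,1,2} with sum B - S
  have key : ∀ (s : Finset ι) (D : ℤ), -(s.card : ℤ) ≤ D → D ≤ 2 * s.card →
      ∃ g : ι → ℤ, (∀ i, -1 ≤ g i ∧ g i ≤ 2) ∧ ∑ i ∈ s, g i = D := by
    intro s
    induction s using Finset.induction_on with
    | empty => intro D h1 h2; simp at h1 h2; exact ⟨fun _ => 0, by simp, by simp; omega⟩
    | insert a s ha ih =>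
      intro D h1 h2
      rw [Finset.card_insert_of_notMem ha] at h1 h2
      push_cast at h1 h2
      set v : ℤ := if D < 0 then -1 else min D 2 with hv
      have hv2 : -1 ≤ v ∧ v ≤ 2 := by rw [hv]; split_ifs <;> omega
      obtain ⟨g, hg1, hg2⟩ := ih (D - v) (by rw [hv]; split_ifs <;> omega) (by rw [hv]; split_ifs <;> omega)
      refine ⟨Function.update g a v, ?_, ?_⟩
      · intro i; by_cases h : i = a
        · subst h; simpa using hv2
        · rw [Function.update_of_ne h]; exact hg1 i
      · rw [Finset.sum_insert ha, Function.update_self, Finset.sum_congr rfl fun i hi => Function.update_of_ne (by rintro rfl; exact ha hi) v g, hg2]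
        ring
  obtain ⟨g, hg1, hg2⟩ := key s (B - S) h2 h1
  refine ⟨fun i => ⌊u i⌋ + g i, ?_, ?_⟩
  · intro i
    have a1 := Int.floor_le (u i)
    have a2 := Int.lt_floor_add_one (u i)
    have b1 : (-1:ℝ) ≤ g i := by exact_mod_cast (hg1 i).1
    have b2 : (g i : ℝ) ≤ 2 := by exact_mod_cast (hg1 i).2
    push_cast
    rw [abs_le]; constructor <;> linarith
  · rw [Finset.sum_add_distrib, hg2]; ring
end

section
/-! Part C2: the tilted row distribution -/

def pi0 {k : ℕ} (l : Fin k → ℝ) : ℝ := ∏ j, (1 - l j)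
def kap (k : ℕ) : ℝ := (1 / 4) ^ k * ((k + 1) / 2 + 1 / k)

/-- the tilt is admissible for the type `l` -/
structure TiltOK {k : ℕ} (l : Fin k → ℝ) (x : ℝ) : Prop where
  x0 : 0 < x
  x1 : x ≤ 1 / 10
  fix : ∏ j, (1 - l j * (1 - x)) = x
  kl : -Real.log (1 - x) * (1 - ∑ j, l j) + ∑ j, (1 - l j) * Real.log ((1 - l j * (1 - x)) / (1 - l j))
    ≤ pi0 l + kap k

lemma log_one_add_le {u : ℝ} (h0 : 0 ≤ u) (h1 : u ≤ 1 / 2) : Real.log (1 + u) ≤ u - u ^ 2 / 2 + 2 * u ^ 3 := by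
  have h := Real.abs_log_sub_add_sum_range_le (x := -u) (by rw [abs_neg, abs_of_nonneg h0]; linarith) 2
  simp only [Finset.sum_range_succ, Finset.sum_range_zero, abs_neg, abs_of_nonneg h0] at h
  have h2 := (abs_le.1 h).2
  have h3 : u ^ (2 + 1) / (1 - u) ≤ 2 * u ^ 3 := by
    rw [div_le_iff₀ (by linarith)]
    have : 0 ≤ u ^ 3 * (1 - 2 * u) := mul_nonneg (pow_nonneg h0 3) (by linarith)
    linarith [show 2 * u ^ 3 * (1 - u) = u ^ (2+1) + u ^ 3 * (1 - 2 * u) by ring]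
  norm_num at h2 h3
  linarith

lemma neg_log_ge {x : ℝ} (h0 : 0 ≤ x) (h1 : x < 1) : x + x ^ 2 / 2 ≤ -Real.log (1 - x) := by
  have h := Real.hasSum_pow_div_log_of_abs_lt_one (abs_lt.2 ⟨by linarith, h1⟩)
  have := sum_le_hasSum (Finset.range 2) (fun i _ => by positivity) h
  simp [Finset.sum_range_succ] at this
  norm_num at this
  linarith

set_option maxHeartbeats 2000000 in
lemma tilt_exists {k : ℕ} (hk : 100 ≤ k) (h2k : (k:ℝ) ^ 8 ≤ 2 ^ k) (y : ℝ) (hy0 : 0 ≤ y)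
    (hy : y ≤ 1 / (k:ℝ) ^ 4) (l : Fin k → ℝ) (hl : ∀ j, |l j - 1 / 2| ≤ y / 2) : ∃ x, TiltOK l x := by
  have hK : (100:ℝ) ≤ k := by exact_mod_cast hk
  have hk0 : (0:ℝ) < k := by linarith
  have hP : (0:ℝ) < 2 ^ k := by positivity
  have hy1 : y ≤ 1 / 100 := by
    refine hy.trans ?_
    gcongr
    calc (100:ℝ) ≤ k := hK
      _ = k ^ 1 := (pow_one _).symm
      _ ≤ k ^ 4 := pow_le_pow_right₀ (by linarith) (by norm_num)
  have hl1 : ∀ j, 1 / 2 - y / 2 ≤ l j := fun j => by have := (abs_le.1 (hl j)).1; linarith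
  have hl2 : ∀ j, l j ≤ 1 / 2 + y / 2 := fun j => by have := (abs_le.1 (hl j)).2; linarith
  have ha : ∀ j, 0 < 1 - l j := fun j => by linarith [hl2 j]
  have hb : ∀ j, 0 < l j := fun j => by linarith [hl1 j]
  set s : ℝ := ∑ j, l j / (1 - l j) with hs
  have hs0 : 0 ≤ s := Finset.sum_nonneg fun j _ => (div_pos (hb j) (ha j)).le
  have hsk : s ≤ k + 3 / k ^ 3 := by
    have : ∀ j ∈ (univ : Finset (Fin k)), l j / (1 - l j) ≤ 1 + 3 * y := by
      intro j _
      rw [div_le_iff₀ (ha j)]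
      nlinarith [hl2 j]
    have := Finset.sum_le_card_nsmul _ _ _ this
    simp only [Finset.card_univ, Fintype.card_fin, nsmul_eq_mul] at this
    have h3 : k * (3 * y) ≤ 3 / k ^ 3 := by
      calc k * (3 * y) ≤ k * (3 * (1 / k ^ 4)) := by gcongr
        _ = _ := by field_simp
    rw [hs]; linarith
  have hπ0 : 0 < pi0 l := Finset.prod_pos fun j _ => ha j
  set e : ℝ := 1 / (k:ℝ) ^ 3 with he
  have he0 : 0 < e := by positivity
  have hke : k * e ≤ 1 / 10000 := by
    have : k * e = 1 / k ^ 2 := by rw [he]; field_simp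
    rw [this]; gcongr; nlinarith
  have he1 : e ≤ 1 / 1000000 := by nlinarith
  have hπ : pi0 l ≤ 1 / 2 ^ k * (1 + 2 * e) := by
    have h1 : pi0 l ≤ (1 / 2 * Real.exp y) ^ k := by
      unfold pi0
      calc _ ≤ ∏ _j : Fin k, (1 / 2 * Real.exp y) := by
            refine Finset.prod_le_prod (fun j _ => (ha j).le) fun j _ => ?_
            have := Real.add_one_le_exp y
            linarith [hl1 j]
        _ = _ := by simp
    rw [mul_pow, ← Real.exp_nat_mul, one_div_pow] at h1
    have h2 : Real.exp (k * y) ≤ 1 + 2 * e := by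
      have hky : k * y ≤ e := by
        calc k * y ≤ k * (1 / k ^ 4) := by gcongr
          _ = e := by rw [he]; field_simp
      have := Real.abs_exp_sub_one_le (x := e) (by rw [abs_of_pos he0]; linarith)
      rw [abs_of_pos he0] at this
      have := le_abs_self (Real.exp e - 1)
      have := Real.exp_le_exp.2 hky
      linarith
    exact h1.trans (by gcongr)
  have hQ : (1:ℝ) / 2 ^ k ≤ e ^ 2 * (1 / k ^ 2) := by
    rw [he]
    have : (1 / (k:ℝ) ^ 3) ^ 2 * (1 / k ^ 2) = 1 / k ^ 8 := by field_simp
    rw [this]; gcongr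
  set Q : ℝ := 1 / 2 ^ k with hQd
  have hQ0 : 0 < Q := by positivity
  set X : ℝ := Q * (1 + 3 * e) with hX
  have hX0 : 0 < X := by positivity
  have hX2 : X ≤ 2 * Q := by rw [hX]; nlinarith only [hQ0, he1, he0]
  have hQk : Q * k ^ 2 ≤ e ^ 2 := by
    calc Q * k ^ 2 ≤ (e ^ 2 * (1 / k ^ 2)) * k ^ 2 := by gcongr
      _ = e ^ 2 := by field_simp
  have hkk : (k:ℝ) ≤ k ^ 2 := by nlinarith
  have hQe : Q * k ≤ e ^ 2 := (mul_le_mul_of_nonneg_left hkk hQ0.le).trans hQk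
  have hQ1 : Q ≤ e ^ 2 := by nlinarith only [hQe, hQ0, hK]
  have hX1 : X ≤ 1 / 10 := by nlinarith only [hX2, hQ1, he1, he0]
  have hsX : s * X ≤ e / 4 := by
    have : s ≤ 2 * k := by
      have : 3 / (k:ℝ) ^ 3 = 3 * e := by rw [he]; ring
      linarith
    calc s * X ≤ (2 * k) * (2 * Q) := by gcongr
      _ = 4 * (Q * k) := by ring
      _ ≤ 4 * e ^ 2 := by gcongr
      _ ≤ e / 4 := by nlinarith only [he0, he1]
  -- the fixed point equation
  have hprod : ∀ x, 0 ≤ x → ∏ j, (1 - l j * (1 - x)) ≤ pi0 l * Real.exp (s * x) := by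
    intro x hx
    unfold pi0
    rw [hs, Finset.sum_mul, Real.exp_sum, ← Finset.prod_mul_distrib]
    refine Finset.prod_le_prod (fun j _ => ?_) fun j _ => ?_
    · have := mul_nonneg (hb j).le hx
      linarith [ha j, show 1 - l j * (1 - x) = 1 - l j + l j * x by ring]
    · calc 1 - l j * (1 - x) = (1 - l j) * (l j / (1 - l j) * x + 1) := by
            have := (ha j).ne'; field_simp; ring
        _ ≤ _ := mul_le_mul_of_nonneg_left (Real.add_one_le_exp _) (ha j).le
  have hgX : ∏ j, (1 - l j * (1 - X)) ≤ X := by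
    refine (hprod X hX0.le).trans ?_
    have h1 : Real.exp (s * X) ≤ 1 + e / 2 := by
      have := Real.abs_exp_sub_one_le (x := e / 4) (by rw [abs_of_pos (show 0 < e / 4 by positivity)]; linarith)
      rw [abs_of_pos (show 0 < e / 4 by positivity)] at this
      have := le_abs_self (Real.exp (e/4) - 1)
      have := Real.exp_le_exp.2 hsX
      linarith
    calc _ ≤ (Q * (1 + 2 * e)) * (1 + e / 2) := by gcongr
      _ = Q * (1 + 5/2 * e + e ^ 2) := by ring
      _ ≤ Q * (1 + 3 * e) := by
          apply mul_le_mul_of_nonneg_left _ hQ0.le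
          nlinarith only [he0, he1]
  have hcont : ContinuousOn (fun x => ∏ j, (1 - l j * (1 - x)) - x) (Set.Icc 0 X) := by fun_prop
  have hivt := intermediate_value_Icc' hX0.le hcont
  have hmem : (0:ℝ) ∈ Set.Icc (∏ j, (1 - l j * (1 - X)) - X) (∏ j, (1 - l j * (1 - 0)) - 0) := by
    refine ⟨by linarith, ?_⟩
    have : ∏ j, (1 - l j * (1 - 0)) = pi0 l := by unfold pi0; simp
    rw [this]; linarith
  obtain ⟨x, ⟨hx0, hxX⟩, hx⟩ := hivt hmem
  have hfix : ∏ j, (1 - l j * (1 - x)) = x := by simp only at hx; linarith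
  have hπx : pi0 l ≤ x := by
    rw [← hfix]; unfold pi0
    refine Finset.prod_le_prod (fun j _ => (ha j).le) fun j _ => ?_
    have := mul_nonneg (hb j).le hx0
    linarith [show 1 - l j * (1 - x) = 1 - l j + l j * x by ring]
  have hxpos : 0 < x := by linarith
  refine ⟨x, hxpos, hxX.trans hX1, hfix, ?_⟩
  -- KL estimate
  have hx110 : x ≤ 1 / 10 := hxX.trans hX1
  have hLsum : 1 ≤ ∑ j, l j := by
    have : ∀ j ∈ (univ : Finset (Fin k)), (1/4 : ℝ) ≤ l j := fun j _ => by linarith [hl1 j]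
    have := Finset.card_nsmul_le_sum _ _ _ this
    simp only [Finset.card_univ, Fintype.card_fin, nsmul_eq_mul] at this
    linarith
  have t1 : -Real.log (1 - x) * (1 - ∑ j, l j) ≤ (x + x ^ 2 / 2) * (1 - ∑ j, l j) :=
    mul_le_mul_of_nonpos_right (neg_log_ge hx0 (by linarith)) (by linarith)
  have t2 : ∑ j, (1 - l j) * Real.log ((1 - l j * (1 - x)) / (1 - l j)) ≤
      ∑ j, (l j * x - (l j / (1 - l j) - l j) * (x ^ 2 / 2) + 3 * x ^ 3) := by
    refine Finset.sum_le_sum fun j _ => ?_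
    have hne := (ha j).ne'
    have e1 : (1 - l j * (1 - x)) / (1 - l j) = 1 + l j * x / (1 - l j) := by field_simp; ring
    have u0 : 0 ≤ l j * x / (1 - l j) := div_nonneg (mul_nonneg (hb j).le hx0) (ha j).le
    have hr : l j / (1 - l j) ≤ 1.1 := by rw [div_le_iff₀ (ha j)]; linarith [hl2 j]
    have hr0 : 0 ≤ l j / (1 - l j) := (div_pos (hb j) (ha j)).le
    have u1 : l j * x / (1 - l j) ≤ 1 / 2 := by
      rw [mul_div_right_comm]; nlinarith only [hr, hr0, hx110, hx0]
    have h := log_one_add_le u0 u1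
    rw [e1]
    refine (mul_le_mul_of_nonneg_left h (ha j).le).trans ?_
    have e2 : (1 - l j) * (l j * x / (1 - l j) - (l j * x / (1 - l j)) ^ 2 / 2 + 2 * (l j * x / (1 - l j)) ^ 3)
      = l j * x - (l j / (1 - l j) - l j) * (x ^ 2 / 2) + 2 * l j * (l j / (1 - l j)) ^ 2 * x ^ 3 := by
      field_simp; ring
    rw [e2]
    have h3 : 2 * l j * (l j / (1 - l j)) ^ 2 ≤ 3 := by
      calc 2 * l j * (l j / (1 - l j)) ^ 2 ≤ 2 * 0.51 * 1.1 ^ 2 := by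
            gcongr; linarith [hl2 j]
        _ ≤ 3 := by norm_num
    have := mul_le_mul_of_nonneg_right h3 (pow_nonneg hx0 3)
    linarith
  have t3 : ∑ j, (l j * x - (l j / (1 - l j) - l j) * (x ^ 2 / 2) + 3 * x ^ 3) =
      (∑ j, l j) * x - (s - ∑ j, l j) * (x ^ 2 / 2) + k * (3 * x ^ 3) := by
    rw [Finset.sum_add_distrib, Finset.sum_sub_distrib, ← Finset.sum_mul, ← Finset.sum_mul, Finset.sum_sub_distrib, ← hs]
    simp
  have hxs : x ≤ pi0 l + s * x ^ 2 + s ^ 2 * x ^ 3 := by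
    have h1 := hprod x hx0
    rw [hfix] at h1
    have hsx0 : 0 ≤ s * x := mul_nonneg hs0 hx0
    have hsx1 : s * x ≤ 1 := by
      have : s * x ≤ s * X := by gcongr
      linarith
    have h2 := Real.abs_exp_sub_one_sub_id_le (x := s * x) (by rw [abs_of_nonneg hsx0]; exact hsx1)
    have h3 := le_abs_self (Real.exp (s * x) - 1 - s * x)
    calc x ≤ pi0 l * Real.exp (s * x) := h1
      _ ≤ pi0 l * (1 + s * x + (s * x) ^ 2) := by gcongr; linarith
      _ = pi0 l + pi0 l * (s * x + (s * x) ^ 2) := by ring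
      _ ≤ pi0 l + x * (s * x + (s * x) ^ 2) := by gcongr
      _ = _ := by ring
  have hfin : x ^ 2 * ((1 + s) / 2) + (s ^ 2 + 3 * k) * x ^ 3 ≤ kap k := by
    have hk3 : 3 / (k:ℝ) ^ 3 = 3 * e := by rw [he]; ring
    rw [hk3] at hsk
    have hs2 : s ≤ 2 * k := by linarith
    have hk1 : kap k = Q ^ 2 * ((k + 1) / 2 + 1 / k) := by
      unfold kap; rw [hQd, ← one_div_pow, ← pow_mul, mul_comm k 2, pow_mul]; norm_num
    have hik : 1 / (k:ℝ) = k ^ 2 * e := by rw [he]; field_simp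
    rw [hk1, hik]
    have a1 : x ^ 2 * ((1 + s) / 2) ≤ (Q * (1 + 3 * e)) ^ 2 * ((1 + (k + 3 * e)) / 2) := by gcongr
    have a2 : (s ^ 2 + 3 * k) * x ^ 3 ≤ ((2 * k) ^ 2 + 3 * k) * (2 * Q) ^ 3 := by
      gcongr; exact hxX.trans hX2
    have a3 : ((2 * k) ^ 2 + 3 * k) * (2 * Q) ^ 3 ≤ Q ^ 2 * (40 * e) := by
      have : (2 * (k:ℝ)) ^ 2 + 3 * k ≤ 5 * k ^ 2 := by nlinarith only [hK]
      calc ((2 * k) ^ 2 + 3 * k) * (2 * Q) ^ 3 ≤ (5 * k ^ 2) * (2 * Q) ^ 3 := by gcongr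
        _ = Q ^ 2 * (40 * (Q * k ^ 2)) := by ring
        _ ≤ Q ^ 2 * (40 * e) := by gcongr; nlinarith only [hQk, he0, he1]
    have a4 : (Q * (1 + 3 * e)) ^ 2 * ((1 + (k + 3 * e)) / 2) ≤ Q ^ 2 * ((k + 1) / 2 + 10 * (k * e)) := by
      rw [mul_pow, mul_assoc]
      apply mul_le_mul_of_nonneg_left _ (by positivity)
      have : (1 + 3 * e) ^ 2 ≤ 1 + 7 * e := by nlinarith only [he0, he1]
      calc (1 + 3 * e) ^ 2 * ((1 + (k + 3 * e)) / 2) ≤ (1 + 7 * e) * ((1 + (k + 3 * e)) / 2) := by gcongr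
        _ = (k+1)/2 + 3/2 * e + 7/2 * e + 7 / 2 * (k * e) + 21/2 * (e * e) := by ring
        _ ≤ _ := by
          have : e ≤ k * e := by nlinarith only [hK, he0]
          have : e * e ≤ e := by nlinarith only [he0, he1]
          linarith
    have a5 : Q ^ 2 * ((k + 1) / 2 + 10 * (k * e)) + Q ^ 2 * (40 * e) ≤ Q ^ 2 * ((k + 1) / 2 + k ^ 2 * e) := by
      rw [← mul_add]
      apply mul_le_mul_of_nonneg_left _ (by positivity)
      have : 100 * (k * e) ≤ k ^ 2 * e := by nlinarith only [mul_pos hk0 he0, hK]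
      have : 40 * e ≤ k * e := by nlinarith only [hK, he0]
      linarith [mul_pos hk0 he0]
    linarith
  rw [t3] at t2
  set Z := ∑ j, l j
  have e9 : (x + x ^ 2 / 2) * (1 - Z) + (Z * x - (s - Z) * (x ^ 2 / 2) + k * (3 * x ^ 3)) =
    x + x ^ 2 / 2 - s * x ^ 2 / 2 + 3 * k * x ^ 3 := by ring
  have e10 : x ^ 2 * ((1 + s) / 2) + (s ^ 2 + 3 * k) * x ^ 3 =
    x ^ 2 / 2 + s * x ^ 2 / 2 + s ^ 2 * x ^ 3 + 3 * k * x ^ 3 := by ring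
  linarith
end

section
/-! Part C3: row measures -/

def berw (q : ℝ) (b : Bool) : ℝ := if b then q else 1 - q

lemma berw_sum (q : ℝ) : ∑ b, berw q b = 1 := by simp [berw]
lemma berw_nonneg {q : ℝ} (h0 : 0 ≤ q) (h1 : q ≤ 1) (b : Bool) : 0 ≤ berw q b := by
  unfold berw; split_ifs <;> linarith

def rowP0 {k : ℕ} (l : Fin k → ℝ) (y : Fin k → Bool) : ℝ := ∏ j, berw (l j) (y j)
def rowP1 {k : ℕ} (l : Fin k → ℝ) (x : ℝ) (y : Fin k → Bool) : ℝ :=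
  if ∃ j, y j = true then (∏ j, berw (l j * (1 - x)) (y j)) / (1 - x) else 0

section
variable {k : ℕ} {l : Fin k → ℝ} {x : ℝ}

lemma prod_zero_row (q : Fin k → ℝ) (y : Fin k → Bool) (h : ¬ ∃ j, y j = true) :
    ∏ j, berw (q j) (y j) = ∏ j, (1 - q j) := by
  push Not at h
  refine Finset.prod_congr rfl fun j _ => ?_
  simp [berw, h j]

lemma sum_rows (q : Fin k → ℝ) : ∑ y : Fin k → Bool, ∏ j, berw (q j) (y j) = 1 := by
  rw [sum_prod_eq (fun j b => berw (q j) b)]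
  exact Finset.prod_eq_one fun j _ => berw_sum _

lemma rowP1_eq (H : TiltOK l x) (y : Fin k → Bool) :
    rowP1 l x y = ((∏ j, berw (l j * (1 - x)) (y j)) - if ∃ j, y j = true then 0 else x) / (1 - x) := by
  unfold rowP1
  by_cases h : ∃ j, y j = true
  · simp [h]
  · rw [if_neg h, if_neg h, prod_zero_row _ _ h, H.fix]; simp

lemma sum_zero_row (g : (Fin k → Bool) → ℝ) :
    ∑ y : Fin k → Bool, (if ∃ j, y j = true then 0 else g y) = g (fun _ => false) := by
  rw [Finset.sum_eq_single (fun _ => false)]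
  · simp
  · intro y _ hy
    rw [if_pos]
    by_contra h
    push Not at h
    exact hy (funext fun j => by simpa using h j)
  · simp

lemma rowP1_sum (H : TiltOK l x) : ∑ y, rowP1 l x y = 1 := by
  have hx := H.x1
  rw [Finset.sum_congr rfl fun y _ => rowP1_eq H y, ← Finset.sum_div, Finset.sum_sub_distrib, sum_rows,
    sum_zero_row (fun _ => x)]
  exact div_self (by linarith)

lemma rowP1_marg (H : TiltOK l x) (j : Fin k) :
    ∑ y, rowP1 l x y * (if y j = true then 1 else 0) = l j := by
  have hx := H.x1
  have e : ∀ y : Fin k → Bool, rowP1 l x y * (if y j = true then 1 else 0) =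
      (∏ j, berw (l j * (1 - x)) (y j)) * (if y j = true then 1 else 0) / (1 - x) := by
    intro y
    by_cases h : y j = true
    · have : ∃ j, y j = true := ⟨j, h⟩
      simp [rowP1, this, h]
    · simp [h]
  rw [Finset.sum_congr rfl fun y _ => e y, ← Finset.sum_div]
  have := Ex_coord (fun j b => berw (l j * (1 - x)) b) (fun j => berw_sum _) j (fun b => if b = true then 1 else 0)
  unfold Ex PW at this
  rw [this]
  simp [berw]
  rw [mul_div_assoc, div_self (by linarith), mul_one]

lemma rowP1_lower (H : TiltOK l x) (hl : ∀ j, 0.45 ≤ l j ∧ l j ≤ 0.55) (y : Fin k → Bool) (hy : ∃ j, y j = true) :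
    (1 / 4) ^ k ≤ rowP1 l x y := by
  have hx := H.x1
  have hx0 := H.x0
  unfold rowP1; rw [if_pos hy]
  have : (1/4 : ℝ) ^ k ≤ ∏ j, berw (l j * (1 - x)) (y j) := by
    calc (1/4 : ℝ) ^ k = ∏ _j : Fin k, (1/4 : ℝ) := by simp
      _ ≤ _ := by
        refine Finset.prod_le_prod (fun _ _ => by norm_num) fun j _ => ?_
        have := hl j
        unfold berw; split_ifs <;> nlinarith
  refine this.trans ?_
  rw [le_div_iff₀ (by linarith)]
  have : 0 ≤ ∏ j, berw (l j * (1 - x)) (y j) := le_trans (by positivity) this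
  nlinarith

lemma rowP1_nonneg (H : TiltOK l x) (hl : ∀ j, 0.45 ≤ l j ∧ l j ≤ 0.55) (y : Fin k → Bool) : 0 ≤ rowP1 l x y := by
  by_cases h : ∃ j, y j = true
  · exact le_trans (by positivity) (rowP1_lower H hl y h)
  · simp [rowP1, h]

/-- log likelihood ratio -/
def llr {k : ℕ} (l : Fin k → ℝ) (x : ℝ) (y : Fin k → Bool) : ℝ :=
  Real.log (1 - x) + ∑ j, if y j = true then - Real.log (1 - x) else - Real.log ((1 - l j * (1 - x)) / (1 - l j))

lemma row_ratio (H : TiltOK l x) (hl : ∀ j, 0.45 ≤ l j ∧ l j ≤ 0.55) (y : Fin k → Bool) (hy : ∃ j, y j = true) :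
    rowP0 l y = rowP1 l x y * Real.exp (llr l x y) := by
  have hx := H.x1
  have hx0 := H.x0
  have h1x : 0 < 1 - x := by linarith
  unfold llr rowP1 rowP0
  rw [if_pos hy, Real.exp_add, Real.exp_log h1x, Real.exp_sum, div_mul_eq_mul_div, mul_left_comm,
    mul_comm (1 - x), mul_div_assoc, div_self h1x.ne', mul_one, ← Finset.prod_mul_distrib]
  refine Finset.prod_congr rfl fun j _ => ?_
  have h1 : 0 < 1 - l j := by have := hl j; norm_num at this; linarith
  have h2 : 0 < 1 - l j * (1 - x) := by have := hl j; norm_num at this; nlinarith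
  unfold berw
  split_ifs
  · rw [Real.exp_neg, Real.exp_log h1x]; field_simp
  · rw [Real.exp_neg, Real.exp_log (by positivity)]; field_simp

end

/-- filling the reserved rows -/
lemma row_fill {ι : Type} [DecidableEq ι] {k : ℕ} (hk : 3 ≤ k) (J : Finset ι) (g : Fin k → ℕ)
    (h1 : ∀ j, J.card / 3 + 1 ≤ g j) (h2 : ∀ j, g j ≤ J.card) :
    ∃ A : ι → Fin k → Bool, (∀ i ∈ J, ∃ j, A i j = true) ∧
      ∀ j, (J.filter fun i => A i j = true).card = g j := by
  obtain ⟨P0, hP0, hc0⟩ := Finset.exists_subset_card_eq (s := J) (n := min J.card (J.card / 3 + 1)) (min_le_left _ _)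
  obtain ⟨P1, hP1, hc1⟩ := Finset.exists_subset_card_eq (s := J \ P0) (n := min (J \ P0).card (J.card / 3 + 1)) (min_le_left _ _)
  have hd0 : (J \ P0).card = J.card - P0.card := Finset.card_sdiff_of_subset hP0
  have hd1 : ((J \ P0) \ P1).card = (J \ P0).card - P1.card := Finset.card_sdiff_of_subset hP1
  set P : Fin k → Finset ι := fun j => if j.1 = 0 then P0 else if j.1 = 1 then P1 else
    if j.1 = 2 then (J \ P0) \ P1 else ∅ with hP
  have hPJ : ∀ j, P j ⊆ J := by
    intro j; simp only [hP]; split_ifs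
    · exact hP0
    · exact hP1.trans Finset.sdiff_subset
    · exact Finset.sdiff_subset.trans Finset.sdiff_subset
    · simp
  have hPc : ∀ j, (P j).card ≤ g j := by
    intro j
    refine le_trans ?_ (h1 j)
    simp only [hP]; split_ifs
    · omega
    · omega
    · omega
    · simp
  choose S hS1 hS2 hS3 using fun j => Finset.exists_subsuperset_card_eq (hPJ j) (hPc j) (h2 j)
  refine ⟨fun i j => decide (i ∈ S j), ?_, ?_⟩
  · intro i hi
    by_cases c0 : i ∈ P0
    · exact ⟨⟨0, by omega⟩, by simpa using hS1 _ (by simpa [hP] using c0)⟩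
    by_cases c1 : i ∈ P1
    · exact ⟨⟨1, by omega⟩, by simpa using hS1 _ (by simpa [hP] using c1)⟩
    · exact ⟨⟨2, by omega⟩, by simpa using hS1 _ (by simp [hP, hi, c0, c1])⟩
  · intro j
    rw [← hS3 j]
    congr 1
    ext i
    simp only [Finset.mem_filter, decide_eq_true_eq]
    exact ⟨fun h => h.2, fun h => ⟨hS2 j h, h⟩⟩
end

section
/-! Part C4: matrices with nonzero rows and prescribed column sums -/

def cntT {k m : ℕ} (T : Fin m → Fin k → ℝ) (l : Fin k → ℝ) : ℕ := (univ.filter fun i => T i = l).card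

def BBset {k m : ℕ} (T : Fin m → Fin k → ℝ) (Λ : Finset (Fin k → ℝ)) (c : (Fin k → ℝ) → Fin k → ℤ) :
    Finset (Fin m → Fin k → Bool) :=
  univ.filter fun β => (∀ i, ∃ j, β i j = true) ∧
    ∀ l ∈ Λ, ∀ j, ((univ.filter fun i => T i = l ∧ β i j = true).card : ℤ) = c l j

/-- weight -/
def Wt {k : ℕ} (l : Fin k → ℝ) (x : ℝ) (j : Fin k) : ℝ :=
  - Real.log (1 - x) + Real.log ((1 - l j * (1 - x)) / (1 - l j))

lemma Wt_abs {k : ℕ} {l : Fin k → ℝ} {x : ℝ} (H : TiltOK l x) (hl : ∀ j, 0.45 ≤ l j ∧ l j ≤ 0.55) (j : Fin k) :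
    |Wt l x j| ≤ 2 := by
  have hx := H.x1
  have hx0 := H.x0
  have hj := hl j
  norm_num at hj
  have h1 : 0 < 1 - l j := by linarith
  have h2 : 0 < 1 - l j * (1 - x) := by nlinarith
  have a1 : 0 ≤ -Real.log (1 - x) := by
    have := Real.log_nonpos (by linarith : 0 ≤ 1 - x) (by linarith); linarith
  have a2 : -Real.log (1 - x) ≤ 1 := by
    have := Real.one_sub_inv_le_log_of_pos (by linarith : 0 < 1 - x)
    have h : (1 - x)⁻¹ ≤ 2 := by
      rw [inv_le_comm₀ (by linarith) (by norm_num)]; linarith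
    linarith
  have q1 : 1 ≤ (1 - l j * (1 - x)) / (1 - l j) := by rw [le_div_iff₀ h1]; nlinarith
  have q2 : (1 - l j * (1 - x)) / (1 - l j) ≤ 2 := by rw [div_le_iff₀ h1]; nlinarith
  have b1 := Real.log_nonneg q1
  have b2 := Real.log_le_sub_one_of_pos (by linarith : 0 < (1 - l j * (1 - x)) / (1 - l j))
  unfold Wt
  rw [abs_of_nonneg (by linarith)]; linarith

lemma llr_eq {k : ℕ} {l : Fin k → ℝ} {x : ℝ} (H : TiltOK l x) (y : Fin k → Bool) :
    -(pi0 l + kap k) + ∑ j, ((if y j = true then 1 else 0) - l j) * Wt l x j ≤ llr l x y := by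
  have hk := H.kl
  have e : llr l x y = -(-Real.log (1 - x) * (1 - ∑ j, l j) + ∑ j, (1 - l j) * Real.log ((1 - l j * (1 - x)) / (1 - l j)))
      + ∑ j, ((if y j = true then 1 else 0) - l j) * Wt l x j := by
    unfold llr
    have : ∀ j, (if y j = true then - Real.log (1 - x) else - Real.log ((1 - l j * (1 - x)) / (1 - l j))) =
        -(l j * Real.log (1 - x)) - (1 - l j) * Real.log ((1 - l j * (1 - x)) / (1 - l j)) +
        ((if y j = true then 1 else 0) - l j) * Wt l x j := by
      intro j; unfold Wt; split_ifs <;> ring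
    rw [Finset.sum_congr rfl fun j _ => this j, Finset.sum_add_distrib, Finset.sum_sub_distrib, Finset.sum_neg_distrib, ← Finset.sum_mul]
    ring
  rw [e]; linarith

lemma llr_total {k m : ℕ} (T : Fin m → Fin k → ℝ) (Λ : Finset (Fin k → ℝ)) (X : (Fin k → ℝ) → ℝ)
    (hX : ∀ l ∈ Λ, TiltOK l (X l)) (hl : ∀ l ∈ Λ, ∀ j, 0.45 ≤ l j ∧ l j ≤ 0.55) (hT : ∀ i, T i ∈ Λ)
    (c : (Fin k → ℝ) → Fin k → ℤ) (hc : ∀ l ∈ Λ, ∀ j, |(c l j : ℝ) - l j * cntT T l| ≤ 2)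
    (β : Fin m → Fin k → Bool) (hβ : β ∈ BBset T Λ c) :
    -(∑ i, (pi0 (T i) + kap k)) - 4 * (k * Λ.card) ≤ ∑ i, llr (T i) (X (T i)) (β i) := by
  have h1 : ∑ i, (-(pi0 (T i) + kap k) + ∑ j, ((if β i j = true then 1 else 0) - T i j) * Wt (T i) (X (T i)) j) ≤
      ∑ i, llr (T i) (X (T i)) (β i) := Finset.sum_le_sum fun i _ => llr_eq (hX _ (hT i)) (β i)
  refine le_trans ?_ h1
  rw [Finset.sum_add_distrib (f := fun i => -(pi0 (T i) + kap k)), Finset.sum_neg_distrib, sub_eq_add_neg]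
  refine add_le_add le_rfl ?_
  have h2 := Finset.sum_fiberwise_of_maps_to (s := (univ : Finset (Fin m))) (t := Λ) (g := T) (fun i _ => hT i)
    (fun i => ∑ j, ((if β i j = true then 1 else 0) - T i j) * Wt (T i) (X (T i)) j)
  rw [← h2]
  have h3 : ∀ l ∈ Λ, -(4 * (k:ℝ)) ≤ ∑ i ∈ univ.filter (fun i => T i = l), ∑ j, ((if β i j = true then 1 else 0) - T i j) * Wt (T i) (X (T i)) j := by
    intro l hlΛ
    have e : ∑ i ∈ univ.filter (fun i => T i = l), ∑ j, ((if β i j = true then 1 else 0) - T i j) * Wt (T i) (X (T i)) j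
        = ∑ j, ((c l j : ℝ) - l j * cntT T l) * Wt l (X l) j := by
      rw [Finset.sum_comm]
      refine Finset.sum_congr rfl fun j _ => ?_
      have : ∀ i ∈ univ.filter (fun i => T i = l), ((if β i j = true then 1 else 0) - T i j) * Wt (T i) (X (T i)) j =
          ((if β i j = true then 1 else 0) - l j) * Wt l (X l) j := by
        intro i hi; rw [(Finset.mem_filter.1 hi).2]
      rw [Finset.sum_congr rfl this, ← Finset.sum_mul, Finset.sum_sub_distrib, Finset.sum_boole, Finset.filter_filter]
      have hb := (Finset.mem_filter.1 hβ).2.2 l hlΛ j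
      have hb' : ((univ.filter fun i => T i = l ∧ β i j = true).card : ℝ) = c l j := by exact_mod_cast hb
      rw [hb']
      simp [cntT]; left; ring
    rw [e]
    have : ∀ j ∈ (univ : Finset (Fin k)), (-4:ℝ) ≤ ((c l j : ℝ) - l j * cntT T l) * Wt l (X l) j := by
      intro j _
      have a := hc l hlΛ j
      have b := Wt_abs (hX l hlΛ) (hl l hlΛ) j
      have : |((c l j : ℝ) - l j * cntT T l) * Wt l (X l) j| ≤ 2 * 2 := by
        rw [abs_mul]; exact mul_le_mul a b (abs_nonneg _) (by norm_num)
      have := (abs_le.1 this).1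
      linarith
    have := Finset.sum_le_sum this
    simp at this; linarith
  have := Finset.sum_le_sum h3
  simp only [Finset.sum_const, nsmul_eq_mul] at this
  linarith

set_option maxHeartbeats 1000000 in
lemma rows_prob {k m : ℕ} (hk : 3 ≤ k) (T : Fin m → Fin k → ℝ) (Λ : Finset (Fin k → ℝ)) (X : (Fin k → ℝ) → ℝ)
    (hX : ∀ l ∈ Λ, TiltOK l (X l)) (hl : ∀ l ∈ Λ, ∀ j, 0.45 ≤ l j ∧ l j ≤ 0.55) (hT : ∀ i, T i ∈ Λ)
    (c : (Fin k → ℝ) → Fin k → ℤ) (hc : ∀ l ∈ Λ, ∀ j, |(c l j : ℝ) - l j * cntT T l| ≤ 2)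
    (R : ℕ) (hR60 : 60 ≤ R) (hR : ∀ l ∈ Λ, R ≤ cntT T l) (hV : (Λ.card * k : ℝ) * m ≤ ((R:ℝ) / 20) ^ 2 / 2) :
    ((1 / 4 : ℝ) ^ k) ^ (Λ.card * R) / 2 ≤ ∑ β ∈ BBset T Λ c, PW (fun i => rowP1 (T i) (X (T i))) β := by
  have hR60' : (60:ℝ) ≤ R := by exact_mod_cast hR60
  have hch : ∀ l : Fin k → ℝ, ∃ Jl : Finset (Fin m), Jl ⊆ univ.filter (fun i => T i = l) ∧ (l ∈ Λ → Jl.card = R) := by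
    intro l
    by_cases h : l ∈ Λ
    · obtain ⟨J, h1, h2⟩ := Finset.exists_subset_card_eq (s := univ.filter (fun i => T i = l)) (n := R) (hR l h)
      exact ⟨J, h1, fun _ => h2⟩
    · exact ⟨∅, by simp, fun h' => absurd h' h⟩
  choose Jf hJ1 hJ2 using hch
  have hJT : ∀ l, ∀ i ∈ Jf l, T i = l := fun l i hi => (Finset.mem_filter.1 (hJ1 l hi)).2
  set J : Finset (Fin m) := univ.filter fun i => i ∈ Jf (T i) with hJ
  have hJl : ∀ l, J.filter (fun i => T i = l) = Jf l := by
    intro l; ext i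
    simp only [hJ, Finset.mem_filter, Finset.mem_univ, true_and]
    constructor
    · rintro ⟨a, rfl⟩; exact a
    · intro h; have := hJT l i h; exact ⟨by rw [this]; exact h, this⟩
  have hJc : J.card = Λ.card * R := by
    rw [Finset.card_eq_sum_card_fiberwise (t := Λ) (f := T) (fun i _ => hT i)]
    rw [Finset.sum_congr rfl fun l hlΛ => by rw [hJl l, hJ2 l hlΛ]]
    simp
  rw [← hJc]
  refine TR (Q := ↥Λ × Fin k) (fun i => rowP1 (T i) (X (T i))) (fun i a => rowP1_nonneg (hX _ (hT i)) (hl _ (hT i)) a)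
    (fun i => rowP1_sum (hX _ (hT i))) J _ (by positivity)
    (fun q i y => if T i = q.1.1 ∧ y q.2 = true then 1 else 0) ((R:ℝ) / 20) (by positivity) (fun _ _ => 1) ?_ ?_ _ ?_
  · intro q i a b; split_ifs <;> norm_num
  · refine le_trans ?_ hV
    simp only [one_pow, Finset.sum_const, nsmul_eq_mul, mul_one, Finset.card_univ, Fintype.card_prod, Fintype.card_coe, Fintype.card_fin]
    push_cast
    gcongr
    exact_mod_cast (Finset.card_le_univ _).trans (by simp)
  · intro w hpos htyp
    -- off-J counts
    have ho : ∀ l ∈ Λ, ∀ j, |(((univ.filter fun i => i ∉ J ∧ T i = l ∧ w i j = true).card : ℕ) : ℝ) - l j * ((cntT T l : ℝ) - R)| ≤ (R:ℝ) / 20 := by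
      intro l hlΛ j
      have h := htyp (⟨l, hlΛ⟩, j)
      simp only at h
      have e : ∑ i ∈ Jᶜ, ((if T i = l ∧ w i j = true then (1:ℝ) else 0) - ∑ a, rowP1 (T i) (X (T i)) a * (if T i = l ∧ a j = true then 1 else 0)) =
          (((univ.filter fun i => i ∉ J ∧ T i = l ∧ w i j = true).card : ℕ) : ℝ) - l j * ((cntT T l : ℝ) - R) := by
        rw [Finset.sum_sub_distrib]
        congr 1
        · rw [Finset.sum_boole]
          congr 2
          ext i; simp
        · have : ∀ i ∈ Jᶜ, ∑ a, rowP1 (T i) (X (T i)) a * (if T i = l ∧ a j = true then 1 else 0) = if T i = l then l j else 0 := by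
            intro i _
            by_cases h : T i = l
            · simp only [h, true_and, if_true]
              exact rowP1_marg (hX l hlΛ) j
            · simp [h]
          rw [Finset.sum_congr rfl this, ← Finset.sum_filter, Finset.sum_const, nsmul_eq_mul, mul_comm]
          congr 1
          have : cntT T l = R + (Jᶜ.filter fun i => T i = l).card := by
            rw [← hJ2 l hlΛ, ← hJl l, ← Finset.card_union_of_disjoint, ← Finset.filter_union, Finset.union_compl]
            · rfl
            · exact Finset.disjoint_filter_filter disjoint_compl_right
          rw [this]; push_cast; ring
      rw [e] at h; exact h
    have hfill : ∀ l : Fin k → ℝ, ∃ A : Fin m → Fin k → Bool, l ∈ Λ → ((∀ i ∈ Jf l, ∃ j, A i j = true) ∧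
        ∀ j, (((Jf l).filter fun i => A i j = true).card : ℤ) = c l j - (univ.filter fun i => i ∉ J ∧ T i = l ∧ w i j = true).card) := by
      intro l
      by_cases hlΛ : l ∈ Λ
      swap
      · exact ⟨fun _ _ => true, fun h => absurd h hlΛ⟩
      have hb : ∀ j, ((R:ℤ) / 3 + 1 ≤ c l j - (univ.filter fun i => i ∉ J ∧ T i = l ∧ w i j = true).card) ∧
          c l j - (univ.filter fun i => i ∉ J ∧ T i = l ∧ w i j = true).card ≤ (R:ℤ) := by
        intro j
        have h1 := abs_le.1 (ho l hlΛ j)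
        have h2 := abs_le.1 (hc l hlΛ j)
        have h3 := hl l hlΛ j
        norm_num at h3
        set o := (univ.filter fun i => i ∉ J ∧ T i = l ∧ w i j = true).card
        have u1 : (0.4:ℝ) * R - 2 ≤ c l j - o := by nlinarith
        have u2 : (c l j : ℝ) - o ≤ 0.6 * R + 2 := by nlinarith
        constructor
        · have : (R:ℝ) + 3 ≤ 3 * (c l j - o) := by linarith
          have : (R:ℤ) + 3 ≤ 3 * (c l j - o) := by exact_mod_cast this
          omega
        · have : (c l j - o) ≤ (R:ℝ) := by linarith
          exact_mod_cast this
      obtain ⟨A, hA1, hA2⟩ := row_fill hk (Jf l) (fun j => (c l j - (univ.filter fun i => i ∉ J ∧ T i = l ∧ w i j = true).card).toNat)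
        (fun j => by rw [hJ2 l hlΛ]; have := (hb j).1; omega) (fun j => by rw [hJ2 l hlΛ]; have := (hb j).2; omega)
      refine ⟨A, fun _ => ⟨hA1, fun j => ?_⟩⟩
      rw [hA2 j]
      have := (hb j).1
      omega
    choose A hA using hfill
    refine ⟨fun i => if i ∈ J then A (T i) i else w i, ?_, ?_, ?_⟩
    · simp only [BBset, Finset.mem_filter, Finset.mem_univ, true_and]
      constructor
      · intro i
        by_cases hi : i ∈ J
        · simp only [hi, if_true]
          exact (hA (T i) (hT i)).1 i (Finset.mem_filter.1 hi).2
        · simp only [hi, if_false]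
          have := hpos i
          by_contra hcon
          simp only [rowP1, hcon, if_false] at this
          exact lt_irrefl _ this
      · intro l hlΛ j
        have e : (univ.filter fun i => T i = l ∧ (if i ∈ J then A (T i) i else w i) j = true) =
            ((Jf l).filter fun i => A l i j = true) ∪ (univ.filter fun i => i ∉ J ∧ T i = l ∧ w i j = true) := by
          ext i
          rw [← hJl l]
          simp only [Finset.mem_filter, Finset.mem_univ, true_and, Finset.mem_union]
          by_cases hi : i ∈ J
          · simp only [hi, if_true, true_and, not_true_eq_false, false_and, or_false]
            constructor
            · rintro ⟨rfl, h⟩; exact ⟨rfl, h⟩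
            · rintro ⟨rfl, h⟩; exact ⟨rfl, h⟩
          · simp [hi]
        rw [e, Finset.card_union_of_disjoint]
        · push_cast; rw [(hA l hlΛ).2 j]; ring
        · rw [Finset.disjoint_left]
          intro i hi hi'
          rw [← hJl l] at hi
          simp only [Finset.mem_filter, Finset.mem_univ, true_and] at hi hi'
          exact hi'.1 hi.1.1
    · intro i hi; simp [hi]
    · intro i hi
      simp only [hi, if_true]
      exact rowP1_lower (hX _ (hT i)) (hl _ (hT i)) _ ((hA (T i) (hT i)).1 i (Finset.mem_filter.1 hi).2)

lemma rows_main {k : ℕ} (hk : 3 ≤ k) (Λ : Finset (Fin k → ℝ)) (hΛ : ∀ l ∈ Λ, ∃ x, TiltOK l x)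
    (hl : ∀ l ∈ Λ, ∀ j, 0.45 ≤ l j ∧ l j ≤ 0.55) (γ ε : ℝ) (hγ : 0 < γ) (hε : 0 < ε) :
    ∃ N0 : ℕ, ∀ m ≥ N0, ∀ T : Fin m → Fin k → ℝ, (∀ i, T i ∈ Λ) → (∀ l ∈ Λ, γ * m ≤ cntT T l) →
      ∀ c : (Fin k → ℝ) → Fin k → ℤ, (∀ l ∈ Λ, ∀ j, |(c l j : ℝ) - l j * cntT T l| ≤ 2) →
      Real.exp (-(∑ i, (pi0 (T i) + kap k)) - ε * m) ≤ ∑ β ∈ BBset T Λ c, ∏ i, rowP0 (T i) (β i) := by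
  have hX : ∀ l : Fin k → ℝ, ∃ x, l ∈ Λ → TiltOK l x := by
    intro l
    by_cases h : l ∈ Λ
    · obtain ⟨x, hx⟩ := hΛ l h; exact ⟨x, fun _ => hx⟩
    · exact ⟨0, fun h' => absurd h' h⟩
  choose X hX using hX
  set ρ : ℝ := min γ (ε / (4 * (Λ.card * k + 1))) with hρ
  have hρ0 : 0 < ρ := by rw [hρ]; positivity
  set N1 : ℝ := 120 / ρ + 3200 * (Λ.card * k) / ρ ^ 2 + (4 * (k * Λ.card) + 1) * 2 / ε with hN1
  obtain ⟨N0, hN0⟩ := exists_nat_ge N1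
  refine ⟨N0, fun m hm T hT hcnt c hc => ?_⟩
  have hmN : N1 ≤ m := hN0.trans (by exact_mod_cast hm)
  have p1 : 0 ≤ 120 / ρ := by positivity
  have p2 : 0 ≤ 3200 * (Λ.card * k) / ρ ^ 2 := by positivity
  have p3 : 0 ≤ (4 * ((k:ℝ) * Λ.card) + 1) * 2 / ε := by positivity
  have m1 : 120 ≤ m * ρ := by rw [← div_le_iff₀ hρ0]; linarith
  have m2 : 3200 * (Λ.card * k : ℝ) ≤ m * ρ ^ 2 := by rw [← div_le_iff₀ (by positivity)]; linarith
  have m3 : (4 * ((k:ℝ) * Λ.card) + 1) * 2 ≤ m * ε := by rw [← div_le_iff₀ hε]; linarith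
  set R : ℕ := ⌊ρ * m⌋₊ with hR
  have hm0 : (0:ℝ) ≤ m := Nat.cast_nonneg _
  have hR1 : (R:ℝ) ≤ ρ * m := Nat.floor_le (by positivity)
  have hR2 : ρ * m / 2 ≤ R := by
    have := Nat.lt_floor_add_one (ρ * m)
    rw [← hR] at this; linarith
  have hprob := rows_prob hk T Λ X (fun l h => hX l h) hl hT c hc R
    (by have : (60:ℝ) ≤ R := by linarith
        exact_mod_cast this)
    (fun l hlΛ => by
      have h1 := hcnt l hlΛ
      have h2 : ρ * m ≤ γ * m := by gcongr; exact min_le_left _ _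
      have : (R:ℝ) ≤ cntT T l := by linarith
      exact_mod_cast this)
    (by
      have : (ρ * m / 40) ^ 2 / 2 ≤ ((R:ℝ) / 20) ^ 2 / 2 := by
        gcongr ?_ ^ 2 / 2; linarith
      refine le_trans ?_ this
      have : (Λ.card * k : ℝ) * m ≤ (m * ρ ^ 2 / 3200) * m := by gcongr; linarith
      refine this.trans (le_of_eq ?_); ring)
  have hfac : ∀ β ∈ BBset T Λ c, Real.exp (-(∑ i, (pi0 (T i) + kap k)) - 4 * (k * Λ.card)) *
      PW (fun i => rowP1 (T i) (X (T i))) β ≤ ∏ i, rowP0 (T i) (β i) := by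
    intro β hβ
    have hnz := (Finset.mem_filter.1 hβ).2.1
    rw [Finset.prod_congr rfl fun i _ => row_ratio (hX _ (hT i)) (hl _ (hT i)) (β i) (hnz i), Finset.prod_mul_distrib,
      ← Real.exp_sum, mul_comm]
    refine mul_le_mul_of_nonneg_left (Real.exp_le_exp.2 (llr_total T Λ X (fun l h => hX l h) hl hT c hc β hβ))
      (PW_nonneg (fun i a => rowP1_nonneg (hX _ (hT i)) (hl _ (hT i)) a) β)
  have hs := Finset.sum_le_sum hfac
  rw [← Finset.mul_sum] at hs
  refine le_trans ?_ hs
  refine le_trans ?_ (mul_le_mul_of_nonneg_left hprob (Real.exp_pos _).le)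
  have hlog4 : Real.log 4 ≤ 2 := by
    have := Real.log_two_lt_d9
    rw [show (4:ℝ) = 2 ^ 2 by norm_num, Real.log_pow]; push_cast; linarith
  have hpow : Real.exp (-(2 * (k * (Λ.card * R)))) ≤ ((1 / 4 : ℝ) ^ k) ^ (Λ.card * R) := by
    rw [← pow_mul, ← Real.exp_log (by norm_num : (0:ℝ) < 1/4), ← Real.exp_nat_mul]
    apply Real.exp_le_exp.2
    rw [one_div, Real.log_inv]
    push_cast
    have : 0 ≤ (k * (Λ.card * R) : ℝ) := by positivity
    nlinarith
  have h2 : Real.exp (-1) ≤ 1 / 2 := by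
    have := Real.exp_one_gt_d9
    rw [Real.exp_neg, one_div]
    exact inv_anti₀ (by norm_num) (by linarith)
  have hfin : Real.exp (-(2 * (k * (Λ.card * R)))) * Real.exp (-1) ≤ ((1 / 4 : ℝ) ^ k) ^ (Λ.card * R) / 2 := by
    rw [div_eq_mul_one_div]
    exact mul_le_mul hpow h2 (Real.exp_pos _).le (by positivity)
  refine le_trans ?_ (mul_le_mul_of_nonneg_left hfin (Real.exp_pos _).le)
  rw [← Real.exp_add, ← Real.exp_add]
  apply Real.exp_le_exp.2
  have hA : 2 * (k * (Λ.card * R) : ℝ) ≤ ε * m / 2 := by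
    have : (R:ℝ) ≤ ε / (4 * (Λ.card * k + 1)) * m := hR1.trans (by gcongr; exact min_le_right _ _)
    calc 2 * (k * (Λ.card * R) : ℝ) ≤ 2 * (k * (Λ.card * (ε / (4 * (Λ.card * k + 1)) * m))) := by gcongr
      _ = (Λ.card * k / (Λ.card * k + 1)) * (ε * m / 2) := by field_simp; ring
      _ ≤ 1 * (ε * m / 2) := by
        gcongr
        rw [div_le_one (by positivity)]; linarith
      _ = _ := one_mul _
  linarith
end

section
/-! Part C5: equal fibres -/

section C5
variable {S L : Type} [Fintype S] [DecidableEq S] [Fintype L] [DecidableEq L]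

lemma perm_exists (T : S → ℝ) (β β' : S → Bool) (h : ∀ t, (univ.filter fun s => T s = t ∧ β s = true).card =
    (univ.filter fun s => T s = t ∧ β' s = true).card) :
    ∃ π : Equiv.Perm S, (∀ s, T (π s) = T s) ∧ ∀ s, β' (π s) = β s := by
  have key : ∀ c : ℝ × Bool, Nonempty ({s // (T s, β s) = c} ≃ {s // (T s, β' s) = c}) := by
    rintro ⟨t, b⟩
    refine ⟨Fintype.equivOfCardEq ?_⟩
    rw [Fintype.card_subtype, Fintype.card_subtype]
    have h1 : ∀ γ : S → Bool, (univ.filter fun s => T s = t).card =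
        (univ.filter fun s => T s = t ∧ γ s = true).card + (univ.filter fun s => T s = t ∧ γ s = false).card := by
      intro γ
      rw [← Finset.card_filter_add_card_filter_not (s := univ.filter fun s => T s = t) (fun s => γ s = true),
        Finset.filter_filter, Finset.filter_filter]
      simp only [Bool.not_eq_true]
    have a := h1 β
    have b' := h1 β'
    have c := h t
    cases b
    · simp only [Prod.mk.injEq]; omega
    · simp only [Prod.mk.injEq]; omega
  refine ⟨Equiv.ofFiberEquiv (fun c => (key c).some), ?_, ?_⟩
  · intro s
    have := Equiv.ofFiberEquiv_map (f := fun s => (T s, β s)) (g := fun s => (T s, β' s)) (fun c => (key c).some) s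
    exact congrArg Prod.fst this
  · intro s
    have := Equiv.ofFiberEquiv_map (f := fun s => (T s, β s)) (g := fun s => (T s, β' s)) (fun c => (key c).some) s
    exact congrArg Prod.snd this

lemma fib_abs (T : S → ℝ) (hT : ∀ s, 0 ≤ T s ∧ T s ≤ 1) (C : Finset (S → L))
    (hC : ∀ π : Equiv.Perm S, (∀ s, T (π s) = T s) → ∀ Ψ ∈ C, (fun s => Ψ (π s)) ∈ C) (v : L → Bool) (B : ℝ → ℕ)
    (hB : ∀ Ψ ∈ C, ∀ t, (univ.filter fun s => T s = t ∧ v (Ψ s) = true).card = B t) (BB : Finset (S → Bool))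
    (hBB : ∀ β ∈ BB, ∀ t, (univ.filter fun s => T s = t ∧ β s = true).card = B t) :
    (C.card : ℝ) * ∑ β ∈ BB, ∏ s, berw (T s) (β s) ≤ ((C.filter fun Ψ => (fun s => v (Ψ s)) ∈ BB).card : ℝ) := by
  set V : Finset (S → Bool) := univ.filter fun β => ∀ t, (univ.filter fun s => T s = t ∧ β s = true).card = B t with hV
  have memV : ∀ β, β ∈ V ↔ ∀ t, (univ.filter fun s => T s = t ∧ β s = true).card = B t := by
    intro β; simp [hV]
  rcases BB.eq_empty_or_nonempty with rfl | ⟨β0, hβ0⟩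
  · simp
  set fib : (S → Bool) → Finset (S → L) := fun β => C.filter fun Ψ => (fun s => v (Ψ s)) = β with hfib
  have hle : ∀ β ∈ V, ∀ β' ∈ V, (fib β').card ≤ (fib β).card := by
    intro β hβ β' hβ'
    obtain ⟨π, h1, h2⟩ := perm_exists T β β' (fun t => ((memV β).1 hβ t).trans ((memV β').1 hβ' t).symm)
    refine Finset.card_le_card_of_injOn (fun Ψ s => Ψ (π s)) ?_ ?_
    · intro Ψ hΨ
      have hΨ := Finset.mem_filter.1 (Finset.mem_coe.1 hΨ)
      refine Finset.mem_coe.2 (Finset.mem_filter.2 ⟨hC π h1 Ψ hΨ.1, ?_⟩)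
      funext s
      rw [← h2 s, ← hΨ.2]
    · intro Ψ _ Ψ' _ h
      funext s
      have := congrFun h (π.symm s)
      simpa using this
  have hF : ∀ β ∈ V, (fib β).card = (fib β0).card := fun β hβ =>
    le_antisymm (hle _ ((memV β0).2 (hBB β0 hβ0)) _ hβ) (hle _ hβ _ ((memV β0).2 (hBB β0 hβ0)))
  have hw : ∀ β ∈ V, ∏ s, berw (T s) (β s) = ∏ s, berw (T s) (β0 s) := by
    intro β hβ
    obtain ⟨π, h1, h2⟩ := perm_exists T β β0 (fun t => ((memV β).1 hβ t).trans (hBB β0 hβ0 t).symm)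
    rw [← Equiv.prod_comp π (fun s => berw (T s) (β0 s))]
    exact Finset.prod_congr rfl fun s _ => by rw [h1, h2]
  set w := ∏ s, berw (T s) (β0 s) with hwdef
  have hw0 : 0 ≤ w := Finset.prod_nonneg fun s _ => berw_nonneg (hT s).1 (hT s).2 _
  have hVw : (V.card : ℝ) * w ≤ 1 := by
    have h1 : ∑ β : S → Bool, ∏ s, berw (T s) (β s) = 1 := by
      rw [sum_prod_eq (fun s b => berw (T s) b)]
      exact Finset.prod_eq_one fun s _ => berw_sum _
    rw [← h1, ← nsmul_eq_mul, ← Finset.sum_const, ← Finset.sum_congr rfl hw]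
    exact Finset.sum_le_sum_of_subset_of_nonneg (Finset.subset_univ _) fun β _ _ =>
      Finset.prod_nonneg fun s _ => berw_nonneg (hT s).1 (hT s).2 _
  have hCc : C.card = V.card * (fib β0).card := by
    rw [Finset.card_eq_sum_card_fiberwise (t := V) (f := fun Ψ s => v (Ψ s)) (fun Ψ hΨ => Finset.mem_coe.2 ((memV _).2 (hB Ψ (Finset.mem_coe.1 hΨ))))]
    rw [Finset.sum_congr rfl hF]; simp
  have hR : (C.filter fun Ψ => (fun s => v (Ψ s)) ∈ BB).card = BB.card * (fib β0).card := by
    rw [Finset.card_eq_sum_card_fiberwise (t := BB) (f := fun Ψ s => v (Ψ s)) (fun Ψ hΨ => by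
      have := (Finset.mem_filter.1 (Finset.mem_coe.1 hΨ)).2
      exact Finset.mem_coe.2 this)]
    rw [Finset.sum_congr rfl (g := fun _ => (fib β0).card)]
    · simp
    · intro β hβ
      rw [← hF β ((memV β).2 (hBB β hβ))]
      congr 1
      ext Ψ
      simp only [hfib, Finset.mem_filter]
      constructor
      · rintro ⟨⟨a, _⟩, c⟩; exact ⟨a, c⟩
      · rintro ⟨a, c⟩; exact ⟨⟨a, by rw [c]; exact hβ⟩, c⟩
  rw [hR, hCc, Finset.sum_congr rfl fun β hβ => hw β ((memV β).2 (hBB β hβ)), Finset.sum_const, nsmul_eq_mul]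
  push_cast
  have : 0 ≤ ((fib β0).card : ℝ) * BB.card := by positivity
  nlinarith
end C5

/-- formulas with degree sequence `d` and slot types `T` -/
def classT (n k m : ℕ) (d : Lit n → ℕ) (T : Fin m → Fin k → ℝ) : Finset (Formula n k m) :=
  univ.filter fun Ψ => degSeq n k m Ψ = d ∧ ∀ i j, pLit k d (Ψ i j) = T i j

/-- true degree of type t -/
def Btrue {n : ℕ} (k : ℕ) (d : Lit n → ℕ) (σ : Assignment n) (t : ℝ) : ℕ :=
  ∑ l : Lit n, if pLit k d l = t ∧ litVal σ l = true then d l else 0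

lemma occ_eq (n k m : ℕ) (Φ : Formula n k m) (l : Lit n) :
    occ n k m Φ l = (univ.filter fun s : Fin m × Fin k => Φ s.1 s.2 = l).card := by
  unfold occ
  rfl

lemma occ_sum {n k m : ℕ} (Φ : Formula n k m) (g : Lit n → ℝ) :
    ∑ s : Fin m × Fin k, g (Φ s.1 s.2) = ∑ l, (occ n k m Φ l : ℝ) * g l := by
  rw [← Finset.sum_fiberwise (s := (univ : Finset (Fin m × Fin k))) (g := fun s => Φ s.1 s.2)]
  refine Finset.sum_congr rfl fun l _ => ?_
  rw [occ_eq, ← nsmul_eq_mul, ← Finset.sum_const]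
  refine Finset.sum_congr ?_ fun s hs => ?_
  · ext; simp
  · rw [(Finset.mem_filter.1 hs).2]

lemma card_slots {n k m : ℕ} (d : Lit n → ℕ) (T : Fin m → Fin k → ℝ) (σ : Assignment n) (Ψ : Formula n k m)
    (hΨ : Ψ ∈ classT n k m d T) (t : ℝ) :
    (univ.filter fun s : Fin m × Fin k => T s.1 s.2 = t ∧ litVal σ (Ψ s.1 s.2) = true).card = Btrue k d σ t := by
  obtain ⟨h1, h2⟩ := (Finset.mem_filter.1 hΨ).2
  have := occ_sum Ψ (fun l => if pLit k d l = t ∧ litVal σ l = true then 1 else 0)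
  rw [Finset.sum_boole] at this
  have e : (univ.filter fun s : Fin m × Fin k => T s.1 s.2 = t ∧ litVal σ (Ψ s.1 s.2) = true) =
      (univ.filter fun s : Fin m × Fin k => pLit k d (Ψ s.1 s.2) = t ∧ litVal σ (Ψ s.1 s.2) = true) := by
    ext s; simp [h2]
  rw [e]
  have h3 : ((univ.filter fun s : Fin m × Fin k => pLit k d (Ψ s.1 s.2) = t ∧ litVal σ (Ψ s.1 s.2) = true).card : ℝ) =
      Btrue k d σ t := by
    rw [this]
    unfold Btrue; push_cast
    refine Finset.sum_congr rfl fun l _ => ?_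
    rw [show occ n k m Ψ l = d l from congrFun h1 l]
    split_ifs <;> simp
  exact_mod_cast h3

lemma fib_main {n k m : ℕ} (d : Lit n → ℕ) (T : Fin m → Fin k → ℝ) (hT01 : ∀ i j, 0 ≤ T i j ∧ T i j ≤ 1)
    (Λ : Finset (Fin k → ℝ)) (hT : ∀ i, T i ∈ Λ) (σ : Assignment n) (c : (Fin k → ℝ) → Fin k → ℤ)
    (hc : ∀ t : ℝ, ∑ q ∈ (Λ ×ˢ (univ : Finset (Fin k))).filter (fun q => q.1 q.2 = t), c q.1 q.2 = Btrue k d σ t) :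
    ((classT n k m d T).card : ℝ) * ∑ β ∈ BBset T Λ c, ∏ i, rowP0 (T i) (β i) ≤
      ((classT n k m d T).filter fun Ψ => (fun i j => litVal σ (Ψ i j)) ∈ BBset T Λ c).card := by
  have key := fib_abs (S := Fin m × Fin k) (L := Lit n) (fun s => T s.1 s.2) (fun s => hT01 _ _)
    ((classT n k m d T).map (Equiv.curry _ _ _).symm.toEmbedding) ?_ (litVal σ) (Btrue k d σ) ?_
    ((BBset T Λ c).map (Equiv.curry _ _ _).symm.toEmbedding) ?_
  · rw [Finset.card_map, Finset.sum_map] at key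
    have e1 : ∑ β ∈ BBset T Λ c, ∏ i, rowP0 (T i) (β i) =
        ∑ β ∈ BBset T Λ c, ∏ s : Fin m × Fin k, berw (T s.1 s.2) ((Equiv.curry _ _ _).symm.toEmbedding β s) := by
      refine Finset.sum_congr rfl fun β _ => ?_
      rw [Fintype.prod_prod_type]
      rfl
    rw [e1]
    refine key.trans (le_of_eq ?_)
    congr 1
    rw [Finset.filter_map, Finset.card_map]
    congr 1
    refine Finset.filter_congr fun Ψ _ => ?_
    simp only [Finset.mem_map_equiv, Function.comp]
    rfl
  · intro π hπ Ψ hΨ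
    simp only [Finset.mem_map_equiv] at hΨ ⊢
    obtain ⟨h1, h2⟩ := (Finset.mem_filter.1 hΨ).2
    refine Finset.mem_filter.2 ⟨Finset.mem_univ _, ?_, ?_⟩
    · rw [← h1]
      funext l
      unfold degSeq
      rw [occ_eq, occ_eq]
      refine Finset.card_equiv π fun s => ?_
      simp
    · intro i j
      rw [← hπ (i, j)]
      exact h2 (π (i,j)).1 (π (i,j)).2
  · intro Ψ hΨ t
    simp only [Finset.mem_map_equiv] at hΨ
    exact card_slots d T σ _ hΨ t
  · intro β hβ t
    simp only [Finset.mem_map_equiv] at hβ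
    have hb := (Finset.mem_filter.1 hβ).2.2
    have : ((univ.filter fun s : Fin m × Fin k => T s.1 s.2 = t ∧ β s = true).card : ℤ) = Btrue k d σ t := by
      rw [← hc t]
      rw [Finset.card_eq_sum_card_fiberwise (t := (Λ ×ˢ (univ : Finset (Fin k))).filter (fun q => q.1 q.2 = t))
        (f := fun s => (T s.1, s.2))]
      · push_cast
        refine Finset.sum_congr rfl fun q hq => ?_
        obtain ⟨hq1, hq2⟩ := Finset.mem_filter.1 hq
        rw [← hb q.1 (Finset.mem_product.1 hq1).1 q.2, Finset.filter_filter]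
        congr 1
        refine Finset.card_bij (fun s _ => s.1) ?_ ?_ ?_
        · rintro ⟨i, j⟩ h
          simp only [Finset.mem_filter, Finset.mem_univ, true_and, Prod.ext_iff] at h
          obtain ⟨⟨h1, h2⟩, h3, rfl⟩ := h
          exact Finset.mem_filter.2 ⟨Finset.mem_univ _, h3, h2⟩
        · rintro ⟨i, j⟩ h ⟨i', j'⟩ h' e
          simp only [Finset.mem_filter, Finset.mem_univ, true_and, Prod.ext_iff] at h h'
          obtain ⟨_, _, rfl⟩ := h
          obtain ⟨_, _, rfl⟩ := h'
          simp only at e; rw [e]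
        · intro i hi
          simp only [Finset.mem_filter, Finset.mem_univ, true_and] at hi
          refine ⟨(i, q.2), ?_, rfl⟩
          simp only [Finset.mem_filter, Finset.mem_univ, true_and, Prod.ext_iff, and_true]
          exact ⟨⟨by rw [hi.1, hq2], hi.2⟩, hi.1⟩
      · intro s hs
        have hs := (Finset.mem_filter.1 (Finset.mem_coe.1 hs)).2
        refine Finset.mem_coe.2 (Finset.mem_filter.2 ⟨Finset.mem_product.2 ⟨hT _, Finset.mem_univ _⟩, hs.1⟩)
    exact_mod_cast this
end

section
lemma class_lower {n k m : ℕ} (d : Lit n → ℕ) (mv : (Fin k → ℝ) → ℕ) (Λ : Finset (Fin k → ℝ))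
    (h01 : ∀ l : Lit n, 0 ≤ pLit k d l ∧ pLit k d l ≤ 1)
    (hcls : ∀ C : Clause n k, clauseType k d C ∈ Λ)
    (Sg : Finset (Assignment n)) (c : Assignment n → (Fin k → ℝ) → Fin k → ℤ)
    (hc : ∀ σ ∈ Sg, ∀ t : ℝ, ∑ q ∈ (Λ ×ˢ (univ : Finset (Fin k))).filter (fun q => q.1 q.2 = t), c σ q.1 q.2 = Btrue k d σ t)
    (hc2 : ∀ σ ∈ Sg, ∀ l ∈ Λ, ∀ j, |(c σ l j : ℝ) - l j * mv l| ≤ 2) (LB : ℝ)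
    (hLB : ∀ T : Fin m → Fin k → ℝ, (∀ i, T i ∈ Λ) → (∀ l, cntT T l = mv l) → ∀ σ ∈ Sg,
      LB ≤ ∑ β ∈ BBset T Λ (c σ), ∏ i, rowP0 (T i) (β i))
    (hne : (formulaClass n k m d mv).Nonempty) :
    Sg.card * LB ≤ expOver (formulaClass n k m d mv) (fun Ψ => (Zp 2 n k m d Ψ : ℝ)) := by
  unfold expOver
  have hpos : (0:ℝ) < (formulaClass n k m d mv).card := by exact_mod_cast hne.card_pos
  rw [le_div_iff₀ hpos]
  -- typing map
  set ty : Formula n k m → Fin m → Fin k → ℝ := fun Ψ i j => pLit k d (Ψ i j) with hty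
  set Cl := formulaClass n k m d mv with hCl
  have hfibre : ∀ T ∈ Cl.image ty, Cl.filter (fun Ψ => ty Ψ = T) = classT n k m d T := by
    intro T hT
    obtain ⟨Ψ0, h0, rfl⟩ := Finset.mem_image.1 hT
    obtain ⟨_, h0⟩ := (Finset.mem_filter.1 h0).2
    ext Ψ
    simp only [hCl, formulaClass, classT, Finset.mem_filter, Finset.mem_univ, true_and]
    constructor
    · rintro ⟨⟨a, b⟩, c⟩
      exact ⟨a, fun i j => congrFun (congrFun c i) j⟩
    · rintro ⟨a, b⟩
      refine ⟨⟨a, fun l => ?_⟩, funext fun i => funext fun j => b i j⟩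
      rw [← h0 l]
      unfold mCount
      congr 1
      refine Finset.filter_congr fun i _ => ?_
      have : clauseType k d (Ψ i) = clauseType k d (Ψ0 i) := funext fun j => b i j
      rw [this]
  have hcnt : ∀ T ∈ Cl.image ty, ∀ l, cntT T l = mv l := by
    intro T hT l
    obtain ⟨Ψ0, h0, rfl⟩ := Finset.mem_image.1 hT
    exact (Finset.mem_filter.1 h0).2.2 l
  have hTΛ : ∀ T ∈ Cl.image ty, ∀ i, T i ∈ Λ := by
    intro T hT i
    obtain ⟨Ψ0, h0, rfl⟩ := Finset.mem_image.1 hT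
    exact hcls (Ψ0 i)
  have hT01 : ∀ T ∈ Cl.image ty, ∀ i j, 0 ≤ T i j ∧ T i j ≤ 1 := by
    intro T hT i
    obtain ⟨Ψ0, h0, rfl⟩ := Finset.mem_image.1 hT
    exact fun j => h01 _
  -- for each σ
  have hσ : ∀ σ ∈ Sg, LB * Cl.card ≤ ((Cl.filter fun Ψ => Satisfies σ Ψ ∧ Judicious 2 n k m d Ψ σ).card : ℝ) := by
    intro σ hσ
    rw [Finset.card_eq_sum_card_fiberwise (s := Cl) (t := Cl.image ty) (f := ty) (fun Ψ h => Finset.mem_coe.2 (Finset.mem_image_of_mem _ (Finset.mem_coe.1 h))),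
      Finset.card_eq_sum_card_fiberwise (s := Cl.filter _) (t := Cl.image ty) (f := ty) (fun Ψ h => Finset.mem_coe.2 (Finset.mem_image_of_mem _ (Finset.mem_filter.1 (Finset.mem_coe.1 h)).1))]
    push_cast
    rw [Finset.mul_sum]
    refine Finset.sum_le_sum fun T hT => ?_
    rw [hfibre T hT]
    have h1 := fib_main (n := n) d T (hT01 T hT) Λ (hTΛ T hT) σ (c σ) (hc σ hσ)
    have h2 := hLB T (hTΛ T hT) (hcnt T hT) σ hσ
    calc LB * ((classT n k m d T).card : ℝ) ≤ (classT n k m d T).card * ∑ β ∈ BBset T Λ (c σ), ∏ i, rowP0 (T i) (β i) := by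
          rw [mul_comm]; gcongr
      _ ≤ _ := h1
      _ ≤ _ := by
        norm_cast
        refine Finset.card_le_card fun Ψ hΨ => ?_
        obtain ⟨a, b⟩ := Finset.mem_filter.1 hΨ
        rw [← hfibre T hT] at a
        obtain ⟨a1, a2⟩ := Finset.mem_filter.1 a
        obtain ⟨b1, b2⟩ := (Finset.mem_filter.1 b).2
        refine Finset.mem_filter.2 ⟨Finset.mem_filter.2 ⟨a1, b1, ?_⟩, a2⟩
        intro l j
        have hm : mCount n k m d Ψ l = mv l := (Finset.mem_filter.1 a1).2.2 l
        rw [hm]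
        by_cases hl : l ∈ Λ
        · have e : (univ.filter fun i : Fin m => clauseType k d (Ψ i) = l ∧ litVal σ (Ψ i j) = true) =
              univ.filter fun i => T i = l ∧ litVal σ (Ψ i j) = true := by
            subst a2; rfl
          rw [e]
          have := b2 l hl j
          have h3 : ((univ.filter fun i => T i = l ∧ litVal σ (Ψ i j) = true).card : ℝ) = c σ l j := by exact_mod_cast this
          rw [h3]
          exact hc2 σ hσ l hl j
        · have e : (univ.filter fun i : Fin m => clauseType k d (Ψ i) = l ∧ litVal σ (Ψ i j) = true) = ∅ := by
            refine Finset.filter_eq_empty_iff.2 fun i _ h => hl ?_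
            rw [← h.1]; exact hcls _
          have e2 : mv l = 0 := by
            rw [← hm]; unfold mCount
            rw [Finset.card_eq_zero]
            refine Finset.filter_eq_empty_iff.2 fun i _ h => hl ?_
            rw [← h]; exact hcls _
          rw [e, e2]; simp
  calc (Sg.card : ℝ) * LB * Cl.card = ∑ σ ∈ Sg, LB * Cl.card := by simp; ring
    _ ≤ ∑ σ ∈ Sg, ((Cl.filter fun Ψ => Satisfies σ Ψ ∧ Judicious 2 n k m d Ψ σ).card : ℝ) := Finset.sum_le_sum hσ
    _ ≤ ∑ σ, ((Cl.filter fun Ψ => Satisfies σ Ψ ∧ Judicious 2 n k m d Ψ σ).card : ℝ) :=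
        Finset.sum_le_sum_of_subset_of_nonneg (Finset.subset_univ _) fun _ _ _ => by positivity
    _ = ∑ Ψ ∈ Cl, (Zp 2 n k m d Ψ : ℝ) := by
        unfold Zp
        norm_cast
        simp only [Finset.card_filter]
        rw [Finset.sum_comm]
end

section
/-! Part C7: types, and assignments with balanced type counts -/

def bb (k : ℕ) : ℕ := ⌊10 * Real.sqrt ((k : ℝ) * 2 ^ k * Real.log k)⌋₊
def fz (k : ℕ) (z : ℤ) : ℤ := if |z| ≤ bb k then z else 0
def tt (k : ℕ) (u : ℤ) : ℝ := 1 / 2 + (u : ℝ) / 2 ^ (k + 1)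
def TT (k : ℕ) : Finset ℝ := (Finset.Icc (-(bb k : ℤ)) (bb k)).image (tt k)

lemma pBP_eq (k : ℕ) (z : ℤ) : pBP k z = tt k (fz k z) := by
  have h : |(z:ℝ)| ≤ 10 * Real.sqrt ((k : ℝ) * 2 ^ k * Real.log k) ↔ |z| ≤ bb k := by
    have h0 : 0 ≤ 10 * Real.sqrt ((k : ℝ) * 2 ^ k * Real.log k) := by positivity
    have e : |(z:ℝ)| = (z.natAbs : ℝ) := by rw [Nat.cast_natAbs]; simp
    rw [e, bb, ← Nat.le_floor_iff h0, Int.abs_eq_natAbs]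
    exact_mod_cast Iff.rfl
  unfold pBP fz tt
  by_cases hz : |z| ≤ bb k
  · rw [if_pos (h.2 hz), if_pos hz]
  · rw [if_neg (fun h' => hz (h.1 h')), if_neg hz]; simp

lemma tt_neg (k : ℕ) (u : ℤ) : tt k (-u) = 1 - tt k u := by unfold tt; push_cast; ring
lemma tt_inj (k : ℕ) : Function.Injective (tt k) := by
  intro u v h
  unfold tt at h
  have h2 : (0:ℝ) < 2 ^ (k+1) := by positivity
  have : (u:ℝ) = v := by
    have := add_left_cancel h
    rwa [div_left_inj' h2.ne'] at this
  exact_mod_cast this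
lemma fz_neg (k : ℕ) (z : ℤ) : fz k (-z) = - fz k z := by unfold fz; rw [abs_neg]; split_ifs <;> simp
lemma fz_mem (k : ℕ) (z : ℤ) : fz k z ∈ Finset.Icc (-(bb k : ℤ)) (bb k) := by
  unfold fz; rw [Finset.mem_Icc]; split_ifs with h
  · exact abs_le.1 h
  · constructor <;> simp
lemma fz_self {k : ℕ} {z : ℤ} (h : |z| ≤ bb k) : fz k z = z := by unfold fz; rw [if_pos h]
lemma fz_abs (k : ℕ) (z : ℤ) : |fz k z| ≤ |z| := by unfold fz; split_ifs <;> simp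

lemma tt_mem {k : ℕ} {u : ℤ} (h : |u| ≤ bb k) : tt k u ∈ TT k :=
  Finset.mem_image_of_mem _ (Finset.mem_Icc.2 (abs_le.1 h))

lemma TT_card (k : ℕ) : (TT k).card = 2 * bb k + 1 := by
  unfold TT
  rw [Finset.card_image_of_injective _ (tt_inj k)]
  simp; omega

/-- signed degree difference of a literal -/
def zl {n : ℕ} (d : Lit n → ℕ) (l : Lit n) : ℤ := (d l : ℤ) - d (l.1, !l.2)

lemma pLit_eq {n : ℕ} (k : ℕ) (d : Lit n → ℕ) (l : Lit n) : pLit k d l = tt k (fz k (zl d l)) := by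
  obtain ⟨x, b⟩ := l
  unfold pLit zl
  cases b
  · simp only [Bool.false_eq_true, if_false, Bool.not_false]
    rw [pBP_eq, ← tt_neg, ← fz_neg]
    congr 2; ring
  · simp only [if_true, Bool.not_true]
    rw [pBP_eq]

lemma pLit_mem {n : ℕ} (k : ℕ) (d : Lit n → ℕ) (l : Lit n) : pLit k d l ∈ TT k := by
  rw [pLit_eq]; exact Finset.mem_image_of_mem _ (fz_mem _ _)

lemma pLit_false {n : ℕ} (k : ℕ) (d : Lit n → ℕ) (x : Fin n) : pLit k d (x, false) = 1 - pLit k d (x, true) := by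
  simp [pLit]

def Dt {n : ℕ} (k : ℕ) (d : Lit n → ℕ) (t : ℝ) : ℝ := ∑ l : Lit n, if pLit k d l = t then (d l : ℝ) else 0

def fv {n : ℕ} (k : ℕ) (d : Lit n → ℕ) (t : ℝ) (x : Fin n) (y : Bool) : ℝ :=
  (if pLit k d (x, true) = t ∧ y = true then (d (x, true) : ℝ) else 0) +
  (if pLit k d (x, false) = t ∧ y = false then (d (x, false) : ℝ) else 0)

/-- coefficient -/
def cf {n : ℕ} (k : ℕ) (d : Lit n → ℕ) (t : ℝ) (x : Fin n) : ℝ :=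
  (if pLit k d (x, true) = t then (d (x, true) : ℝ) else 0) - (if pLit k d (x, false) = t then (d (x, false) : ℝ) else 0)

def i1 (y : Bool) : ℝ := if y = true then 1 else 0

lemma fv_mean {n : ℕ} (k : ℕ) (d : Lit n → ℕ) (t : ℝ) (x : Fin n) :
    ∑ y, berw (pLit k d (x, true)) y * fv k d t x y =
      t * ((if pLit k d (x, true) = t then (d (x, true) : ℝ) else 0) + if pLit k d (x, false) = t then (d (x, false) : ℝ) else 0) := by
  have h := pLit_false k d x
  simp only [Fintype.sum_bool, berw, fv, if_true, Bool.false_eq_true, if_false, and_true, and_false, add_zero, zero_add, reduceCtorEq]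
  rw [← h]
  split_ifs with h1 h2 h2 <;> simp [h1, h2] <;> ring

lemma fv_dev {n : ℕ} (k : ℕ) (d : Lit n → ℕ) (t : ℝ) (x : Fin n) (y : Bool) :
    fv k d t x y - ∑ y, berw (pLit k d (x, true)) y * fv k d t x y = (i1 y - pLit k d (x, true)) * cf k d t x := by
  have h := pLit_false k d x
  have h' : pLit k d (x, true) = 1 - pLit k d (x, false) := by linarith
  rw [fv_mean]
  unfold fv cf i1
  cases y
  · simp only [Bool.false_eq_true, and_false, if_false, and_true, zero_add, zero_sub, reduceCtorEq]
    by_cases a : pLit k d (x, true) = t <;> by_cases b : pLit k d (x, false) = t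
    · simp only [a, b, if_true]; rw [a, b] at h; ring_nf; nlinarith
    · simp only [a, b, if_true, if_false]; ring
    · simp only [a, b, if_true, if_false]; rw [h', b]; ring
    · simp [a, b]
  · simp only [and_false, if_false, and_true, add_zero, if_true, reduceCtorEq]
    by_cases a : pLit k d (x, true) = t <;> by_cases b : pLit k d (x, false) = t
    · simp only [a, b, if_true]; rw [a, b] at h; 
      have : (d (x, false) : ℝ) * (t - (1 - t)) = 0 := by rw [← h]; ring
      linarith
    · simp only [a, b, if_true, if_false]; ring
    · simp only [a, b, if_true, if_false]; rw [h', b]; ring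
    · simp [a, b]

lemma Btrue_eq {n : ℕ} (k : ℕ) (d : Lit n → ℕ) (σ : Assignment n) (t : ℝ) :
    (Btrue k d σ t : ℝ) = ∑ x, fv k d t x (σ x) := by
  unfold Btrue
  push_cast
  rw [Fintype.sum_prod_type]
  refine Finset.sum_congr rfl fun x _ => ?_
  rw [Fintype.sum_bool]
  unfold fv litVal
  simp

lemma Dt_eq {n : ℕ} (k : ℕ) (d : Lit n → ℕ) (t : ℝ) :
    t * Dt k d t = ∑ x, ∑ y, berw (pLit k d (x, true)) y * fv k d t x y := by
  unfold Dt
  rw [Fintype.sum_prod_type, Finset.mul_sum]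
  refine Finset.sum_congr rfl fun x _ => ?_
  rw [fv_mean, Fintype.sum_bool]

lemma BD_dev {n : ℕ} (k : ℕ) (d : Lit n → ℕ) (σ : Assignment n) (t : ℝ) :
    (Btrue k d σ t : ℝ) - t * Dt k d t = ∑ x, (i1 (σ x) - pLit k d (x, true)) * cf k d t x := by
  rw [Btrue_eq, Dt_eq, ← Finset.sum_sub_distrib]
  exact Finset.sum_congr rfl fun x _ => fv_dev k d t x _

/-- balanced assignments -/
def SgSet {n : ℕ} (k : ℕ) (d : Lit n → ℕ) : Finset (Assignment n) :=
  univ.filter fun σ => ∀ t ∈ TT k, |(Btrue k d σ t : ℝ) - t * Dt k d t| ≤ bb k + 1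

def om (k : ℕ) (t : ℝ) : ℝ := Real.log (t / (1 - t)) / ((t - 1 / 2) * 2 ^ (k + 1))

lemma om_symm (k : ℕ) (t : ℝ) : om k (1 - t) = om k t := by
  unfold om
  rw [show (1 - t) / (1 - (1 - t)) = (t / (1 - t))⁻¹ by rw [inv_div]; ring_nf, Real.log_inv,
    show (1 - t - 1 / 2) * (2:ℝ) ^ (k+1) = -((t - 1/2) * 2 ^ (k+1)) by ring, neg_div_neg_eq]

lemma om_sum {n : ℕ} (k : ℕ) (d : Lit n → ℕ) (x : Fin n) :
    ∑ t ∈ TT k, om k t * cf k d t x = Real.log (pLit k d (x, true) / (1 - pLit k d (x, true))) := by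
  unfold cf
  simp only [mul_sub, Finset.sum_sub_distrib, mul_ite, mul_zero]
  rw [Finset.sum_ite_eq, Finset.sum_ite_eq, if_pos (pLit_mem _ _ _), if_pos (pLit_mem _ _ _), pLit_false, om_symm, ← mul_sub]
  have e : pLit k d (x, true) = tt k (fz k ((d (x, true) : ℤ) - d (x, false))) := by rw [pLit_eq]; rfl
  by_cases h : fz k ((d (x, true) : ℤ) - d (x, false)) = 0
  · rw [e, h]
    have : tt k 0 = 1 / 2 := by simp [tt]
    rw [this]
    have : (1:ℝ)/2 / (1 - 1/2) = 1 := by norm_num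
    unfold om
    rw [this]; simp
  · have hz : fz k ((d (x, true) : ℤ) - d (x, false)) = (d (x, true) : ℤ) - d (x, false) := by
      unfold fz at h ⊢
      split_ifs with h1
      · rfl
      · simp [h1] at h
    have hne : ((d (x, true) : ℝ) - d (x, false)) ≠ 0 := by
      rw [hz] at h; exact_mod_cast h
    unfold om
    have h3 : (pLit k d (x, true) - 1 / 2) * 2 ^ (k+1) = (d (x, true) : ℝ) - d (x, false) := by
      rw [e, hz]; unfold tt; push_cast; field_simp; ring
    rw [h3]; field_simp

lemma weight_bound {n : ℕ} (k : ℕ) (d : Lit n → ℕ) (hp : ∀ x, 0 < pLit k d (x, true) ∧ pLit k d (x, true) < 1)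
    (σ : Assignment n) (hσ : σ ∈ SgSet k d) :
    PW (fun x => berw (pLit k d (x, true))) σ ≤
      Real.exp (-(∑ x, Real.binEntropy (pLit k d (x, true))) + ∑ t ∈ TT k, |om k t| * (bb k + 1)) := by
  have e : ∀ x, berw (pLit k d (x, true)) (σ x) = Real.exp (-Real.binEntropy (pLit k d (x, true)) +
      (i1 (σ x) - pLit k d (x, true)) * Real.log (pLit k d (x, true) / (1 - pLit k d (x, true)))) := by
    intro x
    obtain ⟨h0, h1⟩ := hp x
    set p := pLit k d (x, true)
    rw [Real.binEntropy, Real.log_inv, Real.log_inv, Real.log_div h0.ne' (by linarith)]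
    unfold berw i1
    split_ifs
    · refine (Real.exp_log h0).symm.trans ?_
      congr 1; ring
    · refine (Real.exp_log (by linarith : 0 < 1 - p)).symm.trans ?_
      congr 1; ring
  unfold PW
  rw [Finset.prod_congr rfl fun x _ => e x, ← Real.exp_sum]
  apply Real.exp_le_exp.2
  rw [Finset.sum_add_distrib, Finset.sum_neg_distrib]
  refine add_le_add le_rfl ?_
  have h1 : ∑ x, (i1 (σ x) - pLit k d (x, true)) * Real.log (pLit k d (x, true) / (1 - pLit k d (x, true))) =
      ∑ t ∈ TT k, om k t * ((Btrue k d σ t : ℝ) - t * Dt k d t) := by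
    rw [Finset.sum_congr rfl fun x _ => by rw [← om_sum k d x, Finset.mul_sum], Finset.sum_comm]
    refine Finset.sum_congr rfl fun t _ => ?_
    rw [BD_dev, Finset.mul_sum]
    refine Finset.sum_congr rfl fun x _ => by ring
  rw [h1]
  refine Finset.sum_le_sum fun t ht => ?_
  refine (le_abs_self _).trans ?_
  rw [abs_mul]
  exact mul_le_mul_of_nonneg_left ((Finset.mem_filter.1 hσ).2 t ht) (abs_nonneg _)
end

section
/-! Part C8: many balanced assignments -/

/-- number of variables with given degrees -/
def Nab {n : ℕ} (d : Lit n → ℕ) (q : ℕ × ℕ) : ℕ := (univ.filter fun x : Fin n => (d (x, true), d (x, false)) = q).card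

def KK (k : ℕ) : Finset (ℕ × ℕ) :=
  (Finset.Icc 1 (bb k + 1)).image (fun z => (z, 0)) ∪ (Finset.Icc 1 (bb k)).image (fun z => (z + 1, 1))

lemma KK_sum (k : ℕ) (F : ℕ × ℕ → ℝ) : ∑ q ∈ KK k, F q =
    ∑ z ∈ Finset.Icc 1 (bb k + 1), F (z, 0) + ∑ z ∈ Finset.Icc 1 (bb k), F (z + 1, 1) := by
  unfold KK
  rw [Finset.sum_union, Finset.sum_image, Finset.sum_image]
  · intro a _ b _ h; simpa using h
  · intro a _ b _ h; simpa using h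
  · rw [Finset.disjoint_left]
    intro q h1 h2
    simp only [Finset.mem_image] at h1 h2
    obtain ⟨a, _, rfl⟩ := h1
    obtain ⟨b, _, h⟩ := h2
    simp at h

/-- type of pair -/
def tq (k : ℕ) (q : ℕ × ℕ) : ℝ := tt k (fz k ((q.1 : ℤ) - q.2))
/-- coefficient of pair -/
def cq (k : ℕ) (t : ℝ) (q : ℕ × ℕ) : ℝ :=
  (if tq k q = t then (q.1 : ℝ) else 0) - (if 1 - tq k q = t then (q.2 : ℝ) else 0)

lemma cf_eq {n : ℕ} (k : ℕ) (d : Lit n → ℕ) (t : ℝ) (x : Fin n) : cf k d t x = cq k t (d (x, true), d (x, false)) := by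
  unfold cf cq
  rw [pLit_false, pLit_eq]; rfl

lemma pLit_tq {n : ℕ} (k : ℕ) (d : Lit n → ℕ) (x : Fin n) : pLit k d (x, true) = tq k (d (x, true), d (x, false)) := by
  rw [pLit_eq]; rfl

lemma round_nat (v : ℝ) (R : ℕ) (h0 : 0 ≤ v) (h1 : v + 1 ≤ R) : ∃ g : ℕ, g ≤ R ∧ |(g:ℝ) - v| ≤ 1 := by
  refine ⟨⌊v⌋₊, ?_, ?_⟩
  · have := Nat.floor_le h0
    have : ((⌊v⌋₊ : ℕ) : ℝ) ≤ R := by linarith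
    exact_mod_cast this
  · have a := Nat.floor_le h0
    have b := Nat.lt_floor_add_one v
    rw [abs_le]; constructor <;> linarith

set_option maxHeartbeats 1000000 in
/-- the integer corrections -/
lemma fix_counts (k R : ℕ) (hb1 : (bb k : ℝ) / 2 ^ (k + 1) ≤ 1 / 20) (hR : 60 ≤ R) (dev : ℝ → ℝ)
    (hdev : ∀ t ∈ TT k, |dev t| ≤ (R:ℝ) / 20) :
    ∃ g : ℕ × ℕ → ℕ, (∀ q, g q ≤ R) ∧ ∀ t ∈ TT k, |dev t + ∑ q ∈ KK k, cq k t q * (g q - tq k q * R)| ≤ bb k + 1 := by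
  have hR' : (60:ℝ) ≤ R := by exact_mod_cast hR
  have hP : (0:ℝ) < 2 ^ (k+1) := by positivity
  have ht : ∀ z : ℕ, z ≤ bb k → 1/2 ≤ tt k z ∧ tt k z ≤ 0.55 := by
    intro z hz
    have hz' : (z:ℝ) ≤ bb k := by exact_mod_cast hz
    unfold tt
    push_cast
    have h1 : (z:ℝ) / 2 ^ (k+1) ≤ 1/20 := le_trans (by gcongr) hb1
    have h0 : 0 ≤ (z:ℝ) / 2 ^ (k+1) := by positivity
    constructor
    · linarith
    · norm_num; linarith
  have h2 : ∀ z : ℕ, ∃ g : ℕ, g ≤ R ∧ (1 ≤ z → z ≤ bb k → |(g:ℝ) - (tt k z * R + dev (tt k (-z)))| ≤ 1) := by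
    intro z
    by_cases hz : z ≤ bb k
    · have hd := abs_le.1 (hdev (tt k (-z)) (tt_mem (by rw [abs_neg, Nat.abs_cast]; exact_mod_cast hz)))
      have := ht z hz
      norm_num at this
      obtain ⟨g, hg, hg2⟩ := round_nat (tt k z * R + dev (tt k (-z))) R (by nlinarith) (by nlinarith)
      exact ⟨g, hg, fun _ _ => hg2⟩
    · exact ⟨0, Nat.zero_le _, fun _ h => absurd h hz⟩
  choose g2 hg2 hg2' using h2
  have hdel : ∀ z : ℕ, 1 ≤ z → z ≤ bb k → |(g2 z : ℝ) - tt k z * R| ≤ (R:ℝ)/20 + 1 := by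
    intro z h1 h2
    have hd := abs_le.1 (hdev (tt k (-z)) (tt_mem (by rw [abs_neg, Nat.abs_cast]; exact_mod_cast h2)))
    have := abs_le.1 (hg2' z h1 h2)
    rw [abs_le]; constructor <;> linarith
  have h1 : ∀ z : ℕ, ∃ g : ℕ, g ≤ R ∧ (1 ≤ z → z ≤ bb k → |dev (tt k z) + z * (g - tt k z * R) + (z+1) * (g2 z - tt k z * R)| ≤ z) := by
    intro z
    by_cases hz : 1 ≤ z ∧ z ≤ bb k
    · have hd := hdev (tt k z) (tt_mem (by rw [Nat.abs_cast]; exact_mod_cast hz.2))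
      have hz1 : (1:ℝ) ≤ z := by exact_mod_cast hz.1
      have := ht z hz.2
      norm_num at this
      have hh : |(dev (tt k z) + (z+1) * (g2 z - tt k z * R)) / z| ≤ 3 * (R:ℝ)/20 + 2 := by
        rw [abs_div, abs_of_pos (by linarith : (0:ℝ) < z), div_le_iff₀ (by linarith)]
        refine (abs_add_le _ _).trans ?_
        rw [abs_mul, abs_of_pos (by linarith : (0:ℝ) < z + 1)]
        have := hdel z hz.1 hz.2
        have h3 : ((z:ℝ)+1) * |(g2 z : ℝ) - tt k z * R| ≤ (z+1) * ((R:ℝ)/20 + 1) := by gcongr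
        nlinarith
      set v := (dev (tt k z) + (z+1) * (g2 z - tt k z * R)) / z with hv
      have hh := abs_le.1 hh
      obtain ⟨g, hg, hg2⟩ := round_nat (tt k z * R - v) R (by nlinarith) (by nlinarith)
      refine ⟨g, hg, fun _ _ => ?_⟩
      have e : dev (tt k z) + z * (g - tt k z * R) + (z+1) * (g2 z - tt k z * R) = z * (g - (tt k z * R - v)) := by
        rw [hv]; field_simp; ring
      rw [e, abs_mul, abs_of_pos (by linarith : (0:ℝ) < z)]
      nlinarith
    · exact ⟨0, Nat.zero_le _, fun a b => absurd ⟨a, b⟩ hz⟩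
  choose g1 hg1 hg1' using h1
  obtain ⟨g0, hg0, hg0'⟩ : ∃ g : ℕ, g ≤ R ∧ |dev (tt k 0) + (bb k + 1) * (g - 1/2 * R)| ≤ bb k + 1 := by
    have hd := hdev (tt k 0) (tt_mem (by simp))
    have hz1 : (1:ℝ) ≤ bb k + 1 := by linarith [(Nat.cast_nonneg (bb k) : (0:ℝ) ≤ bb k)]
    have hh : |dev (tt k 0) / (bb k + 1)| ≤ (R:ℝ)/20 := by
      rw [abs_div, abs_of_pos (by linarith : (0:ℝ) < (bb k:ℝ) + 1), div_le_iff₀ (by linarith)]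
      nlinarith
    set v := dev (tt k 0) / (bb k + 1) with hv
    have hh := abs_le.1 hh
    obtain ⟨g, hg, hg2⟩ := round_nat (1/2 * R - v) R (by linarith) (by linarith)
    refine ⟨g, hg, ?_⟩
    have e : dev (tt k 0) + (bb k + 1) * (g - 1/2 * R) = (bb k + 1) * (g - (1/2 * R - v)) := by
      rw [hv]; field_simp; ring
    rw [e, abs_mul, abs_of_pos (by linarith : (0:ℝ) < (bb k:ℝ) + 1)]
    nlinarith
  refine ⟨fun q => if q.2 = 0 then (if q.1 = bb k + 1 then g0 else g1 q.1) else g2 (q.1 - 1), ?_, ?_⟩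
  · intro q; simp only; split_ifs
    · exact hg0
    · exact hg1 _
    · exact hg2 _
  · intro t htT
    obtain ⟨u, hu, rfl⟩ := Finset.mem_image.1 htT
    rw [Finset.mem_Icc] at hu
    rw [KK_sum]
    -- types of the pairs
    have t1 : ∀ z : ℕ, z ≤ bb k → tq k (z, 0) = tt k z := by
      intro z hz; unfold tq
      simp only [Nat.cast_zero, sub_zero]
      rw [fz_self (by rw [Nat.abs_cast]; exact_mod_cast hz)]
    have t0 : tq k (bb k + 1, 0) = tt k 0 := by
      unfold tq fz
      rw [if_neg]
      intro h
      have := (abs_le.1 h).2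
      push_cast at this
      omega
    have t2 : ∀ z : ℕ, z ≤ bb k → tq k (z + 1, 1) = tt k z := by
      intro z hz; unfold tq
      simp only [Nat.cast_add, Nat.cast_one, add_sub_cancel_right]
      rw [fz_self (by rw [Nat.abs_cast]; exact_mod_cast hz)]
    have tt0 : tt k 0 = 1/2 := by simp [tt]
    have S1 : ∑ z ∈ Finset.Icc 1 (bb k + 1), cq k (tt k u) (z, 0) *
        (((if (z, 0).2 = 0 then (if (z, 0).1 = bb k + 1 then g0 else g1 (z, 0).1) else g2 ((z, 0).1 - 1) : ℕ) : ℝ) - tq k (z, 0) * R) =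
        ∑ z ∈ Finset.Icc 1 (bb k), (if (z:ℤ) = u then (z:ℝ) * (g1 z - tt k z * R) else 0) + if u = 0 then ((bb k:ℝ) + 1) * (g0 - 1/2 * R) else 0 := by
      rw [Finset.sum_Icc_succ_top (by omega)]
      congr 1
      · refine Finset.sum_congr rfl fun z hz => ?_
        rw [Finset.mem_Icc] at hz
        simp only [if_true]
        rw [if_neg (by omega), t1 z hz.2]
        unfold cq
        rw [t1 z hz.2]
        simp only [(tt_inj k).eq_iff, Nat.cast_zero, ite_self, sub_zero]
        split_ifs <;> simp
      · simp only [if_true]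
        rw [t0]
        unfold cq
        rw [t0]
        simp only [(tt_inj k).eq_iff, Nat.cast_zero, ite_self, sub_zero]
        by_cases h : u = 0
        · subst h; simp [tt0]
        · rw [if_neg (fun h' => h h'.symm), if_neg h]; simp
    have S2 : ∑ z ∈ Finset.Icc 1 (bb k), cq k (tt k u) (z + 1, 1) *
        (((if (z + 1, 1).2 = 0 then (if (z + 1, 1).1 = bb k + 1 then g0 else g1 (z + 1, 1).1) else g2 ((z + 1, 1).1 - 1) : ℕ) : ℝ) - tq k (z + 1, 1) * R) =
        ∑ z ∈ Finset.Icc 1 (bb k), (((if (z:ℤ) = u then (z:ℝ) + 1 else 0) - (if -(z:ℤ) = u then 1 else 0)) * (g2 z - tt k z * R)) := by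
      refine Finset.sum_congr rfl fun z hz => ?_
      rw [Finset.mem_Icc] at hz
      simp only [one_ne_zero, if_false, Nat.add_sub_cancel]
      rw [t2 z hz.2]
      unfold cq
      rw [t2 z hz.2, ← tt_neg]
      simp only [(tt_inj k).eq_iff]
      push_cast; rfl
    rw [S1, S2]
    rcases lt_trichotomy u 0 with hneg | rfl | hpos
    · obtain ⟨z, rfl⟩ : ∃ z : ℕ, u = -(z:ℤ) := ⟨u.natAbs, by omega⟩
      have hz1 : 1 ≤ z := by omega
      have hz2 : z ≤ bb k := by omega
      rw [if_neg (by omega), Finset.sum_eq_zero, Finset.sum_eq_single z]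
      · rw [if_neg (by omega), if_pos rfl]
        have := abs_le.1 (hg2' z hz1 hz2)
        have hb0 : (0:ℝ) ≤ bb k := Nat.cast_nonneg _
        rw [abs_le]; constructor <;> linarith
      · intro y _ hy
        rw [if_neg (by omega), if_neg (by omega)]; simp
      · intro h; rw [Finset.mem_Icc] at h; omega
      · intro y hy; rw [Finset.mem_Icc] at hy; rw [if_neg (by omega)]
    · rw [if_pos rfl, Finset.sum_eq_zero, Finset.sum_eq_zero]
      · simpa using hg0'
      · intro y hy; rw [Finset.mem_Icc] at hy; rw [if_neg (by omega), if_neg (by omega)]; simp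
      · intro y hy; rw [Finset.mem_Icc] at hy; rw [if_neg (by omega)]
    · obtain ⟨z, rfl⟩ : ∃ z : ℕ, u = (z:ℤ) := ⟨u.natAbs, by omega⟩
      have hz1 : 1 ≤ z := by omega
      have hz2 : z ≤ bb k := by omega
      rw [if_neg (by omega), Finset.sum_eq_single z, Finset.sum_eq_single z]
      · rw [if_pos rfl, if_pos rfl, if_neg (by omega)]
        have := hg1' z hz1 hz2
        have hb0 : (z:ℝ) ≤ bb k := by exact_mod_cast hz2
        rw [show dev (tt k z) + ((z:ℝ) * (g1 z - tt k z * R) + 0 + ((z:ℝ) + 1 - 0) * (g2 z - tt k z * R)) =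
          dev (tt k z) + z * (g1 z - tt k z * R) + (z+1) * (g2 z - tt k z * R) by ring]
        linarith
      · intro y _ hy
        rw [if_neg (by omega), if_neg (by omega)]; simp
      · intro h; rw [Finset.mem_Icc] at h; omega
      · intro y _ hy
        rw [if_neg (by omega)]
      · intro h; rw [Finset.mem_Icc] at h; omega

set_option maxHeartbeats 1000000 in
lemma asg_prob {n : ℕ} (k : ℕ) (d : Lit n → ℕ) (hb1 : (bb k : ℝ) / 2 ^ (k + 1) ≤ 1 / 20)
    (R : ℕ) (hR60 : 60 ≤ R) (hR : ∀ q ∈ KK k, R ≤ Nab d q)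
    (hV : ((2 * bb k + 1 : ℕ) : ℝ) * ∑ x : Fin n, ((d (x, true) : ℝ) + d (x, false)) ^ 2 ≤ ((R:ℝ) / 20) ^ 2 / 2) :
    (1 / 4 : ℝ) ^ ((KK k).card * R) / 2 ≤ ∑ σ ∈ SgSet k d, PW (fun x => berw (pLit k d (x, true))) σ := by
  have hR60' : (60:ℝ) ≤ R := by exact_mod_cast hR60
  have hp : ∀ l : Lit n, 0.45 ≤ pLit k d l ∧ pLit k d l ≤ 0.55 := by
    intro l
    rw [pLit_eq]
    have h := Finset.mem_Icc.1 (fz_mem k (zl d l))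
    have h1 : (-(bb k:ℝ)) ≤ fz k (zl d l) := by exact_mod_cast h.1
    have h2 : (fz k (zl d l) : ℝ) ≤ bb k := by exact_mod_cast h.2
    have h3 : -((bb k : ℝ) / 2 ^ (k + 1)) ≤ (fz k (zl d l) : ℝ) / 2 ^ (k+1) := by
      rw [← neg_div]; gcongr
    have h4 : (fz k (zl d l) : ℝ) / 2 ^ (k+1) ≤ (bb k : ℝ) / 2 ^ (k + 1) := by gcongr
    unfold tt
    constructor <;> norm_num <;> linarith
  have hch : ∀ q : ℕ × ℕ, ∃ Jl : Finset (Fin n), Jl ⊆ univ.filter (fun x => (d (x, true), d (x, false)) = q) ∧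
      (q ∈ KK k → Jl.card = R) ∧ (q ∉ KK k → Jl = ∅) := by
    intro q
    by_cases h : q ∈ KK k
    · obtain ⟨J, h1, h2⟩ := Finset.exists_subset_card_eq (s := univ.filter (fun x : Fin n => (d (x, true), d (x, false)) = q)) (n := R) (hR q h)
      exact ⟨J, h1, fun _ => h2, fun h' => absurd h h'⟩
    · exact ⟨∅, by simp, fun h' => absurd h' h, fun _ => rfl⟩
  choose Jf hJ1 hJ2 hJ3 using hch
  set D : Fin n → ℕ × ℕ := fun x => (d (x, true), d (x, false)) with hD
  have hJT : ∀ l, ∀ i ∈ Jf l, D i = l := fun l i hi => (Finset.mem_filter.1 (hJ1 l hi)).2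
  set J : Finset (Fin n) := univ.filter fun i => i ∈ Jf (D i) with hJ
  have hJK : ∀ x ∈ J, D x ∈ KK k := by
    intro x hx
    by_contra h
    have := (Finset.mem_filter.1 hx).2
    rw [hJ3 _ h] at this; simp at this
  have hJl : ∀ l, J.filter (fun i => D i = l) = Jf l := by
    intro l; ext i
    simp only [hJ, Finset.mem_filter, Finset.mem_univ, true_and]
    constructor
    · rintro ⟨a, rfl⟩; exact a
    · intro h; have := hJT l i h; exact ⟨by rw [this]; exact h, this⟩
  have hJc : J.card = (KK k).card * R := by
    rw [Finset.card_eq_sum_card_fiberwise (t := KK k) (f := D) (fun i hi => hJK i hi)]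
    rw [Finset.sum_congr rfl fun l hlΛ => by rw [hJl l, hJ2 l hlΛ]]
    simp
  rw [← hJc]
  have hcf : ∀ t x, |cf k d t x| ≤ (d (x, true) : ℝ) + d (x, false) := by
    intro t x
    unfold cf
    have a : (0:ℝ) ≤ d (x, true) := Nat.cast_nonneg _
    have b : (0:ℝ) ≤ d (x, false) := Nat.cast_nonneg _
    rw [abs_le]; split_ifs <;> constructor <;> linarith
  refine TR (Q := ↥(TT k)) (fun x => berw (pLit k d (x, true))) (fun x a => berw_nonneg (by have := (hp (x, true)).1; norm_num at this; linarith) (by have := (hp (x, true)).2; norm_num at this; linarith) a)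
    (fun x => berw_sum _) J _ (by positivity)
    (fun q x y => fv k d q.1 x y) ((R:ℝ) / 20) (by positivity) (fun _ x => (d (x, true) : ℝ) + d (x, false)) ?_ ?_ _ ?_
  · intro q x a b
    have h1 := fv_dev k d q.1 x a
    have h2 := fv_dev k d q.1 x b
    have e : fv k d q.1 x a - fv k d q.1 x b = (i1 a - i1 b) * cf k d q.1 x := by linarith
    rw [e, abs_mul]
    have : |i1 a - i1 b| ≤ 1 := by unfold i1; split_ifs <;> norm_num
    calc |i1 a - i1 b| * |cf k d q.1 x| ≤ 1 * ((d (x, true) : ℝ) + d (x, false)) := mul_le_mul this (hcf _ _) (abs_nonneg _) (by norm_num)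
      _ = _ := one_mul _
  · refine le_trans ?_ hV
    rw [Finset.sum_const, nsmul_eq_mul, Finset.card_univ, Fintype.card_coe, TT_card]
    gcongr
    exact Finset.subset_univ _
  · intro w hpos htyp
    set dev : ℝ → ℝ := fun t => ∑ x ∈ Jᶜ, (i1 (w x) - pLit k d (x, true)) * cf k d t x with hdev
    have hdev' : ∀ t ∈ TT k, |dev t| ≤ (R:ℝ) / 20 := by
      intro t ht
      have := htyp ⟨t, ht⟩
      simp only [fv_dev] at this
      exact this
    obtain ⟨g, hg, hg2⟩ := fix_counts k R hb1 hR60 dev hdev'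
    have hS : ∀ q, ∃ S : Finset (Fin n), S ⊆ Jf q ∧ (q ∈ KK k → S.card = g q) := by
      intro q
      by_cases h : q ∈ KK k
      · obtain ⟨S, h1, h2⟩ := Finset.exists_subset_card_eq (s := Jf q) (n := g q) (by rw [hJ2 q h]; exact hg q)
        exact ⟨S, h1, fun _ => h2⟩
      · exact ⟨∅, by simp, fun h' => absurd h' h⟩
    choose S hS1 hS2 using hS
    refine ⟨fun x => if x ∈ J then decide (x ∈ S (D x)) else w x, ?_, ?_, ?_⟩
    · refine Finset.mem_filter.2 ⟨Finset.mem_univ _, fun t ht => ?_⟩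
      rw [BD_dev, ← Finset.sum_add_sum_compl J, add_comm]
      have e1 : ∑ x ∈ Jᶜ, (i1 (if x ∈ J then decide (x ∈ S (D x)) else w x) - pLit k d (x, true)) * cf k d t x = dev t := by
        refine Finset.sum_congr rfl fun x hx => ?_
        rw [if_neg (Finset.mem_compl.1 hx)]
      have e2 : ∑ x ∈ J, (i1 (if x ∈ J then decide (x ∈ S (D x)) else w x) - pLit k d (x, true)) * cf k d t x =
          ∑ q ∈ KK k, cq k t q * (g q - tq k q * R) := by
        rw [← Finset.sum_fiberwise_of_maps_to (t := KK k) (g := D) hJK]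
        refine Finset.sum_congr rfl fun q hq => ?_
        rw [hJl q]
        have : ∀ x ∈ Jf q, (i1 (if x ∈ J then decide (x ∈ S (D x)) else w x) - pLit k d (x, true)) * cf k d t x =
            ((if x ∈ S q then 1 else 0) - tq k q) * cq k t q := by
          intro x hx
          have hDx := hJT q x hx
          have hxJ : x ∈ J := Finset.mem_filter.2 ⟨Finset.mem_univ _, by rw [hDx]; exact hx⟩
          rw [if_pos hxJ, cf_eq, pLit_tq]
          change (i1 (decide (x ∈ S (D x))) - tq k (D x)) * cq k t (D x) = _
          rw [hDx]
          unfold i1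
          simp
        rw [Finset.sum_congr rfl this, ← Finset.sum_mul, Finset.sum_sub_distrib, Finset.sum_boole, Finset.filter_mem_eq_inter,
          Finset.inter_eq_right.2 (hS1 q), hS2 q hq, Finset.sum_const, hJ2 q hq, nsmul_eq_mul]
        ring
      rw [e1, e2]
      exact hg2 t ht
    · intro x hx; simp [hx]
    · intro x hx
      have := hp (x, true)
      norm_num at this
      unfold berw; split_ifs <;> linarith

set_option maxHeartbeats 2000000 in
lemma asg_main (k : ℕ) (hb1 : (bb k : ℝ) / 2 ^ (k + 1) ≤ 1 / 20) (γ ε : ℝ) (hγ : 0 < γ) (hε : 0 < ε) :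
    ∃ N0 : ℕ, ∀ n ≥ N0, ∀ d : Lit n → ℕ, (∀ q ∈ KK k, γ * n ≤ Nab d q) →
      (∑ x : Fin n, ((d (x, true) : ℝ) + d (x, false)) ^ 2 ≤ n * Real.sqrt n) →
      Real.exp (∑ x, Real.binEntropy (pLit k d (x, true)) - ε * n) ≤ (SgSet k d).card := by
  obtain ⟨ρ, hρ0, hργ, hρε⟩ : ∃ ρ : ℝ, 0 < ρ ∧ ρ ≤ γ ∧ ρ ≤ ε / (4 * ((KK k).card + 1)) :=
    ⟨min γ (ε / (4 * ((KK k).card + 1))), by positivity, min_le_left _ _, min_le_right _ _⟩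
  set Cst : ℝ := ∑ t ∈ TT k, |om k t| * (bb k + 1) with hCst
  have hC0 : 0 ≤ Cst := Finset.sum_nonneg fun t _ => by positivity
  obtain ⟨A, hA0, h1A⟩ : ∃ A : ℝ, 0 ≤ A ∧ ((2 * bb k + 1 : ℕ) : ℝ) = A * ρ ^ 2 / 3200 :=
    ⟨((2 * bb k + 1 : ℕ) : ℝ) * 3200 / ρ ^ 2, by positivity, by rw [div_mul_cancel₀ _ (by positivity), mul_div_assoc, div_self (by norm_num), mul_one]⟩
  set N1 : ℝ := 120 / ρ + A ^ 2 + (Cst + 1) * 2 / ε with hN1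
  obtain ⟨N0, hN0⟩ := exists_nat_ge N1
  refine ⟨N0, fun n hn d hN hdeg => ?_⟩
  have hmN : N1 ≤ n := hN0.trans (by exact_mod_cast hn)
  have p1 : 0 ≤ 120 / ρ := by positivity
  have p2 : 0 ≤ A ^ 2 := by positivity
  have p3 : 0 ≤ (Cst + 1) * 2 / ε := by positivity
  have m1 : 120 ≤ n * ρ := by rw [← div_le_iff₀ hρ0]; linarith
  have m2 : A ≤ Real.sqrt n := Real.le_sqrt_of_sq_le (by linarith)
  have m3 : (Cst + 1) * 2 ≤ n * ε := by rw [← div_le_iff₀ hε]; linarith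
  set R : ℕ := ⌊ρ * n⌋₊ with hR
  have hm0 : (0:ℝ) ≤ n := Nat.cast_nonneg _
  have hR1 : (R:ℝ) ≤ ρ * n := Nat.floor_le (by positivity)
  have hR2 : ρ * n / 2 ≤ R := by
    have := Nat.lt_floor_add_one (ρ * n)
    rw [← hR] at this; linarith
  have hprob := asg_prob k d hb1 R
    (by have : (60:ℝ) ≤ R := by linarith
        exact_mod_cast this)
    (fun q hq => by
      have h1 := hN q hq
      have h2 : ρ * n ≤ γ * n := by gcongr
      have : (R:ℝ) ≤ Nab d q := by linarith
      exact_mod_cast this)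
    (by
      have : (ρ * n / 40) ^ 2 / 2 ≤ ((R:ℝ) / 20) ^ 2 / 2 := by
        gcongr ?_ ^ 2 / 2; linarith
      refine le_trans ?_ this
      calc _ ≤ ((2 * bb k + 1 : ℕ) : ℝ) * (n * Real.sqrt n) := by gcongr
        _ = A * Real.sqrt n * (n * ρ ^ 2 / 3200) := by rw [h1A]; ring
        _ ≤ Real.sqrt n * Real.sqrt n * (n * ρ ^ 2 / 3200) := by gcongr
        _ = _ := by rw [Real.mul_self_sqrt hm0]; ring)
  have hp : ∀ x, 0 < pLit k d (x, true) ∧ pLit k d (x, true) < 1 := by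
    intro x
    rw [pLit_eq]
    have h := Finset.mem_Icc.1 (fz_mem k (zl d (x, true)))
    have h1 : (-(bb k:ℝ)) ≤ fz k (zl d (x, true)) := by exact_mod_cast h.1
    have h2 : (fz k (zl d (x, true)) : ℝ) ≤ bb k := by exact_mod_cast h.2
    have h3 : -((bb k : ℝ) / 2 ^ (k + 1)) ≤ (fz k (zl d (x, true)) : ℝ) / 2 ^ (k+1) := by
      rw [← neg_div]; gcongr
    have h4 : (fz k (zl d (x, true)) : ℝ) / 2 ^ (k+1) ≤ (bb k : ℝ) / 2 ^ (k + 1) := by gcongr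
    unfold tt
    constructor <;> linarith
  have hub := Finset.sum_le_sum fun σ hσ => weight_bound k d hp σ hσ
  rw [Finset.sum_const, nsmul_eq_mul] at hub
  have h1 := hprob.trans hub
  have hlog4 : Real.log 4 ≤ 2 := by
    have := Real.log_two_lt_d9
    rw [show (4:ℝ) = 2 ^ 2 by norm_num, Real.log_pow]; push_cast; linarith
  have hpow : Real.exp (-(2 * ((KK k).card * R))) ≤ (1 / 4 : ℝ) ^ ((KK k).card * R) := by
    rw [← Real.exp_log (by norm_num : (0:ℝ) < 1/4), ← Real.exp_nat_mul]
    apply Real.exp_le_exp.2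
    rw [one_div, Real.log_inv]
    push_cast
    have : 0 ≤ ((KK k).card * R : ℝ) := by positivity
    nlinarith
  have h2 : Real.exp (-1) ≤ 1 / 2 := by
    have := Real.exp_one_gt_d9
    rw [Real.exp_neg, one_div]
    exact inv_anti₀ (by norm_num) (by linarith)
  have hfin : Real.exp (-(2 * ((KK k).card * R))) * Real.exp (-1) ≤ (1 / 4 : ℝ) ^ ((KK k).card * R) / 2 := by
    rw [div_eq_mul_one_div]
    exact mul_le_mul hpow h2 (Real.exp_pos _).le (by positivity)
  have h3 := hfin.trans h1
  rw [← Real.exp_add, ← div_le_iff₀ (Real.exp_pos _), ← Real.exp_sub] at h3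
  refine le_trans (Real.exp_le_exp.2 ?_) h3
  have hA : 2 * ((KK k).card * R : ℝ) ≤ ε * n / 2 := by
    clear h3 hfin h2 hpow hlog4 h1 hub hp hprob
    generalize ((KK k).card) = K at *
    have : (R:ℝ) ≤ ε / (4 * (K + 1)) * n := hR1.trans (by gcongr)
    calc 2 * (K * R : ℝ) ≤ 2 * (K * (ε / (4 * (K + 1)) * n)) := by gcongr
      _ = (K / (K + 1)) * (ε * n / 2) := by field_simp; ring
      _ ≤ 1 * (ε * n / 2) := by
        gcongr
        rw [div_le_one (by positivity)]; linarith
      _ = _ := one_mul _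
  linarith
end

section
/-! Part C9: lower bound for the conditional expectation of Zp -/

def LL (k : ℕ) : Finset (Fin k → ℝ) := Fintype.piFinset fun _ => TT k

lemma sum_types {k m : ℕ} (T : Fin m → Fin k → ℝ) (Λ : Finset (Fin k → ℝ)) (hT : ∀ i, T i ∈ Λ) (g : (Fin k → ℝ) → ℝ) :
    ∑ i, g (T i) = ∑ l ∈ Λ, (cntT T l : ℝ) * g l := by
  rw [← Finset.sum_fiberwise_of_maps_to (s := (univ : Finset (Fin m))) (t := Λ) (g := T) (fun i _ => hT i)]
  refine Finset.sum_congr rfl fun l _ => ?_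
  unfold cntT
  rw [← nsmul_eq_mul, ← Finset.sum_const]
  exact Finset.sum_congr rfl fun i hi => by rw [(Finset.mem_filter.1 hi).2]

lemma clauseType_mem {n : ℕ} (k : ℕ) (d : Lit n → ℕ) (C : Clause n k) : clauseType k d C ∈ LL k :=
  Fintype.mem_piFinset.2 fun j => pLit_mem _ _ _

lemma pairs_card {k : ℕ} (hk : 2 ≤ k) {t : ℝ} (ht : t ∈ TT k) :
    bb k + 1 ≤ ((LL k ×ˢ (univ : Finset (Fin k))).filter (fun q => q.1 q.2 = t)).card := by
  have h : (TT k).card ≤ ((LL k ×ˢ (univ : Finset (Fin k))).filter (fun q => q.1 q.2 = t)).card := by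
    refine Finset.card_le_card_of_injOn (fun t' => ((fun j : Fin k => if j = ⟨0, by omega⟩ then t else t'), ⟨0, by omega⟩)) ?_ ?_
    · intro t' ht'
      refine Finset.mem_coe.2 (Finset.mem_filter.2 ⟨Finset.mem_product.2 ⟨Fintype.mem_piFinset.2 fun j => ?_, Finset.mem_univ _⟩, by simp⟩)
      simp only; split_ifs
      · exact ht
      · exact Finset.mem_coe.1 ht'
    · intro a _ b _ h
      have := congrFun (congrArg Prod.fst h) ⟨1, by omega⟩
      simpa using this
  rw [TT_card] at h; omega

lemma Dt_pairs {n k m : ℕ} (Φ : Formula n k m) (t : ℝ) :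
    ∑ q ∈ (LL k ×ˢ (univ : Finset (Fin k))).filter (fun q => q.1 q.2 = t), (q.1 q.2 * typeCounts n k m Φ q.1 : ℝ) =
      t * Dt k (degSeq n k m Φ) t := by
  set d := degSeq n k m Φ with hd
  have h1 : Dt k d t = ∑ j : Fin k, ∑ i : Fin m, if clauseType k d (Φ i) j = t then (1:ℝ) else 0 := by
    have := occ_sum Φ (fun l => if pLit k d l = t then (1:ℝ) else 0)
    unfold Dt
    rw [Finset.sum_comm, ← Fintype.sum_prod_type' (f := fun i j => if clauseType k d (Φ i) j = t then (1:ℝ) else 0)]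
    refine Eq.trans ?_ (this.symm.trans ?_)
    · refine Finset.sum_congr rfl fun l _ => ?_
      rw [hd]; unfold degSeq
      split_ifs <;> simp
    · refine Finset.sum_congr rfl fun s _ => ?_
      simp only [clauseType]; congr
  rw [h1, Finset.mul_sum]
  rw [Finset.sum_filter, Finset.sum_product_right]
  refine Finset.sum_congr rfl fun j _ => ?_
  rw [sum_types (fun i => clauseType k d (Φ i)) (LL k) (fun i => clauseType_mem _ _ _) (fun l => if l j = t then 1 else 0), Finset.mul_sum]
  refine Finset.sum_congr rfl fun l _ => ?_
  simp only
  split_ifs with h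
  · rw [h, mul_one]; rfl
  · simp

lemma Btrue_zero {n : ℕ} (k : ℕ) (d : Lit n → ℕ) (σ : Assignment n) (t : ℝ) (ht : t ∉ TT k) : Btrue k d σ t = 0 := by
  unfold Btrue
  refine Finset.sum_eq_zero fun l _ => ?_
  rw [if_neg]
  rintro ⟨h, _⟩
  exact ht (h ▸ pLit_mem k d l)

lemma TT_bounds {k : ℕ} {y : ℝ} (hy : (bb k : ℝ) / 2 ^ k ≤ y) {t : ℝ} (ht : t ∈ TT k) : |t - 1 / 2| ≤ y / 2 := by
  obtain ⟨u, hu, rfl⟩ := Finset.mem_image.1 ht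
  rw [Finset.mem_Icc] at hu
  have h1 : |(u:ℝ)| ≤ bb k := by
    rw [abs_le]; exact ⟨by exact_mod_cast hu.1, by exact_mod_cast hu.2⟩
  unfold tt
  rw [add_sub_cancel_left, abs_div, abs_of_pos (by positivity : (0:ℝ) < 2 ^ (k+1)), pow_succ, ← div_div]
  gcongr
  exact le_trans (by gcongr) hy

lemma class_main {k : ℕ} (hk : 100 ≤ k) (h2k : (k:ℝ) ^ 8 ≤ 2 ^ k) (hb : (bb k : ℝ) / 2 ^ k ≤ 1 / (k:ℝ) ^ 4)
    (γ ε : ℝ) (hγ : 0 < γ) (hε : 0 < ε) :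
    ∃ N0 : ℕ, ∀ n m : ℕ, N0 ≤ n → N0 ≤ m → ∀ Φ : Formula n k m,
      (∀ q ∈ KK k, γ * n ≤ Nab (degSeq n k m Φ) q) →
      (∑ x : Fin n, ((occ n k m Φ (x, true) : ℝ) + occ n k m Φ (x, false)) ^ 2 ≤ n * Real.sqrt n) →
      (∀ l ∈ LL k, γ * m ≤ typeCounts n k m Φ l) →
      Real.exp (∑ x, Real.binEntropy (pLit k (degSeq n k m Φ) (x, true)) -
        ∑ i, (pi0 (clauseType k (degSeq n k m Φ) (Φ i)) + kap k) - ε * n - ε * m) ≤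
      expOver (formulaClass n k m (degSeq n k m Φ) (typeCounts n k m Φ)) (fun Ψ => (Zp 2 n k m (degSeq n k m Φ) Ψ : ℝ)) := by
  have hK : (100:ℝ) ≤ k := by exact_mod_cast hk
  have hk4 : 1 / (k:ℝ) ^ 4 ≤ 1 / 100 := by
    apply one_div_le_one_div_of_le (by norm_num)
    calc (100:ℝ) ≤ k := hK
      _ = k ^ 1 := (pow_one _).symm
      _ ≤ k ^ 4 := pow_le_pow_right₀ (by linarith) (by norm_num)
  have hTT : ∀ t ∈ TT k, |t - 1/2| ≤ (1 / (k:ℝ) ^ 4) / 2 := fun t ht => TT_bounds hb ht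
  have hTT2 : ∀ t ∈ TT k, 0.45 ≤ t ∧ t ≤ 0.55 := by
    intro t ht
    have := abs_le.1 (hTT t ht)
    constructor <;> norm_num <;> linarith
  have hb1 : (bb k : ℝ) / 2 ^ (k + 1) ≤ 1 / 20 := by
    rw [pow_succ, ← div_div]; linarith
  obtain ⟨N1, hN1⟩ := asg_main k hb1 γ ε hγ hε
  obtain ⟨N2, hN2⟩ := rows_main (by omega : 3 ≤ k) (LL k)
    (fun l hl => tilt_exists hk h2k (1 / (k:ℝ)^4) (by positivity) le_rfl l (fun j => hTT _ (Fintype.mem_piFinset.1 hl j)))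
    (fun l hl j => hTT2 _ (Fintype.mem_piFinset.1 hl j)) γ ε hγ hε
  refine ⟨max N1 N2, fun n m hn hm Φ P1 P2 P3 => ?_⟩
  set d := degSeq n k m Φ with hd
  set mv := typeCounts n k m Φ with hmv
  have hS := hN1 n (le_trans (le_max_left _ _) hn) d P1 P2
  -- column sums
  have hc : ∀ σ : Assignment n, ∀ t : ℝ, ∃ c : (Fin k → ℝ) × Fin k → ℤ, (σ ∈ SgSet k d → t ∈ TT k →
      (∀ q, |(c q : ℝ) - q.1 q.2 * mv q.1| ≤ 2) ∧
      ∑ q ∈ (LL k ×ˢ (univ : Finset (Fin k))).filter (fun q => q.1 q.2 = t), c q = Btrue k d σ t) := by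
    intro σ t
    by_cases h : σ ∈ SgSet k d ∧ t ∈ TT k
    · obtain ⟨c, c1, c2⟩ := rounding ((LL k ×ˢ (univ : Finset (Fin k))).filter (fun q => q.1 q.2 = t))
        (fun q => q.1 q.2 * mv q.1) (Btrue k d σ t) (by
          rw [Dt_pairs Φ t]
          refine ((Finset.mem_filter.1 h.1).2 t h.2).trans ?_
          exact_mod_cast pairs_card (by omega) h.2)
      exact ⟨c, fun _ _ => ⟨c1, c2⟩⟩
    · exact ⟨0, fun a b => absurd ⟨a, b⟩ h⟩
  choose c hc using hc
  have hsum : ∀ T : Fin m → Fin k → ℝ, (∀ i, T i ∈ LL k) → (∀ l, cntT T l = mv l) →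
      ∑ i, (pi0 (T i) + kap k) = ∑ i, (pi0 (clauseType k d (Φ i)) + kap k) := by
    intro T hT hcnt
    rw [sum_types T (LL k) hT (fun l => pi0 l + kap k), sum_types (fun i => clauseType k d (Φ i)) (LL k) (fun i => clauseType_mem _ _ _) (fun l => pi0 l + kap k)]
    refine Finset.sum_congr rfl fun l _ => ?_
    rw [hcnt l]; rfl
  have key := class_lower (n := n) (k := k) (m := m) d mv (LL k)
    (fun l => by have := hTT2 _ (pLit_mem k d l); norm_num at this; constructor <;> linarith)
    (fun C => clauseType_mem _ _ _) (SgSet k d) (fun σ l j => c σ (l j) (l, j))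
    (by
      intro σ hσ t
      by_cases ht : t ∈ TT k
      · rw [← (hc σ t hσ ht).2]
        refine Finset.sum_congr rfl fun q hq => ?_
        rw [(Finset.mem_filter.1 hq).2]
      · rw [Btrue_zero k d σ t ht, Finset.filter_false_of_mem]
        · simp
        · intro q hq h
          exact ht (h ▸ Fintype.mem_piFinset.1 (Finset.mem_product.1 hq).1 q.2))
    (by
      intro σ hσ l hl j
      exact (hc σ (l j) hσ (Fintype.mem_piFinset.1 hl j)).1 (l, j))
    (Real.exp (-(∑ i, (pi0 (clauseType k d (Φ i)) + kap k)) - ε * m))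
    (by
      intro T hT hcnt σ hσ
      rw [← hsum T hT hcnt]
      refine hN2 m (le_trans (le_max_right _ _) hm) T hT (fun l hl => ?_) _ (fun l hl j => ?_)
      · rw [hcnt l]; exact P3 l hl
      · rw [hcnt l]; exact (hc σ (l j) hσ (Fintype.mem_piFinset.1 hl j)).1 (l, j))
    ⟨Φ, Finset.mem_filter.2 ⟨Finset.mem_univ _, rfl, fun l => rfl⟩⟩
  refine le_trans ?_ key
  refine le_trans (le_of_eq ?_) (mul_le_mul_of_nonneg_right hS (Real.exp_pos _).le)
  rw [← Real.exp_add]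
  congr 1; ring
end

section
/-! Part D1: uniform random formula, product formula, concentration -/

def cur {n k m : ℕ} (w : Fin m × Fin k → Lit n) : Formula n k m := fun i j => w (i, j)

def upd {n k m : ℕ} (Φ : Formula n k m) (s : Fin m × Fin k) (a : Lit n) : Formula n k m :=
  fun i j => if (i, j) = s then a else Φ i j

def dg {n k m : ℕ} (Φ : Formula n k m) (x : Fin n) : ℕ := occ n k m Φ (x, true) + occ n k m Φ (x, false)

lemma cur_update {n k m : ℕ} (w : Fin m × Fin k → Lit n) (s : Fin m × Fin k) (a : Lit n) :
    cur (Function.update w s a) = upd (cur w) s a := by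
  funext i j
  simp only [cur, upd, Function.update_apply]

lemma expF_eq_Ex {n k m : ℕ} (hn : 1 ≤ n) (F : Formula n k m → ℝ) :
    expF n k m F = Ex (fun (_ : Fin m × Fin k) (_ : Lit n) => (1 / (2 * n) : ℝ)) (fun w => F (cur w)) := by
  have hn' : (0:ℝ) < n := by exact_mod_cast hn
  unfold expF Ex PW
  rw [card_Formula]
  simp only [Finset.prod_const, Finset.card_univ, Fintype.card_prod, Fintype.card_fin]
  rw [← Finset.mul_sum, div_eq_mul_inv, mul_comm]
  congr 1
  · push_cast
    rw [← pow_mul, one_div, inv_pow, mul_comm m k]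
  · rw [← (Equiv.curry (Fin m) (Fin k) (Lit n)).sum_comp]
    rfl

lemma unif_nonneg {n : ℕ} {ι : Type} (i : ι) (a : Lit n) : 0 ≤ (fun (_ : ι) (_ : Lit n) => (1 / (2 * n) : ℝ)) i a := by
  simp only; positivity

lemma unif_sum {n : ℕ} (hn : 1 ≤ n) {ι : Type} (i : ι) : ∑ a, (fun (_ : ι) (_ : Lit n) => (1 / (2 * n) : ℝ)) i a = 1 := by
  have hn' : (0:ℝ) < n := by exact_mod_cast hn
  simp only [Finset.sum_const, Finset.card_univ, Fintype.card_prod, Fintype.card_fin, Fintype.card_bool, nsmul_eq_mul]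
  push_cast
  field_simp

lemma expF_mono {n k m : ℕ} {F G : Formula n k m → ℝ} (h : ∀ Φ, F Φ ≤ G Φ) : expF n k m F ≤ expF n k m G := by
  unfold expF; gcongr with Φ; exact h Φ

lemma expF_const {n k m : ℕ} (hn : 1 ≤ n) (c : ℝ) : expF n k m (fun _ => c) = c := by
  rw [expF_eq_Ex hn, Ex_const (unif_sum hn)]

lemma expF_add {n k m : ℕ} (F G : Formula n k m → ℝ) :
    expF n k m (fun Φ => F Φ + G Φ) = expF n k m F + expF n k m G := by
  unfold expF; rw [Finset.sum_add_distrib, add_div]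

lemma expF_sub {n k m : ℕ} (F G : Formula n k m → ℝ) :
    expF n k m (fun Φ => F Φ - G Φ) = expF n k m F - expF n k m G := by
  unfold expF; rw [Finset.sum_sub_distrib, sub_div]

lemma expF_mul {n k m : ℕ} (c : ℝ) (F : Formula n k m → ℝ) :
    expF n k m (fun Φ => c * F Φ) = c * expF n k m F := by
  unfold expF; rw [← Finset.mul_sum, mul_div_assoc]

lemma expF_sum {n k m : ℕ} {κ : Type} (s : Finset κ) (F : κ → Formula n k m → ℝ) :
    expF n k m (fun Φ => ∑ i ∈ s, F i Φ) = ∑ i ∈ s, expF n k m (F i) := by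
  unfold expF; rw [Finset.sum_comm, Finset.sum_div]

lemma expF_nonneg {n k m : ℕ} {F : Formula n k m → ℝ} (h : ∀ Φ, 0 ≤ F Φ) : 0 ≤ expF n k m F := by
  unfold expF
  exact div_nonneg (Finset.sum_nonneg fun Φ _ => h Φ) (by positivity)

lemma prF_eq {n k m : ℕ} (E : Formula n k m → Prop) : prF n k m E = expF n k m (fun Φ => if E Φ then 1 else 0) := by
  unfold prF expF
  rw [Finset.sum_boole]

lemma prF_nonneg {n k m : ℕ} (E : Formula n k m → Prop) : 0 ≤ prF n k m E := by
  unfold prF; positivity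

lemma prF_mono {n k m : ℕ} {E E' : Formula n k m → Prop} (h : ∀ Φ, E Φ → E' Φ) : prF n k m E ≤ prF n k m E' := by
  unfold prF
  gcongr with Φ _
  exact h Φ

lemma prF_or {n k m : ℕ} (E E' : Formula n k m → Prop) : prF n k m (fun Φ => E Φ ∨ E' Φ) ≤ prF n k m E + prF n k m E' := by
  rw [prF_eq, prF_eq, prF_eq, ← expF_add]
  refine expF_mono fun Φ => ?_
  by_cases h : E Φ <;> by_cases h' : E' Φ <;> simp [h, h']

lemma prF_not {n k m : ℕ} (hn : 1 ≤ n) (E : Formula n k m → Prop) : prF n k m (fun Φ => ¬ E Φ) = 1 - prF n k m E := by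
  rw [prF_eq, prF_eq]
  have e := expF_const (k := k) (m := m) hn 1
  rw [eq_sub_iff_add_eq, ← expF_add]
  refine Eq.trans (congrArg (expF n k m) (funext fun Φ => ?_)) e
  by_cases h : E Φ <;> simp [h]

lemma markovF {n k m : ℕ} (F : Formula n k m → ℝ) (h : ∀ Φ, 0 ≤ F Φ) (t : ℝ) (ht : 0 < t) :
    prF n k m (fun Φ => t ≤ F Φ) ≤ expF n k m F / t := by
  rw [prF_eq, le_div_iff₀ ht, mul_comm, ← expF_mul]
  refine expF_mono fun Φ => ?_
  split_ifs with h1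
  · linarith
  · simpa using h Φ

lemma expF_prod {n k m : ℕ} (hn : 1 ≤ n) (g : Fin m × Fin k → Lit n → ℝ) :
    expF n k m (fun Φ => ∏ s : Fin m × Fin k, g s (Φ s.1 s.2)) = ∏ s, ((∑ a, g s a) / (2 * n)) := by
  rw [expF_eq_Ex hn]
  unfold Ex PW
  simp only [cur, ← Finset.prod_mul_distrib]
  rw [sum_prod_eq (fun (s : Fin m × Fin k) a => 1 / (2 * (n:ℝ)) * g s a)]
  refine Finset.prod_congr rfl fun s _ => ?_
  rw [← Finset.mul_sum]; ring

lemma dg_eq {n k m : ℕ} (Φ : Formula n k m) (x : Fin n) :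
    dg Φ x = (univ.filter fun s : Fin m × Fin k => (Φ s.1 s.2).1 = x).card := by
  unfold dg occ
  rw [← Finset.card_union_of_disjoint]
  · congr 1; ext s
    simp only [Finset.mem_union, Finset.mem_filter, Finset.mem_univ, true_and]
    rcases h : Φ s.1 s.2 with ⟨y, b⟩
    cases b <;> simp
  · rw [Finset.disjoint_filter]
    intro s _ h1 h2
    rw [h1] at h2; simp at h2

lemma cube_le (j : ℕ) : (j:ℝ) ^ 3 ≤ 6 * 2 ^ j := by
  have : j ^ 3 ≤ 6 * 2 ^ j := by
    induction j with
    | zero => simp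
    | succ j ih =>
      by_cases h : j < 4
      · interval_cases j <;> norm_num
      · push Not at h
        rw [pow_succ 2]
        have : (j+1)^3 ≤ 2 * j ^ 3 := by nlinarith [mul_le_mul h h (by norm_num) (by omega), mul_le_mul h (mul_le_mul h h (by norm_num) (by omega)) (by norm_num) (by omega), sq_nonneg (j:ℤ), mul_le_mul h (le_refl (j*j)) (by positivity) (by positivity)]
        omega
  exact_mod_cast this

lemma exp_lin {n K : ℕ} (hn : 1 ≤ n) (c R : ℝ) (hc0 : 0 ≤ c) (hK : (K:ℝ) ≤ R * n) : (1 + c / n) ^ K ≤ Real.exp (R * c) := by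
  have hn' : (0:ℝ) < n := by exact_mod_cast hn
  calc (1 + c / n) ^ K ≤ (Real.exp (c / n)) ^ K := by
        gcongr
        rw [add_comm]; exact Real.add_one_le_exp _
    _ = Real.exp (K * (c / n)) := by rw [← Real.exp_nat_mul]
    _ ≤ _ := by
        apply Real.exp_le_exp.2
        rw [mul_div_assoc', div_le_iff₀ hn']
        nlinarith

lemma exp_two_dg {n k m : ℕ} (hn : 1 ≤ n) (R : ℝ) (hK : ((m * k : ℕ):ℝ) ≤ R * n) (x : Fin n) :
    expF n k m (fun Φ => (2:ℝ) ^ dg Φ x) ≤ Real.exp R := by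
  have hn' : (0:ℝ) < n := by exact_mod_cast hn
  have e : ∀ Φ : Formula n k m, (2:ℝ) ^ dg Φ x = ∏ s : Fin m × Fin k, (if (Φ s.1 s.2).1 = x then (2:ℝ) else 1) := by
    intro Φ
    rw [dg_eq, Finset.prod_ite]; simp
  simp only [e]
  rw [expF_prod hn (fun _ a => if a.1 = x then (2:ℝ) else 1)]
  have : ∑ a : Lit n, (if a.1 = x then (2:ℝ) else 1) = 2 * n + 2 := by
    rw [Fintype.sum_prod_type]
    simp only [Fintype.sum_bool]
    rw [Finset.sum_congr rfl (g := fun y : Fin n => (2:ℝ) + if y = x then 2 else 0)]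
    · rw [Finset.sum_add_distrib]; simp; ring
    · intro y _; split_ifs <;> norm_num
  rw [this, Finset.prod_const, Finset.card_univ, Fintype.card_prod, Fintype.card_fin, Fintype.card_fin]
  have := exp_lin hn 1 R (by norm_num) hK
  rw [mul_one] at this
  refine le_trans (le_of_eq ?_) this
  congr 1; field_simp

lemma exp_dg3 {n k m : ℕ} (hn : 1 ≤ n) (R : ℝ) (hK : ((m * k : ℕ):ℝ) ≤ R * n) (x : Fin n) :
    expF n k m (fun Φ => (dg Φ x : ℝ) ^ 3) ≤ 6 * Real.exp R := by
  calc _ ≤ expF n k m (fun Φ => 6 * (2:ℝ) ^ dg Φ x) := expF_mono fun Φ => cube_le _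
    _ ≤ _ := by rw [expF_mul]; have := exp_two_dg hn R hK x; linarith

lemma exp_dg2 {n k m : ℕ} (hn : 1 ≤ n) (R : ℝ) (hK : ((m * k : ℕ):ℝ) ≤ R * n) (x : Fin n) :
    expF n k m (fun Φ => (dg Φ x : ℝ) ^ 2) ≤ 6 * Real.exp R := by
  refine le_trans (expF_mono fun Φ => ?_) (exp_dg3 hn R hK x)
  have : (dg Φ x) ^ 2 ≤ (dg Φ x) ^ 3 := by
    rcases Nat.eq_zero_or_pos (dg Φ x) with h | h
    · simp [h]
    · exact Nat.pow_le_pow_right h (by norm_num)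
  exact_mod_cast this

lemma slots_dg {n k m : ℕ} (Φ : Formula n k m) (g : Fin n → ℝ) :
    ∑ s : Fin m × Fin k, g (Φ s.1 s.2).1 = ∑ x, (dg Φ x : ℝ) * g x := by
  rw [occ_sum Φ (fun l => g l.1), Fintype.sum_prod_type]
  refine Finset.sum_congr rfl fun x _ => ?_
  rw [Fintype.sum_bool]; unfold dg; push_cast; ring

lemma varF {n k m : ℕ} (hn : 1 ≤ n) (R : ℝ) (hK : ((m * k : ℕ):ℝ) ≤ R * n) (F : Formula n k m → ℝ) (M : ℝ)
    (h : ∀ Φ s a, |F Φ - F (upd Φ s a)| ≤ M * (dg Φ (Φ s.1 s.2).1 + dg Φ a.1 + 1)) (t : ℝ) (ht : 0 < t) :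
    prF n k m (fun Φ => t ≤ |F Φ - expF n k m F|) ≤
      (3 * M ^ 2 * (6 * Real.exp R + R * (6 * Real.exp R + 1)) * n) / t ^ 2 := by
  have hn' : (0:ℝ) < n := by exact_mod_cast hn
  rw [prF_eq, expF_eq_Ex hn, expF_eq_Ex hn]
  refine chebyshev_Ex _ (fun i a => unif_nonneg i a) (unif_sum hn) (fun w => F (cur w)) _ t ht ?_
  set a0 : Lit n := (⟨0, hn⟩, true)
  refine (efron_stein _ (fun i a => unif_nonneg i a) (unif_sum hn) (fun _ => a0) (fun w => F (cur w))).trans ?_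
  rw [← Ex_sum]
  simp only [cur_update]
  rw [← expF_eq_Ex hn (F := fun Φ => ∑ s, (F Φ - F (upd Φ s a0)) ^ 2)]
  calc _ ≤ expF n k m (fun Φ => 3 * M ^ 2 * (∑ x, (dg Φ x : ℝ) ^ 3 + (m * k : ℕ) * ((dg Φ a0.1 : ℝ) ^ 2 + 1))) := by
        refine expF_mono fun Φ => ?_
        calc _ ≤ ∑ s : Fin m × Fin k, 3 * M ^ 2 * ((dg Φ (Φ s.1 s.2).1 : ℝ) ^ 2 + ((dg Φ a0.1 : ℝ) ^ 2 + 1)) := by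
              refine Finset.sum_le_sum fun s _ => ?_
              rw [← sq_abs]
              calc _ ≤ (M * ((dg Φ (Φ s.1 s.2).1 : ℝ) + dg Φ a0.1 + 1)) ^ 2 := by
                    gcongr; exact h Φ s a0
                _ ≤ _ := by
                    rw [mul_pow]
                    have := sq_nonneg M
                    generalize (dg Φ (Φ s.1 s.2).1 : ℝ) = u
                    generalize (dg Φ a0.1 : ℝ) = v
                    have : (u + v + 1) ^ 2 ≤ 3 * (u ^ 2 + (v ^ 2 + 1)) := by
                      nlinarith [sq_nonneg (u - v), sq_nonneg (u - 1), sq_nonneg (v - 1)]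
                    nlinarith
          _ = _ := by
              rw [← Finset.mul_sum, Finset.sum_add_distrib, slots_dg Φ (fun x => (dg Φ x : ℝ) ^ 2)]
              simp only [Finset.sum_const, Finset.card_univ, Fintype.card_prod, Fintype.card_fin, nsmul_eq_mul]
              congr 3; ext x; ring
    _ = 3 * M ^ 2 * (∑ x, expF n k m (fun Φ => (dg Φ x : ℝ) ^ 3) + (m * k : ℕ) * (expF n k m (fun Φ => (dg Φ a0.1 : ℝ) ^ 2) + 1)) := by
        rw [expF_mul, expF_add, expF_sum, expF_mul, expF_add, expF_const hn]
    _ ≤ 3 * M ^ 2 * (∑ x : Fin n, 6 * Real.exp R + (R * n) * (6 * Real.exp R + 1)) := by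
        have := exp_dg2 hn R hK a0.1
        have h0 : 0 ≤ expF n k m (fun Φ => (dg Φ a0.1 : ℝ) ^ 2) := expF_nonneg fun Φ => by positivity
        have h1 : (0:ℝ) ≤ R * n := le_trans (by positivity) hK
        gcongr
        exact exp_dg3 hn R hK _
    _ = _ := by simp; ring
end

section
/-! Part D2: with high probability statements for variable statistics -/

def WHP (k : ℕ) (r : ℝ) (P : ∀ n, Formula n k ⌊r * n⌋₊ → Prop) : Prop :=
  Tendsto (fun n => prF n k ⌊r * n⌋₊ (fun Φ => ¬ P n Φ)) atTop (nhds 0)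

lemma WHP.of_bound {k : ℕ} {r : ℝ} {P : ∀ n, Formula n k ⌊r * n⌋₊ → Prop} (u : ℕ → ℝ)
    (h : ∀ᶠ n in atTop, prF n k ⌊r * n⌋₊ (fun Φ => ¬ P n Φ) ≤ u n) (hu : Tendsto u atTop (nhds 0)) : WHP k r P :=
  tendsto_of_tendsto_of_tendsto_of_le_of_le' tendsto_const_nhds hu (Eventually.of_forall fun n => prF_nonneg _) h

lemma WHP.mono {k : ℕ} {r : ℝ} {P Q : ∀ n, Formula n k ⌊r * n⌋₊ → Prop} (hP : WHP k r P)
    (h : ∀ᶠ n in atTop, ∀ Φ, P n Φ → Q n Φ) : WHP k r Q := by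
  refine WHP.of_bound _ ?_ hP
  filter_upwards [h] with n hn
  exact prF_mono fun Φ h1 h2 => h1 (hn Φ h2)

lemma WHP.and {k : ℕ} {r : ℝ} {P Q : ∀ n, Formula n k ⌊r * n⌋₊ → Prop} (hP : WHP k r P) (hQ : WHP k r Q) :
    WHP k r (fun n Φ => P n Φ ∧ Q n Φ) := by
  have := Tendsto.add hP hQ
  rw [add_zero] at this
  refine WHP.of_bound _ (Eventually.of_forall fun n => ?_) this
  refine le_trans (prF_mono fun Φ h => ?_) (prF_or _ _)
  exact not_and_or.1 h

lemma WHP.triv {k : ℕ} {r : ℝ} {P : ∀ n, Formula n k ⌊r * n⌋₊ → Prop} (h : ∀ᶠ n in atTop, ∀ Φ, P n Φ) : WHP k r P := by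
  refine WHP.of_bound (fun _ => 0) ?_ tendsto_const_nhds
  filter_upwards [h] with n hn
  have : prF n k ⌊r * n⌋₊ (fun Φ => ¬ P n Φ) = 0 := by
    rw [prF_eq]
    unfold expF
    rw [Finset.sum_eq_zero, zero_div]
    intro Φ _; rw [if_neg (not_not.2 (hn Φ))]
  exact this.le

lemma WHP.forall_mem {k : ℕ} {r : ℝ} {κ : Type} (S : Finset κ) {P : κ → ∀ n, Formula n k ⌊r * n⌋₊ → Prop}
    (h : ∀ c ∈ S, WHP k r (P c)) : WHP k r (fun n Φ => ∀ c ∈ S, P c n Φ) := by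
  induction S using Finset.induction_on with
  | empty => exact WHP.triv (Eventually.of_forall fun n Φ c hc => by simp at hc)
  | insert a s _ ih =>
    refine WHP.mono ((h a (Finset.mem_insert_self _ _)).and (ih fun c hc => h c (Finset.mem_insert_of_mem hc)))
      (Eventually.of_forall fun n Φ hΦ c hc => ?_)
    rcases Finset.mem_insert.1 hc with rfl | hc
    · exact hΦ.1
    · exact hΦ.2 c hc

lemma slots_le {k : ℕ} {r : ℝ} (hr : 0 ≤ r) (n : ℕ) : ((⌊r * n⌋₊ * k : ℕ) : ℝ) ≤ (r * k) * n := by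
  have := Nat.floor_le (show 0 ≤ r * (n:ℝ) by positivity)
  push_cast
  have hk : (0:ℝ) ≤ k := by positivity
  nlinarith

lemma slots_ge {k : ℕ} (hk : 1 ≤ k) {r : ℝ} (hr : 1 ≤ r) (n : ℕ) : n ≤ ⌊r * n⌋₊ * k := by
  have : n ≤ ⌊r * (n:ℝ)⌋₊ := by
    apply Nat.le_floor
    have : (0:ℝ) ≤ n := by positivity
    nlinarith
  nlinarith

lemma tendsto_c_div (c : ℝ) : Tendsto (fun n : ℕ => c / n) atTop (nhds 0) :=
  tendsto_const_div_atTop_nhds_zero_nat c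

lemma conc {k : ℕ} {r : ℝ} (hr : 0 ≤ r) (F : ∀ n, Formula n k ⌊r * n⌋₊ → ℝ) (M : ℝ)
    (h : ∀ n Φ s a, |F n Φ - F n (upd Φ s a)| ≤ M * (dg Φ (Φ s.1 s.2).1 + dg Φ a.1 + 1)) (ε : ℝ) (hε : 0 < ε) :
    WHP k r (fun n Φ => |F n Φ - expF n k _ (F n)| < ε * n) := by
  set R := r * k
  refine WHP.of_bound (fun n => (3 * M ^ 2 * (6 * Real.exp R + R * (6 * Real.exp R + 1))) / ε ^ 2 / n) ?_ (tendsto_c_div _)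
  filter_upwards [eventually_ge_atTop 1] with n hn
  have hn' : (0:ℝ) < n := by exact_mod_cast hn
  have := varF hn R (slots_le hr n) (F n) M (h n) (ε * n) (by positivity)
  simp only [not_lt]
  refine this.trans (le_of_eq ?_)
  field_simp

lemma occ_upd {n k m : ℕ} (Φ : Formula n k m) (s : Fin m × Fin k) (a l : Lit n) (h1 : l ≠ Φ s.1 s.2) (h2 : l ≠ a) :
    occ n k m (upd Φ s a) l = occ n k m Φ l := by
  unfold occ upd
  congr 1
  refine Finset.filter_congr fun p _ => ?_
  split_ifs with h
  · simp only [Prod.mk.eta] at h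
    subst h
    exact ⟨fun h => absurd h.symm h2, fun h => absurd h.symm h1⟩
  · rfl

lemma varstat_lip {n k m : ℕ} (φ : ℕ → ℕ → ℝ) (M : ℝ) (hφ : ∀ a b, |φ a b| ≤ M) (Φ : Formula n k m)
    (s : Fin m × Fin k) (a : Lit n) :
    |∑ x, φ (occ n k m Φ (x, true)) (occ n k m Φ (x, false)) -
      ∑ x, φ (occ n k m (upd Φ s a) (x, true)) (occ n k m (upd Φ s a) (x, false))| ≤
      4 * M * (dg Φ (Φ s.1 s.2).1 + dg Φ a.1 + 1) := by
  have hM : 0 ≤ M := (abs_nonneg _).trans (hφ 0 0)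
  rw [← Finset.sum_sub_distrib]
  have : ∑ x, (φ (occ n k m Φ (x, true)) (occ n k m Φ (x, false)) -
      φ (occ n k m (upd Φ s a) (x, true)) (occ n k m (upd Φ s a) (x, false))) =
    ∑ x ∈ {(Φ s.1 s.2).1, a.1}, (φ (occ n k m Φ (x, true)) (occ n k m Φ (x, false)) -
      φ (occ n k m (upd Φ s a) (x, true)) (occ n k m (upd Φ s a) (x, false))) := by
    symm
    refine Finset.sum_subset (Finset.subset_univ _) fun x _ hx => ?_
    simp only [Finset.mem_insert, Finset.mem_singleton, not_or] at hx
    have : ∀ b, occ n k m (upd Φ s a) (x, b) = occ n k m Φ (x, b) := fun b =>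
      occ_upd Φ s a (x, b) (fun h => hx.1 (by rw [← h])) (fun h => hx.2 (by rw [← h]))
    rw [this, this, sub_self]
  rw [this]
  refine (Finset.abs_sum_le_sum_abs _ _).trans ?_
  calc _ ≤ ∑ x ∈ ({(Φ s.1 s.2).1, a.1} : Finset (Fin n)), 2 * M := by
        refine Finset.sum_le_sum fun x _ => ?_
        refine (abs_sub _ _).trans ?_
        have := hφ (occ n k m Φ (x, true)) (occ n k m Φ (x, false))
        have := hφ (occ n k m (upd Φ s a) (x, true)) (occ n k m (upd Φ s a) (x, false))
        linarith
    _ ≤ 2 * (2 * M) := by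
        rw [Finset.sum_const, nsmul_eq_mul]
        gcongr
        exact_mod_cast Finset.card_le_two
    _ ≤ _ := by
        have : (0:ℝ) ≤ dg Φ (Φ s.1 s.2).1 + dg Φ a.1 := by positivity
        nlinarith

/-- P2 -/
lemma whp_P2 {k : ℕ} {r : ℝ} (hr : 0 ≤ r) :
    WHP k r (fun n Φ => ∑ x : Fin n, ((occ n k _ Φ (x, true) : ℝ) + occ n k _ Φ (x, false)) ^ 2 ≤ n * Real.sqrt n) := by
  refine WHP.of_bound (fun n => 6 * Real.exp (r * k) / Real.sqrt n) ?_ ?_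
  · filter_upwards [eventually_ge_atTop 1] with n hn
    have hn' : (0:ℝ) < n := by exact_mod_cast hn
    have hs : 0 < Real.sqrt n := Real.sqrt_pos.2 hn'
    refine le_trans (prF_mono fun Φ h => ?_) ((markovF (fun Φ => ∑ x : Fin n, (dg Φ x : ℝ) ^ 2) (fun Φ => by positivity)
      (n * Real.sqrt n) (by positivity)).trans ?_)
    · push Not at h
      simp only [dg]; push_cast; exact h.le
    · rw [expF_sum]
      calc _ ≤ (∑ x : Fin n, 6 * Real.exp (r * k)) / (n * Real.sqrt n) := by
            gcongr with x
            exact exp_dg2 hn _ (slots_le hr n) x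
        _ = _ := by
            simp; field_simp
  · refine Tendsto.div_atTop tendsto_const_nhds ?_
    exact Real.tendsto_sqrt_atTop.comp tendsto_natCast_atTop_atTop

lemma pair_prob {n k m : ℕ} (hn : 1 ≤ n) (x : Fin n) (a b : ℕ) :
    ((m * k).choose (a + b) : ℝ) * (1 / (2 * n)) ^ (a + b) * (1 - 1 / n) ^ (m * k - (a + b)) ≤
      expF n k m (fun Φ => if occ n k m Φ (x, true) = a ∧ occ n k m Φ (x, false) = b then 1 else 0) := by
  have hn' : (0:ℝ) < n := by exact_mod_cast hn
  have hA : ∀ T : Finset (Fin m × Fin k), ∃ A, T.card = a + b → A ⊆ T ∧ A.card = a := by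
    intro T
    by_cases h : T.card = a + b
    · obtain ⟨A, h1, h2⟩ := Finset.exists_subset_card_eq (show a ≤ T.card by omega)
      exact ⟨A, fun _ => ⟨h1, h2⟩⟩
    · exact ⟨∅, fun h' => absurd h' h⟩
  choose A hA using hA
  set g : Finset (Fin m × Fin k) → Fin m × Fin k → Lit n → ℝ := fun T s l =>
    if s ∈ T then (if l = (x, decide (s ∈ A T)) then 1 else 0) else (if l.1 ≠ x then 1 else 0) with hg
  have g01 : ∀ T s l, 0 ≤ g T s l ∧ g T s l ≤ 1 := by
    intro T s l; simp only [hg]; split_ifs <;> norm_num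
  have key : ∀ Φ : Formula n k m, ∑ T ∈ Finset.powersetCard (a + b) univ, ∏ s : Fin m × Fin k, g T s (Φ s.1 s.2) ≤
      if occ n k m Φ (x, true) = a ∧ occ n k m Φ (x, false) = b then 1 else 0 := by
    intro Φ
    set T0 := (univ.filter fun s : Fin m × Fin k => (Φ s.1 s.2).1 = x) with hT0
    have hz : ∀ T ∈ Finset.powersetCard (a + b) (univ : Finset (Fin m × Fin k)), ∏ s : Fin m × Fin k, g T s (Φ s.1 s.2) ≠ 0 →
        T = T0 ∧ (occ n k m Φ (x, true) = a ∧ occ n k m Φ (x, false) = b) := by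
      intro T hT hne
      rw [Finset.prod_ne_zero_iff] at hne
      have h1 : ∀ s ∈ T, Φ s.1 s.2 = (x, decide (s ∈ A T)) := by
        intro s hs
        have := hne s (Finset.mem_univ _)
        simp only [hg, if_pos hs] at this
        by_contra h; rw [if_neg h] at this; exact this rfl
      have h2 : ∀ s ∉ T, (Φ s.1 s.2).1 ≠ x := by
        intro s hs
        have := hne s (Finset.mem_univ _)
        simp only [hg, if_neg hs] at this
        by_contra h; rw [if_neg (not_not.2 h)] at this; exact this rfl
      have hTc := (Finset.mem_powersetCard.1 hT).2
      obtain ⟨hAs, hAc⟩ := hA T hTc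
      refine ⟨?_, ?_, ?_⟩
      · ext s
        simp only [hT0, Finset.mem_filter, Finset.mem_univ, true_and]
        constructor
        · intro hs; rw [h1 s hs]
        · intro hs; by_contra h; exact h2 s h hs
      · rw [occ_eq, ← hAc]
        congr 1; ext s
        simp only [Finset.mem_filter, Finset.mem_univ, true_and]
        by_cases hs : s ∈ T
        · rw [h1 s hs]; simp
        · have := h2 s hs
          constructor
          · intro h; rw [h] at this; exact absurd rfl this
          · intro h; exact absurd (hAs h) hs
      · rw [occ_eq]
        have : b = (T \ A T).card := by rw [Finset.card_sdiff_of_subset hAs]; omega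
        rw [this]
        congr 1; ext s
        simp only [Finset.mem_filter, Finset.mem_univ, true_and, Finset.mem_sdiff]
        by_cases hs : s ∈ T
        · rw [h1 s hs]; simp [hs]
        · have := h2 s hs
          constructor
          · intro h; rw [h] at this; exact absurd rfl this
          · intro h; exact absurd h.1 hs
    have hle : ∀ T, ∏ s : Fin m × Fin k, g T s (Φ s.1 s.2) ≤ 1 := fun T =>
      Finset.prod_le_one (fun s _ => (g01 _ _ _).1) (fun s _ => (g01 _ _ _).2)
    by_cases hex : ∃ T ∈ Finset.powersetCard (a + b) (univ : Finset (Fin m × Fin k)), ∏ s : Fin m × Fin k, g T s (Φ s.1 s.2) ≠ 0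
    · obtain ⟨T, hT, hne⟩ := hex
      obtain ⟨h1, h2⟩ := hz T hT hne
      rw [if_pos h2, Finset.sum_eq_single T]
      · exact hle T
      · intro T' hT' hd
        by_contra h
        exact hd ((hz T' hT' h).1.trans h1.symm)
      · intro h; exact absurd hT h
    · push Not at hex
      rw [Finset.sum_eq_zero hex]
      split_ifs <;> norm_num
  refine le_trans (le_of_eq ?_) (expF_mono key)
  rw [expF_sum]
  have e : ∀ T ∈ Finset.powersetCard (a + b) (univ : Finset (Fin m × Fin k)),
      expF n k m (fun Φ => ∏ s : Fin m × Fin k, g T s (Φ s.1 s.2)) =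
      (1 / (2 * n)) ^ (a + b) * (1 - 1 / n) ^ (m * k - (a + b)) := by
    intro T hT
    have hTc := (Finset.mem_powersetCard.1 hT).2
    rw [expF_prod hn]
    have : ∀ s, (∑ l, g T s l) / (2 * n) = if s ∈ T then (1 / (2 * (n:ℝ))) else (1 - 1 / n) := by
      intro s
      simp only [hg]
      split_ifs with h
      · rw [Finset.sum_ite_eq' univ]; simp
      · have : ∑ l : Lit n, (if l.1 ≠ x then (1:ℝ) else 0) = 2 * n - 2 := by
          rw [Fintype.sum_prod_type]
          simp only [Fintype.sum_bool]
          rw [Finset.sum_congr rfl (g := fun y : Fin n => (2:ℝ) - if y = x then 2 else 0)]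
          · rw [Finset.sum_sub_distrib]; simp; ring
          · intro y _; by_cases hy : y = x <;> simp [hy]; norm_num
        rw [this]; field_simp
    rw [Finset.prod_congr rfl fun s _ => this s, Finset.prod_ite]
    simp only [Finset.prod_const]
    congr 2
    · rw [Finset.filter_mem_eq_inter, Finset.univ_inter, hTc]
    · have : (univ.filter fun s => s ∉ T) = Tᶜ := by ext; simp
      rw [this, Finset.card_compl, hTc]; simp
  rw [Finset.sum_congr rfl e, Finset.sum_const, Finset.card_powersetCard, nsmul_eq_mul]
  simp; ring

lemma one_sub_pow_ge {n K : ℕ} (hn : 2 ≤ n) (R : ℝ) (hK : (K:ℝ) ≤ R * n) : Real.exp (-(2 * R)) ≤ (1 - 1 / (n:ℝ)) ^ K := by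
  have hn' : (2:ℝ) ≤ n := by exact_mod_cast hn
  have hx : 1 / (n:ℝ) ≤ 1 / 2 := one_div_le_one_div_of_le (by norm_num) hn'
  have hx0 : 0 < 1 / (n:ℝ) := by positivity
  have : Real.exp (-(2 * (1 / (n:ℝ)))) ≤ 1 - 1 / n := by
    rw [Real.exp_neg, inv_le_iff_one_le_mul₀ (Real.exp_pos _)]
    have := Real.add_one_le_exp (2 * (1 / (n:ℝ)))
    nlinarith
  calc Real.exp (-(2 * R)) ≤ Real.exp (K * -(2 * (1 / (n:ℝ)))) := by
        apply Real.exp_le_exp.2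
        rw [show (K:ℝ) * -(2 * (1 / (n:ℝ))) = -(2 * (K / n)) by ring]
        have : (K:ℝ) / n ≤ R := by rw [div_le_iff₀ (by linarith)]; exact hK
        linarith
    _ = (Real.exp (-(2 * (1 / (n:ℝ))))) ^ K := by rw [← Real.exp_nat_mul]
    _ ≤ _ := by gcongr

lemma pair_prob_low {k : ℕ} (hk : 1 ≤ k) {r : ℝ} (hr : 1 ≤ r) (a b : ℕ) (n : ℕ) (hn : 2 * (a + b) + 2 ≤ n) (x : Fin n) :
    (1 / 4) ^ (a + b) / (a + b).factorial * Real.exp (-(2 * (r * k))) ≤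
      expF n k ⌊r * n⌋₊ (fun Φ => if occ n k _ Φ (x, true) = a ∧ occ n k _ Φ (x, false) = b then 1 else 0) := by
  have hge := slots_ge hk hr n
  have hle := slots_le (k := k) (by linarith : 0 ≤ r) n
  have hn' : (0:ℝ) < n := by exact_mod_cast (by omega : 0 < n)
  refine le_trans ?_ (pair_prob (by omega) x a b)
  set K := ⌊r * (n:ℝ)⌋₊ * k
  set q := a + b
  gcongr
  · rw [div_le_iff₀ (by positivity)]
    have h1 := Nat.pow_le_choose (α := ℝ) q K
    have h2 : ((K + 1 - q : ℕ):ℝ) ^ q ≤ q.factorial * K.choose q := by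
      have := (div_le_iff₀' (by positivity)).1 h1
      push_cast at this ⊢
      exact this
    have h3 : (n:ℝ) / 2 ≤ (K + 1 - q : ℕ) := by
      have : n ≤ 2 * (K + 1 - q) := by omega
      have : (n:ℝ) ≤ 2 * (K + 1 - q : ℕ) := by exact_mod_cast this
      linarith
    calc (1/4:ℝ) ^ q = ((n:ℝ) / 2) ^ q * (1 / (2 * n)) ^ q := by
          rw [← mul_pow]; congr 1; field_simp; norm_num
      _ ≤ ((K + 1 - q : ℕ):ℝ) ^ q * (1 / (2 * n)) ^ q := by gcongr
      _ ≤ (q.factorial * K.choose q) * (1 / (2 * n)) ^ q := by gcongr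
      _ = _ := by ring
  · refine (one_sub_pow_ge (by omega : 2 ≤ n) _ hle).trans ?_
    have h1 : 1 / (n:ℝ) ≤ 1 := by rw [div_le_one hn']; exact_mod_cast (by omega : 1 ≤ n)
    have h0 : 0 < 1 / (n:ℝ) := by positivity
    exact pow_le_pow_of_le_one (by linarith) (by linarith) (by omega)

/-- P1 -/
lemma whp_Nab {k : ℕ} (hk : 1 ≤ k) {r : ℝ} (hr : 1 ≤ r) (q : ℕ × ℕ) :
    ∃ γ : ℝ, 0 < γ ∧ WHP k r (fun n Φ => γ * n ≤ Nab (degSeq n k _ Φ) q) := by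
  obtain ⟨a, b⟩ := q
  set γ := (1 / 4 : ℝ) ^ (a + b) / (a + b).factorial * Real.exp (-(2 * (r * k))) with hγ
  have hγ0 : 0 < γ := by positivity
  refine ⟨γ / 2, by positivity, ?_⟩
  set φ : ℕ → ℕ → ℝ := fun a' b' => if a' = a ∧ b' = b then 1 else 0 with hφ
  have hc := conc (k := k) (by linarith : 0 ≤ r) (fun n Φ => ∑ x, φ (occ n k _ Φ (x, true)) (occ n k _ Φ (x, false))) (4 * 1)
    (fun n Φ s c => varstat_lip φ 1 (fun a' b' => by simp only [hφ]; split_ifs <;> norm_num) Φ s c) (γ / 2) (by positivity)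
  refine hc.mono ?_
  filter_upwards [eventually_ge_atTop (2 * (a + b) + 2)] with n hn Φ h
  have e : (Nab (degSeq n k _ Φ) (a, b) : ℝ) = ∑ x, φ (occ n k _ Φ (x, true)) (occ n k _ Φ (x, false)) := by
    simp only [hφ]
    rw [Finset.sum_boole]
    unfold Nab degSeq
    simp only [Prod.mk.injEq]
  have hE : γ * n ≤ expF n k ⌊r * n⌋₊ (fun Φ => ∑ x, φ (occ n k _ Φ (x, true)) (occ n k _ Φ (x, false))) := by
    rw [expF_sum]
    calc γ * n = ∑ x : Fin n, γ := by simp; ring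
      _ ≤ _ := Finset.sum_le_sum fun x _ => pair_prob_low hk hr a b n hn x
  have := (abs_lt.1 h).1
  rw [e]
  linarith
end

section
/-! Part D3: the statistic A -/

def chi {n : ℕ} (x : Fin n) (l : Lit n) : ℝ := if l.1 = x then (if l.2 then 1 else -1) else 0

def zv {n k m : ℕ} (Φ : Formula n k m) (x : Fin n) : ℤ := (occ n k m Φ (x, true) : ℤ) - occ n k m Φ (x, false)

lemma sum_chi {n : ℕ} (x : Fin n) (g : ℝ → ℝ) : ∑ l : Lit n, g (chi x l) = 2 * (n - 1) * g 0 + g 1 + g (-1) := by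
  rw [Fintype.sum_prod_type]
  simp only [Fintype.sum_bool, chi]
  rw [Finset.sum_congr rfl (g := fun y : Fin n => 2 * g 0 + if y = x then (g 1 + g (-1) - 2 * g 0) else 0)]
  · rw [Finset.sum_add_distrib]; simp; ring
  · intro y _; by_cases hy : y = x <;> simp [hy] <;> ring

lemma zv_eq {n k m : ℕ} (Φ : Formula n k m) (x : Fin n) : (zv Φ x : ℝ) = ∑ s : Fin m × Fin k, chi x (Φ s.1 s.2) := by
  rw [occ_sum Φ (chi x), Fintype.sum_prod_type]
  simp only [Fintype.sum_bool, chi]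
  rw [Finset.sum_eq_single x]
  · simp [zv]; ring
  · intro y _ hy; simp [hy]
  · simp

lemma exp_z2 {n k m : ℕ} (hn : 1 ≤ n) (x : Fin n) : expF n k m (fun Φ => (zv Φ x : ℝ) ^ 2) = (m * k : ℕ) / n := by
  have hn' : (0:ℝ) < n := by exact_mod_cast hn
  have e : ∀ Φ : Formula n k m, (zv Φ x : ℝ) ^ 2 = ∑ s : Fin m × Fin k, ∑ s' : Fin m × Fin k, chi x (Φ s.1 s.2) * chi x (Φ s'.1 s'.2) := by
    intro Φ; rw [zv_eq, sq, Finset.sum_mul_sum]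
  simp only [e]
  rw [expF_sum]
  simp only [expF_sum]
  have key : ∀ s s' : Fin m × Fin k, expF n k m (fun Φ => chi x (Φ s.1 s.2) * chi x (Φ s'.1 s'.2)) = if s = s' then 1 / (n:ℝ) else 0 := by
    intro s s'
    set g : Fin m × Fin k → Lit n → ℝ := fun u l => (if u = s then chi x l else 1) * (if u = s' then chi x l else 1) with hg
    have e2 : ∀ Φ : Formula n k m, chi x (Φ s.1 s.2) * chi x (Φ s'.1 s'.2) = ∏ u : Fin m × Fin k, g u (Φ u.1 u.2) := by
      intro Φ
      simp only [hg]
      rw [Finset.prod_mul_distrib, Finset.prod_ite_eq' univ s, Finset.prod_ite_eq' univ s']; simp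
    simp only [e2]
    rw [expF_prod hn]
    split_ifs with h
    · subst h
      rw [Finset.prod_eq_single s]
      · have := sum_chi x (fun y => y * y)
        simp only [hg, if_true]
        rw [this]; field_simp; ring
      · intro u _ hu
        simp only [hg, if_neg hu]
        simp; field_simp
      · simp
    · rw [Finset.prod_eq_zero (Finset.mem_univ s)]
      have := sum_chi x (fun y => y)
      simp only [hg, if_true, if_neg h, mul_one]
      rw [this]; simp
  simp only [key]
  simp only [Finset.sum_ite_eq, Finset.mem_univ, if_true, Finset.sum_const, Finset.card_univ, Fintype.card_prod, Fintype.card_fin, nsmul_eq_mul]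
  ring

lemma exp_mgf {n k m : ℕ} (hn : 1 ≤ n) (R : ℝ) (hK : ((m * k : ℕ):ℝ) ≤ R * n) (x : Fin n) (u : ℝ) :
    expF n k m (fun Φ => Real.exp (u * zv Φ x)) ≤ Real.exp (R * (Real.cosh u - 1)) := by
  have hn' : (0:ℝ) < n := by exact_mod_cast hn
  have e : ∀ Φ : Formula n k m, Real.exp (u * zv Φ x) = ∏ s : Fin m × Fin k, Real.exp (u * chi x (Φ s.1 s.2)) := by
    intro Φ; rw [zv_eq, Finset.mul_sum, Real.exp_sum]
  simp only [e]
  rw [expF_prod hn (fun _ l => Real.exp (u * chi x l))]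
  rw [sum_chi x (fun y => Real.exp (u * y)), Finset.prod_const, Finset.card_univ, Fintype.card_prod, Fintype.card_fin, Fintype.card_fin]
  refine le_trans (le_of_eq ?_) (exp_lin hn (Real.cosh u - 1) R (by linarith [Real.one_le_cosh u]) hK)
  congr 1
  rw [Real.cosh_eq]
  field_simp
  simp; ring_nf

def AA (k : ℕ) {n m : ℕ} (Φ : Formula n k m) : ℝ := ∑ x, ((fz k (zv Φ x) : ℤ) : ℝ) ^ 2

def tau (k : ℕ) (R t : ℝ) : ℝ := 4 / t ^ 2 * Real.exp (-(t * (10 * Real.sqrt ((k : ℝ) * 2 ^ k * Real.log k)))) * Real.exp (R * (Real.cosh (2 * t) - 1))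

lemma fz_tail (k : ℕ) (z : ℤ) (t : ℝ) (ht : 0 < t) :
    (z:ℝ) ^ 2 - ((fz k z : ℤ) : ℝ) ^ 2 ≤ 2 / t ^ 2 * Real.exp (-(t * (10 * Real.sqrt ((k : ℝ) * 2 ^ k * Real.log k)))) *
      (Real.exp (2 * t * z) + Real.exp (-(2 * t) * z)) := by
  set B := 10 * Real.sqrt ((k : ℝ) * 2 ^ k * Real.log k) with hB
  unfold fz
  split_ifs with h
  · rw [sub_self]; positivity
  · push Not at h
    have h1 : B ≤ |(z:ℝ)| := by
      have h2 : (bb k : ℤ) + 1 ≤ |z| := h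
      have h3 : ((bb k : ℝ)) + 1 ≤ |(z:ℝ)| := by exact_mod_cast h2
      have := Nat.lt_floor_add_one B
      exact this.le.trans h3
    have h2 : Real.exp (2 * t * |(z:ℝ)|) ≤ Real.exp (2 * t * z) + Real.exp (-(2 * t) * z) := by
      rcases abs_cases (z:ℝ) with ⟨h, _⟩ | ⟨h, _⟩ <;> rw [h]
      · have := Real.exp_pos (-(2 * t) * z); linarith
      · have := Real.exp_pos (2 * t * z)
        rw [show 2 * t * -(z:ℝ) = -(2 * t) * z by ring]; linarith
    have h3 : (t * |(z:ℝ)|) ^ 2 ≤ 2 * Real.exp (t * |(z:ℝ)|) := by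
      have := Real.quadratic_le_exp_of_nonneg (show 0 ≤ t * |(z:ℝ)| by positivity)
      have : 0 ≤ t * |(z:ℝ)| := by positivity
      linarith
    have h4 : Real.exp (t * |(z:ℝ)|) ≤ Real.exp (-(t * B)) * Real.exp (2 * t * |(z:ℝ)|) := by
      rw [← Real.exp_add]
      apply Real.exp_le_exp.2
      nlinarith
    calc (z:ℝ) ^ 2 - ((0:ℤ):ℝ) ^ 2 = (t * |(z:ℝ)|) ^ 2 / t ^ 2 := by
          rw [mul_pow, sq_abs]; field_simp; simp
      _ ≤ 2 * (Real.exp (-(t * B)) * (Real.exp (2 * t * z) + Real.exp (-(2 * t) * z))) / t ^ 2 := by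
          gcongr
          refine h3.trans ?_
          gcongr
          refine h4.trans ?_
          gcongr
      _ = _ := by ring

lemma fz_sq_le (k : ℕ) (z : ℤ) : ((fz k z : ℤ) : ℝ) ^ 2 ≤ (z:ℝ) ^ 2 := by
  unfold fz; split_ifs
  · exact le_rfl
  · simp; positivity

lemma exp_AA {n k m : ℕ} (hn : 1 ≤ n) (R : ℝ) (hK : ((m * k : ℕ):ℝ) ≤ R * n) (t : ℝ) (ht : 0 < t) :
    expF n k m (AA k) ≤ (m * k : ℕ) ∧ (m * k : ℕ) - n * tau k R t ≤ expF n k m (AA k) := by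
  have hn' : (0:ℝ) < n := by exact_mod_cast hn
  have hz : expF n k m (fun Φ => ∑ x, (zv Φ x : ℝ) ^ 2) = (m * k : ℕ) := by
    rw [expF_sum, Finset.sum_congr rfl fun x _ => exp_z2 hn x]
    simp; field_simp
  constructor
  · rw [← hz]
    exact expF_mono fun Φ => Finset.sum_le_sum fun x _ => fz_sq_le _ _
  · have : expF n k m (fun Φ => ∑ x, (zv Φ x : ℝ) ^ 2) - expF n k m (AA k) ≤ n * tau k R t := by
      rw [← expF_sub]
      calc _ ≤ expF n k m (fun Φ => ∑ x, 2 / t ^ 2 * Real.exp (-(t * (10 * Real.sqrt ((k : ℝ) * 2 ^ k * Real.log k)))) *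
            (Real.exp (2 * t * zv Φ x) + Real.exp (-(2 * t) * zv Φ x))) := by
            refine expF_mono fun Φ => ?_
            unfold AA
            rw [← Finset.sum_sub_distrib]
            exact Finset.sum_le_sum fun x _ => fz_tail k _ t ht
        _ = ∑ x : Fin n, 2 / t ^ 2 * Real.exp (-(t * (10 * Real.sqrt ((k : ℝ) * 2 ^ k * Real.log k)))) *
            (expF n k m (fun Φ => Real.exp (2 * t * zv Φ x)) + expF n k m (fun Φ => Real.exp (-(2 * t) * zv Φ x))) := by
            rw [expF_sum]
            refine Finset.sum_congr rfl fun x _ => ?_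
            rw [expF_mul, expF_add]
        _ ≤ ∑ x : Fin n, tau k R t := by
            refine Finset.sum_le_sum fun x _ => ?_
            have h1 := exp_mgf hn R hK x (2 * t)
            have h2 := exp_mgf hn R hK x (-(2 * t))
            rw [Real.cosh_neg] at h2
            unfold tau
            calc _ ≤ 2 / t ^ 2 * Real.exp (-(t * (10 * Real.sqrt ((k : ℝ) * 2 ^ k * Real.log k)))) *
                (Real.exp (R * (Real.cosh (2 * t) - 1)) + Real.exp (R * (Real.cosh (2 * t) - 1))) := by gcongr
              _ = _ := by ring
        _ = _ := by simp
    linarith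

lemma tau_le {k : ℕ} (hk : 10 ^ 4 ≤ k) {r : ℝ} (hr0 : 0 ≤ r) (hr : r ≤ 2 ^ k * Real.log 2) :
    tau k (r * k) (Real.sqrt (Real.log k / (k * 2 ^ k))) ≤ 2 ^ k / (k:ℝ) ^ 5 := by
  have hK : (10 ^ 4 : ℝ) ≤ k := by exact_mod_cast hk
  have hk0 : (0:ℝ) < k := by linarith
  have hl1 : 1 ≤ Real.log k := by
    rw [Real.le_log_iff_exp_le hk0]
    linarith [Real.exp_one_lt_d9]
  have hlk : Real.log k ≤ k := (Real.log_le_sub_one_of_pos hk0).trans (by linarith)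
  set l := Real.log k with hl
  have h2k : (0:ℝ) < 2 ^ k := by positivity
  have h2k2 : (2:ℝ) ≤ 2 ^ k := by
    calc (2:ℝ) = 2 ^ 1 := by norm_num
      _ ≤ 2 ^ k := pow_le_pow_right₀ (by norm_num) (by omega)
  set t := Real.sqrt (l / (k * 2 ^ k)) with ht
  have ht2 : t ^ 2 = l / (k * 2 ^ k) := Real.sq_sqrt (by positivity)
  have htB : t * (10 * Real.sqrt (k * 2 ^ k * l)) = 10 * l := by
    rw [ht, mul_left_comm, ← Real.sqrt_mul (by positivity)]
    rw [show l / (k * 2 ^ k) * (k * 2 ^ k * l) = l ^ 2 by field_simp, Real.sqrt_sq (by linarith)]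
  have hcosh : Real.cosh (2 * t) - 1 ≤ 4 * (l / (k * 2 ^ k)) := by
    have h1 := Real.cosh_le_exp_half_sq (2 * t)
    have h2 : (2 * t) ^ 2 / 2 = 2 * (l / (k * 2 ^ k)) := by rw [mul_pow, ht2]; ring
    rw [h2] at h1
    have h3 : 2 * (l / (k * 2 ^ k)) ≤ 1 := by
      rw [mul_div_assoc', div_le_one (by positivity)]; nlinarith
    have h4 : 0 ≤ 2 * (l / (k * 2 ^ k)) := by positivity
    have h5 := Real.abs_exp_sub_one_le (x := 2 * (l / (k * 2 ^ k))) (by rw [abs_of_nonneg h4]; exact h3)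
    rw [abs_of_nonneg h4] at h5
    have := le_abs_self (Real.exp (2 * (l / (k * 2 ^ k))) - 1)
    linarith
  have hR : r * k * (Real.cosh (2 * t) - 1) ≤ 3 * l := by
    have h0 : 0 ≤ Real.cosh (2 * t) - 1 := by linarith [Real.one_le_cosh (2 * t)]
    have l2 := Real.log_two_lt_d9
    calc r * k * (Real.cosh (2 * t) - 1) ≤ (2 ^ k * Real.log 2) * k * (4 * (l / (k * 2 ^ k))) := by gcongr
      _ = 4 * Real.log 2 * l := by field_simp
      _ ≤ 3 * l := by nlinarith
  unfold tau
  rw [htB, ht2]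
  have ek : Real.exp l = k := Real.exp_log hk0
  calc 4 / (l / (k * 2 ^ k)) * Real.exp (-(10 * l)) * Real.exp (r * k * (Real.cosh (2 * t) - 1))
      ≤ 4 * (k * 2 ^ k) * Real.exp (-(10 * l)) * Real.exp (3 * l) := by
        gcongr
        rw [div_div_eq_mul_div]
        exact div_le_self (by positivity) hl1
    _ = 4 * (k * 2 ^ k) / (k:ℝ) ^ 7 := by
        rw [mul_assoc, ← Real.exp_add, show -(10 * l) + 3 * l = -((7:ℕ) * l) by push_cast; ring, Real.exp_neg, Real.exp_nat_mul, ek]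
        rfl
    _ ≤ _ := by
        rw [div_le_div_iff₀ (by positivity) (by positivity)]
        have : 4 * (k * 2 ^ k) * (k:ℝ) ^ 5 = (2 ^ k * k ^ 6) * 4 := by ring
        rw [this]
        have : 2 ^ k * (k:ℝ) ^ 7 = (2 ^ k * k ^ 6) * k := by ring
        rw [this]
        gcongr; linarith

lemma whp_AA {k : ℕ} (hk : 10 ^ 4 ≤ k) {r : ℝ} (hr0 : 0 ≤ r) (hr : r ≤ 2 ^ k * Real.log 2) (ε : ℝ) (hε : 0 < ε) :
    WHP k r (fun n Φ => (⌊r * n⌋₊ * k : ℕ) - n * (2 ^ k / (k:ℝ) ^ 5) - ε * n ≤ AA k Φ ∧ AA k Φ ≤ (⌊r * n⌋₊ * k : ℕ) + ε * n) := by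
  have hK : (10 ^ 4 : ℝ) ≤ k := by exact_mod_cast hk
  have hk0 : (0:ℝ) < k := by linarith
  set φ : ℕ → ℕ → ℝ := fun a b => ((fz k ((a:ℤ) - b) : ℤ) : ℝ) ^ 2 with hφ
  have hc := conc (k := k) hr0 (fun n Φ => ∑ x, φ (occ n k _ Φ (x, true)) (occ n k _ Φ (x, false))) (4 * (bb k : ℝ) ^ 2)
    (fun n Φ s c => varstat_lip φ _ (fun a b => by
      simp only [hφ]
      rw [abs_of_nonneg (by positivity)]
      have h := Finset.mem_Icc.1 (fz_mem k ((a:ℤ) - b))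
      rw [sq_le_sq, abs_le, Nat.abs_cast]
      exact ⟨by exact_mod_cast h.1, by exact_mod_cast h.2⟩) Φ s c) ε hε
  refine hc.mono ?_
  filter_upwards [eventually_ge_atTop 1] with n hn Φ h
  have ht : 0 < Real.sqrt (Real.log k / (k * 2 ^ k)) := by
    apply Real.sqrt_pos.2
    have : 0 < Real.log k := Real.log_pos (by linarith)
    positivity
  obtain ⟨h1, h2⟩ := exp_AA hn (r * k) (slots_le hr0 n) _ ht
  have h3 := tau_le hk hr0 hr
  have e : (fun Φ : Formula n k ⌊r * n⌋₊ => ∑ x, φ (occ n k _ Φ (x, true)) (occ n k _ Φ (x, false))) = AA k := rfl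
  simp only [e] at h
  have e' : ∑ x, φ (occ n k _ Φ (x, true)) (occ n k _ Φ (x, false)) = AA k Φ := rfl
  rw [e'] at h
  have h4 := abs_lt.1 h
  have h5 : (n:ℝ) * tau k (r * k) (Real.sqrt (Real.log k / (k * 2 ^ k))) ≤ n * (2 ^ k / (k:ℝ) ^ 5) := by gcongr
  constructor
  · linarith [h4.1]
  · linarith [h4.2]
end

section
/-! Part D4: clause statistics -/

def CS {n k m : ℕ} (g : Fin k → ℝ → ℝ) (Φ : Formula n k m) : ℝ :=
  ∑ i, ∏ j, g j (pLit k (degSeq n k m Φ) (Φ i j))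

lemma pLit_congr {n k : ℕ} (d d' : Lit n → ℕ) (l : Lit n) (h : ∀ b, d (l.1, b) = d' (l.1, b)) : pLit k d l = pLit k d' l := by
  unfold pLit; rw [h, h]

lemma prod_mem01 {k : ℕ} (g : Fin k → ℝ → ℝ) (hg : ∀ j t, 0 ≤ g j t ∧ g j t ≤ 1) (l : Fin k → ℝ) :
    0 ≤ ∏ j, g j (l j) ∧ ∏ j, g j (l j) ≤ 1 :=
  ⟨Finset.prod_nonneg fun j _ => (hg _ _).1, Finset.prod_le_one (fun j _ => (hg _ _).1) (fun j _ => (hg _ _).2)⟩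

lemma card_clauses {n k m : ℕ} (Φ : Formula n k m) (x : Fin n) :
    (univ.filter fun i : Fin m => ∃ j, (Φ i j).1 = x).card ≤ dg Φ x := by
  rw [dg_eq]
  have : (univ.filter fun i : Fin m => ∃ j, (Φ i j).1 = x) ⊆ (univ.filter fun s : Fin m × Fin k => (Φ s.1 s.2).1 = x).image Prod.fst := by
    intro i hi
    obtain ⟨j, hj⟩ := (Finset.mem_filter.1 hi).2
    exact Finset.mem_image.2 ⟨(i, j), Finset.mem_filter.2 ⟨Finset.mem_univ _, hj⟩, rfl⟩
  exact (Finset.card_le_card this).trans Finset.card_image_le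

lemma CS_lip {n k m : ℕ} (g : Fin k → ℝ → ℝ) (hg : ∀ j t, 0 ≤ g j t ∧ g j t ≤ 1) (Φ : Formula n k m)
    (s : Fin m × Fin k) (a : Lit n) :
    |CS g Φ - CS g (upd Φ s a)| ≤ 1 * (dg Φ (Φ s.1 s.2).1 + dg Φ a.1 + 1) := by
  unfold CS
  rw [← Finset.sum_sub_distrib]
  set I := (univ.filter fun i : Fin m => ∃ j, (Φ i j).1 = (Φ s.1 s.2).1) ∪ (univ.filter fun i : Fin m => ∃ j, (Φ i j).1 = a.1) with hI
  rw [← Finset.sum_subset (Finset.subset_univ I)]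
  · refine (Finset.abs_sum_le_sum_abs _ _).trans ?_
    calc _ ≤ ∑ i ∈ I, (1:ℝ) := by
          refine Finset.sum_le_sum fun i _ => ?_
          have h1 := prod_mem01 g hg (fun j => pLit k (degSeq n k m Φ) (Φ i j))
          have h2 := prod_mem01 g hg (fun j => pLit k (degSeq n k m (upd Φ s a)) (upd Φ s a i j))
          rw [abs_le]; constructor <;> linarith
      _ = (I.card : ℝ) := by simp
      _ ≤ (dg Φ (Φ s.1 s.2).1 + dg Φ a.1 : ℕ) := by
          exact_mod_cast (Finset.card_union_le _ _).trans (add_le_add (card_clauses _ _) (card_clauses _ _))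
      _ ≤ _ := by push_cast; linarith
  · intro i _ hi
    simp only [hI, Finset.mem_union, Finset.mem_filter, Finset.mem_univ, true_and, not_or, not_exists] at hi
    obtain ⟨h1, h2⟩ := hi
    rw [sub_eq_zero]
    refine Finset.prod_congr rfl fun j _ => ?_
    have e : upd Φ s a i j = Φ i j := by
      unfold upd
      rw [if_neg]
      intro h
      apply h1 j
      rw [← h]
    rw [e]
    congr 1
    refine pLit_congr _ _ _ fun b => ?_
    unfold degSeq
    rw [occ_upd]
    · intro h; exact h1 j (by rw [← h])
    · intro h; exact h2 j (by rw [← h])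

/-! exchangeability -/

def pm {n k m : ℕ} (π : Equiv.Perm (Fin m × Fin k)) (Φ : Formula n k m) : Formula n k m :=
  fun i j => Φ (π (i, j)).1 (π (i, j)).2

lemma pm_bij {n k m : ℕ} (π : Equiv.Perm (Fin m × Fin k)) : Function.Bijective (pm (n := n) π) := by
  refine Function.bijective_iff_has_inverse.2 ⟨pm π.symm, fun Φ => ?_, fun Φ => ?_⟩ <;>
  · funext i j; simp [pm]

lemma expF_pm {n k m : ℕ} (π : Equiv.Perm (Fin m × Fin k)) (F : Formula n k m → ℝ) :
    expF n k m (fun Φ => F (pm π Φ)) = expF n k m F := by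
  unfold expF
  rw [(pm_bij π).sum_comp F]

lemma occ_pm {n k m : ℕ} (π : Equiv.Perm (Fin m × Fin k)) (Φ : Formula n k m) : occ n k m (pm π Φ) = occ n k m Φ := by
  funext l
  rw [occ_eq, occ_eq]
  refine Finset.card_bij (fun s _ => π s) ?_ ?_ ?_
  · intro s hs
    simpa [pm] using hs
  · intro a _ b _ h; exact π.injective h
  · intro s hs
    exact ⟨π.symm s, by simpa [pm] using hs, by simp⟩

def WW {n k m : ℕ} (g : Fin k → ℝ → ℝ) (e : Fin k → Fin m × Fin k) (Φ : Formula n k m) : ℝ :=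
  ∏ j, g j (pLit k (degSeq n k m Φ) (Φ (e j).1 (e j).2))

lemma exch {n k m : ℕ} (g : Fin k → ℝ → ℝ) (e e' : Fin k ↪ Fin m × Fin k) :
    expF n k m (WW g e) = expF n k m (WW g e') := by
  set ee : {x // x ∈ Set.range e'} ≃ {x // x ∈ Set.range e} := e'.toEquivRange.symm.trans e.toEquivRange with hee
  set π : Equiv.Perm (Fin m × Fin k) := ee.extendSubtype with hπ
  have h : ∀ j, π (e' j) = e j := by
    intro j
    rw [hπ, Equiv.extendSubtype_apply_of_mem _ _ ⟨j, rfl⟩]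
    have : (⟨e' j, ⟨j, rfl⟩⟩ : {x // x ∈ Set.range e'}) = e'.toEquivRange j := rfl
    rw [hee, Equiv.trans_apply, this, Equiv.symm_apply_apply]
    rfl
  rw [← expF_pm π (WW g e')]
  congr 1
  funext Φ
  unfold WW degSeq
  rw [occ_pm]
  refine Finset.prod_congr rfl fun j _ => ?_
  unfold pm
  rw [Prod.mk.eta, h]

lemma expF_CS {n k m : ℕ} (g : Fin k → ℝ → ℝ) :
    expF n k m (CS g) * ((m * k).descFactorial k : ℕ) = m * expF n k m (fun Φ => ∑ e : Fin k ↪ Fin m × Fin k, WW g e Φ) := by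
  have hc : Fintype.card (Fin k ↪ Fin m × Fin k) = (m * k).descFactorial k := by
    rw [Fintype.card_embedding_eq]; simp
  have h1 : expF n k m (CS g) = ∑ i : Fin m, expF n k m (fun Φ => ∏ j, g j (pLit k (degSeq n k m Φ) (Φ i j))) := by
    rw [← expF_sum]; rfl
  rw [h1, Finset.sum_mul]
  have h2 : ∀ i : Fin m, expF n k m (fun Φ => ∏ j, g j (pLit k (degSeq n k m Φ) (Φ i j))) * ((m * k).descFactorial k : ℕ) =
      expF n k m (fun Φ => ∑ e : Fin k ↪ Fin m × Fin k, WW g e Φ) := by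
    intro i
    set e0 : Fin k ↪ Fin m × Fin k := ⟨fun j => (i, j), fun a b h => (Prod.mk.inj h).2⟩ with he0
    rw [expF_sum, Finset.sum_congr rfl fun e _ => exch (n := n) g e e0, Finset.sum_const, Finset.card_univ, hc, nsmul_eq_mul, mul_comm]
    rfl
  rw [Finset.sum_congr rfl fun i _ => h2 i]
  simp

def SS {n k m : ℕ} (g : ℝ → ℝ) (Φ : Formula n k m) : ℝ := ∑ s : Fin m × Fin k, g (pLit k (degSeq n k m Φ) (Φ s.1 s.2))

lemma sum_all {n k m : ℕ} (g : Fin k → ℝ → ℝ) (Φ : Formula n k m) :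
    ∑ f : Fin k → Fin m × Fin k, WW g f Φ = ∏ j, SS (g j) Φ := by
  unfold WW SS
  rw [Finset.prod_univ_sum]
  simp

lemma emb_sum {n k m : ℕ} (g : Fin k → ℝ → ℝ) (hg : ∀ j t, 0 ≤ g j t ∧ g j t ≤ 1) (Φ : Formula n k m) :
    (∑ e : Fin k ↪ Fin m × Fin k, WW g e Φ ≤ ∏ j, SS (g j) Φ) ∧
    (∏ j, SS (g j) Φ - (((m * k : ℕ) : ℝ) ^ k - ((m * k).descFactorial k : ℕ)) ≤ ∑ e : Fin k ↪ Fin m × Fin k, WW g e Φ) := by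
  have h01 : ∀ f : Fin k → Fin m × Fin k, 0 ≤ WW g f Φ ∧ WW g f Φ ≤ 1 := fun f => prod_mem01 g hg _
  have e1 : ∑ e : Fin k ↪ Fin m × Fin k, WW g e Φ = ∑ f ∈ (univ.filter fun f : Fin k → Fin m × Fin k => Function.Injective f), WW g f Φ := by
    refine Finset.sum_bij (fun e _ => (e : Fin k → Fin m × Fin k)) ?_ ?_ ?_ ?_
    · intro e _; simpa using e.injective
    · intro a _ b _ h; exact DFunLike.coe_injective h
    · intro f hf; exact ⟨⟨f, (Finset.mem_filter.1 hf).2⟩, Finset.mem_univ _, rfl⟩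
    · intro e _; rfl
  have hc : (univ.filter fun f : Fin k → Fin m × Fin k => Function.Injective f).card = (m * k).descFactorial k := by
    have : Fintype.card (Fin k ↪ Fin m × Fin k) = (m * k).descFactorial k := by
      rw [Fintype.card_embedding_eq]; simp
    rw [← this, ← Finset.card_univ]
    symm
    refine Finset.card_bij (fun e _ => (e : Fin k → Fin m × Fin k)) ?_ ?_ ?_
    · intro e _; simpa using e.injective
    · intro a _ b _ h; exact DFunLike.coe_injective h
    · intro f hf; exact ⟨⟨f, (Finset.mem_filter.1 hf).2⟩, Finset.mem_univ _, rfl⟩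
  rw [e1, ← sum_all]
  have hs := Finset.sum_filter_add_sum_filter_not univ (fun f : Fin k → Fin m × Fin k => Function.Injective f) (fun f => WW g f Φ)
  have hcard := Finset.card_filter_add_card_filter_not (s := univ) (fun f : Fin k → Fin m × Fin k => Function.Injective f)
  have h3 : 0 ≤ ∑ f ∈ univ.filter (fun f : Fin k → Fin m × Fin k => ¬ Function.Injective f), WW g f Φ :=
    Finset.sum_nonneg fun f _ => (h01 f).1
  have h4 : ∑ f ∈ univ.filter (fun f : Fin k → Fin m × Fin k => ¬ Function.Injective f), WW g f Φ ≤
      ((univ.filter (fun f : Fin k → Fin m × Fin k => ¬ Function.Injective f)).card : ℝ) := by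
    calc _ ≤ ∑ f ∈ univ.filter (fun f : Fin k → Fin m × Fin k => ¬ Function.Injective f), (1:ℝ) :=
          Finset.sum_le_sum fun f _ => (h01 f).2
      _ = _ := by simp
  have h5 : ((univ.filter (fun f : Fin k → Fin m × Fin k => Function.Injective f)).card : ℝ) +
      ((univ.filter (fun f : Fin k → Fin m × Fin k => ¬ Function.Injective f)).card : ℝ) = ((m * k : ℕ):ℝ) ^ k := by
    have : Fintype.card (Fin k → Fin m × Fin k) = (m * k) ^ k := by simp
    rw [Finset.card_univ, this] at hcard
    exact_mod_cast hcard
  rw [hc] at h5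
  constructor
  · linarith
  · linarith
end

section
/-! Part D5: concentration of clause statistics -/

def rat (k : ℕ) (r : ℝ) (n : ℕ) : ℝ := ((⌊r * n⌋₊ * k : ℕ) : ℝ) ^ k / ((⌊r * n⌋₊ * k).descFactorial k : ℕ)

lemma rat_tendsto {k : ℕ} (hk : 1 ≤ k) {r : ℝ} (hr : 1 ≤ r) : Tendsto (rat k r) atTop (nhds 1) := by
  have h0 : Tendsto (fun n : ℕ => ⌊r * n⌋₊ * k) atTop atTop :=
    tendsto_atTop_mono (fun n => slots_ge hk hr n) tendsto_id
  have h1 : ∀ᶠ N : ℕ in atTop, ((N.descFactorial k : ℕ) : ℝ) ≠ 0 := by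
    filter_upwards [eventually_ge_atTop k] with N hN
    have := Nat.descFactorial_pos.2 hN
    positivity
  have h2 := (Asymptotics.isEquivalent_iff_tendsto_one h1).1 (isEquivalent_descFactorial k).symm
  exact h2.comp h0

lemma desc_pos {k : ℕ} (hk : 1 ≤ k) {r : ℝ} (hr : 1 ≤ r) {n : ℕ} (hn : k ≤ n) :
    (0:ℝ) < ((⌊r * n⌋₊ * k).descFactorial k : ℕ) := by
  have := Nat.descFactorial_pos.2 (hn.trans (slots_ge hk hr n))
  exact_mod_cast this

lemma SS_mem {n k m : ℕ} (g : ℝ → ℝ) (hg : ∀ t, 0 ≤ g t ∧ g t ≤ 1) (Φ : Formula n k m) : 0 ≤ SS g Φ ∧ SS g Φ ≤ ((m * k : ℕ):ℝ) := by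
  constructor
  · exact Finset.sum_nonneg fun s _ => (hg _).1
  · calc SS g Φ ≤ ∑ s : Fin m × Fin k, (1:ℝ) := Finset.sum_le_sum fun s _ => (hg _).2
      _ = _ := by simp

lemma floor_le_mul {r : ℝ} (hr : 0 ≤ r) (n : ℕ) : ((⌊r * n⌋₊ : ℕ) : ℝ) ≤ r * n := Nat.floor_le (by positivity)
lemma le_floor_mul {r : ℝ} (hr : 1 ≤ r) (n : ℕ) : (n : ℝ) ≤ ((⌊r * n⌋₊ : ℕ) : ℝ) := by
  have : n ≤ ⌊r * (n:ℝ)⌋₊ := by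
    apply Nat.le_floor
    have : (0:ℝ) ≤ n := by positivity
    nlinarith
  exact_mod_cast this

lemma CS_upper {k : ℕ} (hk : 1 ≤ k) {r : ℝ} (hr : 1 ≤ r) (g : ℝ → ℝ) (hg : ∀ t, 0 ≤ g t ∧ g t ≤ 1) (β : ℝ) (hβ : 0 ≤ β)
    (h : WHP k r (fun n Φ => SS g Φ ≤ β * (⌊r * n⌋₊ * k : ℕ))) (ε : ℝ) (hε : 0 < ε) :
    WHP k r (fun n Φ => CS (fun _ => g) Φ ≤ ⌊r * n⌋₊ * β ^ k + ε * n) := by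
  have hr0 : 0 ≤ r := by linarith
  have hlim : Tendsto (fun n => rat k r n * (β ^ k + prF n k ⌊r * n⌋₊ (fun Φ => ¬ SS g Φ ≤ β * (⌊r * n⌋₊ * k : ℕ)))) atTop (nhds (β ^ k)) := by
    have := (rat_tendsto hk hr).mul (tendsto_const_nhds (x := β ^ k) |>.add h)
    simpa using this
  have hev := hlim.eventually (gt_mem_nhds (show β ^ k < β ^ k + ε / (2 * r) by
    have : 0 < ε / (2 * r) := by positivity
    linarith))
  have hc := conc (k := k) hr0 (fun n Φ => CS (fun _ => g) Φ) 1 (fun n Φ s a => CS_lip _ (fun _ => hg) Φ s a) (ε / 2) (by positivity)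
  refine hc.mono ?_
  filter_upwards [hev, eventually_ge_atTop k] with n h1 hn Φ h2
  have hn1 : 1 ≤ n := hk.trans hn
  have hD := desc_pos hk hr hn
  have key : expF n k ⌊r * n⌋₊ (CS (fun _ => g)) ≤ ⌊r * n⌋₊ * (rat k r n * (β ^ k + prF n k ⌊r * n⌋₊ (fun Φ => ¬ SS g Φ ≤ β * (⌊r * n⌋₊ * k : ℕ)))) := by
    have e1 := expF_CS (n := n) (m := ⌊r * n⌋₊) (fun _ : Fin k => g)
    have e2 : expF n k ⌊r * n⌋₊ (fun Φ => ∑ e : Fin k ↪ Fin ⌊r * n⌋₊ × Fin k, WW (fun _ => g) e Φ) ≤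
        ((⌊r * n⌋₊ * k : ℕ) : ℝ) ^ k * (β ^ k + prF n k ⌊r * n⌋₊ (fun Φ => ¬ SS g Φ ≤ β * (⌊r * n⌋₊ * k : ℕ))) := by
      rw [prF_eq, mul_add, ← expF_mul, ← expF_const (k := k) (m := ⌊r * n⌋₊) hn1 (((⌊r * n⌋₊ * k : ℕ) : ℝ) ^ k * β ^ k), ← expF_add]
      refine expF_mono fun Φ => ((emb_sum _ (fun _ => hg) Φ).1).trans ?_
      simp only [Finset.prod_const, Finset.card_univ, Fintype.card_fin]
      obtain ⟨s0, s1⟩ := SS_mem g hg Φ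
      by_cases hS : SS g Φ ≤ β * (⌊r * n⌋₊ * k : ℕ)
      · rw [if_neg (not_not.2 hS), mul_zero, add_zero, ← mul_pow]
        refine pow_le_pow_left₀ s0 ?_ _
        linarith
      · rw [if_pos hS, mul_one]
        have := pow_le_pow_left₀ s0 s1 k
        have : 0 ≤ ((⌊r * n⌋₊ * k : ℕ) : ℝ) ^ k * β ^ k := by positivity
        linarith
    have e3 : expF n k ⌊r * n⌋₊ (CS (fun _ => g)) = ⌊r * n⌋₊ * (expF n k ⌊r * n⌋₊ (fun Φ => ∑ e : Fin k ↪ Fin ⌊r * n⌋₊ × Fin k, WW (fun _ => g) e Φ) / ((⌊r * n⌋₊ * k).descFactorial k : ℕ)) := by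
      rw [← mul_div_assoc, ← e1]; field_simp
    rw [e3]
    refine mul_le_mul_of_nonneg_left ?_ (by positivity)
    rw [rat, div_mul_eq_mul_div]
    exact div_le_div_of_nonneg_right e2 hD.le
  have h3 := (abs_lt.1 h2).2
  have h4 := floor_le_mul hr0 n
  have h5 : (⌊r * n⌋₊ : ℝ) * (rat k r n * (β ^ k + prF n k ⌊r * n⌋₊ (fun Φ => ¬ SS g Φ ≤ β * (⌊r * n⌋₊ * k : ℕ)))) ≤ ⌊r * n⌋₊ * (β ^ k + ε / (2 * r)) :=
    mul_le_mul_of_nonneg_left h1.le (by positivity)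
  have h6 : (⌊r * n⌋₊ : ℝ) * (ε / (2 * r)) ≤ r * n * (ε / (2 * r)) := mul_le_mul_of_nonneg_right h4 (by positivity)
  have h7 : r * n * (ε / (2 * r)) = ε / 2 * n := by field_simp
  rw [mul_add] at h5
  have h8 : CS (fun _ => g) Φ - expF n k ⌊r * n⌋₊ (CS (fun _ => g)) < ε / 2 * n := h3
  linarith

lemma CS_lower {k : ℕ} (hk : 1 ≤ k) {r : ℝ} (hr : 1 ≤ r) (g : Fin k → ℝ → ℝ) (hg : ∀ j t, 0 ≤ g j t ∧ g j t ≤ 1) (γ : ℝ) (hγ : 0 < γ)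
    (h : ∀ j, WHP k r (fun n Φ => γ * (⌊r * n⌋₊ * k : ℕ) ≤ SS (g j) Φ)) :
    WHP k r (fun n Φ => γ ^ k / 8 * ⌊r * n⌋₊ ≤ CS g Φ) := by
  have hr0 : 0 ≤ r := by linarith
  have hγk : 0 < γ ^ k := by positivity
  have hall := WHP.forall_mem (univ : Finset (Fin k)) (fun j _ => h j)
  set bad : ℕ → ℝ := fun n => prF n k ⌊r * n⌋₊ (fun Φ => ¬ ∀ j ∈ (univ : Finset (Fin k)), γ * (⌊r * n⌋₊ * k : ℕ) ≤ SS (g j) Φ) with hbad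
  have hlim : Tendsto (fun n => rat k r n * (γ ^ k * (1 - bad n)) - (rat k r n - 1)) atTop (nhds (γ ^ k)) := by
    have hall' : Tendsto bad atTop (nhds 0) := hall
    clear_value bad
    have := ((rat_tendsto hk hr).mul (((tendsto_const_nhds (x := (1:ℝ))).sub hall').const_mul (γ ^ k))).sub ((rat_tendsto hk hr).sub_const 1)
    simpa using this
  have hev := hlim.eventually (lt_mem_nhds (show γ ^ k / 2 < γ ^ k by linarith))
  have hc := conc (k := k) hr0 (fun n Φ => CS g Φ) 1 (fun n Φ s a => CS_lip _ hg Φ s a) (γ ^ k / 8) (by positivity)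
  refine hc.mono ?_
  filter_upwards [hev, eventually_ge_atTop k] with n h1 hn Φ h2
  have hn1 : 1 ≤ n := hk.trans hn
  have hD := desc_pos hk hr hn
  have key : ⌊r * n⌋₊ * (rat k r n * (γ ^ k * (1 - bad n)) - (rat k r n - 1)) ≤ expF n k ⌊r * n⌋₊ (CS g) := by
    have e1 := expF_CS (n := n) (m := ⌊r * n⌋₊) g
    have e2 : ((⌊r * n⌋₊ * k : ℕ) : ℝ) ^ k * (γ ^ k * (1 - bad n)) - (((⌊r * n⌋₊ * k : ℕ) : ℝ) ^ k - ((⌊r * n⌋₊ * k).descFactorial k : ℕ)) ≤ expF n k ⌊r * n⌋₊ (fun Φ => ∑ e : Fin k ↪ Fin ⌊r * n⌋₊ × Fin k, WW g e Φ) := by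
      have e0 : 1 - bad n = prF n k ⌊r * n⌋₊ (fun Φ => ∀ j ∈ (univ : Finset (Fin k)), γ * (⌊r * n⌋₊ * k : ℕ) ≤ SS (g j) Φ) := by
        rw [hbad]; simp only []; rw [prF_not hn1]; ring
      rw [e0, prF_eq, ← expF_mul, ← expF_mul,
        ← expF_const (k := k) (m := ⌊r * n⌋₊) hn1 (((⌊r * n⌋₊ * k : ℕ) : ℝ) ^ k - ((⌊r * n⌋₊ * k).descFactorial k : ℕ)), ← expF_sub]
      refine expF_mono fun Φ => le_trans ?_ ((emb_sum _ hg Φ).2)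
      refine sub_le_sub_right ?_ _
      split_ifs with hS
      · rw [mul_one, ← mul_pow]
        calc _ = ∏ j : Fin k, (((⌊r * n⌋₊ * k : ℕ) : ℝ) * γ) := by simp
          _ ≤ _ := Finset.prod_le_prod (fun j _ => by positivity) (fun j hj => by linarith [hS j hj])
      · rw [mul_zero, mul_zero]
        exact Finset.prod_nonneg fun j _ => (SS_mem _ (hg j) Φ).1
    have e3 : expF n k ⌊r * n⌋₊ (CS g) = ⌊r * n⌋₊ * (expF n k ⌊r * n⌋₊ (fun Φ => ∑ e : Fin k ↪ Fin ⌊r * n⌋₊ × Fin k, WW g e Φ) / ((⌊r * n⌋₊ * k).descFactorial k : ℕ)) := by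
      rw [← mul_div_assoc, ← e1]; field_simp
    rw [e3]
    refine mul_le_mul_of_nonneg_left ?_ (by positivity)
    rw [le_div_iff₀ hD]
    refine le_trans (le_of_eq ?_) e2
    rw [rat]; field_simp
  have h3 := (abs_lt.1 h2).1
  have h4 := le_floor_mul hr n
  have h5 : (⌊r * n⌋₊ : ℝ) * (γ ^ k / 2) ≤ _ := mul_le_mul_of_nonneg_left h1.le (by positivity)
  have h6 : γ ^ k / 8 * (n:ℝ) ≤ γ ^ k / 8 * ⌊r * n⌋₊ := mul_le_mul_of_nonneg_left h4 (by positivity)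
  have h8 : -(γ ^ k / 8 * n) < CS g Φ - expF n k ⌊r * n⌋₊ (CS g) := h3
  have h9 : 0 ≤ γ ^ k / 8 * (⌊r * n⌋₊:ℝ) := by positivity
  have h10 := h5.trans key
  linarith

/-! ### lower bounds on the type counts -/

lemma SS_ind {n k m : ℕ} (t : ℝ) (Φ : Formula n k m) : SS (fun u => if u = t then 1 else 0) Φ = Dt k (degSeq n k m Φ) t := by
  unfold SS Dt
  rw [occ_sum Φ (fun l => if pLit k (degSeq n k m Φ) l = t then (1:ℝ) else 0)]
  refine Finset.sum_congr rfl fun l _ => ?_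
  split_ifs
  · rw [mul_one]; rfl
  · rw [mul_zero]

lemma Dt_ge {n : ℕ} (k : ℕ) (d : Lit n → ℕ) (u : ℤ) (hu : |u| ≤ bb k) (a b : ℕ) (ha : 1 ≤ a) (hab : (a:ℤ) - b = u) :
    (Nab d (a, b) : ℝ) ≤ Dt k d (tt k u) := by
  unfold Dt Nab
  rw [Fintype.sum_prod_type, Finset.card_filter]
  push_cast
  refine Finset.sum_le_sum fun x _ => ?_
  rw [Fintype.sum_bool]
  have h0 : (0:ℝ) ≤ if pLit k d (x, false) = tt k u then (d (x, false) : ℝ) else 0 := by split_ifs <;> positivity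
  have h1 : (0:ℝ) ≤ if pLit k d (x, true) = tt k u then (d (x, true) : ℝ) else 0 := by split_ifs <;> positivity
  by_cases h : (d (x, true), d (x, false)) = (a, b)
  · rw [if_pos h]
    have e1 := (Prod.mk.inj h).1
    have e2 := (Prod.mk.inj h).2
    have : pLit k d (x, true) = tt k u := by
      rw [pLit_eq]
      have : zl d (x, true) = u := by
        unfold zl; simp only [Bool.not_true]; rw [e1, e2, hab]
      rw [this, fz_self hu]
    rw [if_pos this, e1]
    have : (1:ℝ) ≤ a := by exact_mod_cast ha
    linarith
  · rw [if_neg h]; linarith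

lemma whp_SS_ind {k : ℕ} (hk : 1 ≤ k) {r : ℝ} (hr : 1 ≤ r) (t : ℝ) (ht : t ∈ TT k) :
    ∃ γ : ℝ, 0 < γ ∧ WHP k r (fun n Φ => γ * (⌊r * n⌋₊ * k : ℕ) ≤ SS (fun u => if u = t then 1 else 0) Φ) := by
  obtain ⟨u, hu, rfl⟩ := Finset.mem_image.1 ht
  have hu' : |u| ≤ bb k := abs_le.2 (Finset.mem_Icc.1 hu)
  obtain ⟨a, b, ha, hab⟩ : ∃ a b : ℕ, 1 ≤ a ∧ (a:ℤ) - b = u :=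
    ⟨u.toNat + 1, (-u).toNat + 1, by omega, by omega⟩
  obtain ⟨γ, hγ, hW⟩ := whp_Nab hk hr (a, b)
  have hk0 : (0:ℝ) < k := by exact_mod_cast hk
  refine ⟨γ / (r * k), by positivity, hW.mono (Eventually.of_forall fun n Φ h => ?_)⟩
  rw [SS_ind]
  refine le_trans ?_ (h.trans (Dt_ge k _ u hu' a b ha hab))
  have := slots_le (k := k) (r := r) (by linarith) n
  calc γ / (r * k) * ((⌊r * n⌋₊ * k : ℕ) : ℝ) ≤ γ / (r * k) * ((r * k) * n) := by gcongr
    _ = γ * n := by field_simp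

lemma CS_ind {n k m : ℕ} (l : Fin k → ℝ) (Φ : Formula n k m) : CS (fun j u => if u = l j then 1 else 0) Φ = typeCounts n k m Φ l := by
  unfold CS typeCounts mCount
  rw [Finset.card_filter]
  push_cast
  refine Finset.sum_congr rfl fun i _ => ?_
  by_cases h : clauseType k (degSeq n k m Φ) (Φ i) = l
  · rw [if_pos h]
    exact Finset.prod_eq_one fun j _ => if_pos (congrFun h j)
  · rw [if_neg h]
    obtain ⟨j, hj⟩ := Function.ne_iff.1 h
    exact Finset.prod_eq_zero (Finset.mem_univ j) (if_neg hj)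

lemma whp_types {k : ℕ} (hk : 1 ≤ k) {r : ℝ} (hr : 1 ≤ r) :
    ∃ γ : ℝ, 0 < γ ∧ WHP k r (fun n Φ => ∀ l ∈ LL k, γ * ⌊r * n⌋₊ ≤ typeCounts n k ⌊r * n⌋₊ Φ l) := by
  choose! γ hγ hW using whp_SS_ind hk hr
  have hne : (TT k).Nonempty := ⟨tt k 0, tt_mem (by simp)⟩
  obtain ⟨t0, ht0, hmin⟩ := Finset.exists_min_image (TT k) γ hne
  refine ⟨γ t0 ^ k / 8, by have := hγ t0 ht0; positivity, WHP.forall_mem _ fun l hl => ?_⟩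
  have := CS_lower hk hr (fun j u => if u = l j then 1 else 0) (fun j t => by split_ifs <;> norm_num) (γ t0) (hγ t0 ht0)
    (fun j => (hW (l j) (Fintype.mem_piFinset.1 hl j)).mono (Eventually.of_forall fun n Φ h => le_trans (by
      have := hmin (l j) (Fintype.mem_piFinset.1 hl j)
      gcongr) h))
  refine this.mono (Eventually.of_forall fun n Φ h => ?_)
  rwa [CS_ind] at h

lemma whp_NabKK {k : ℕ} (hk : 1 ≤ k) {r : ℝ} (hr : 1 ≤ r) :
    ∃ γ : ℝ, 0 < γ ∧ WHP k r (fun n Φ => ∀ q ∈ KK k, γ * n ≤ Nab (degSeq n k ⌊r * n⌋₊ Φ) q) := by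
  choose γ hγ hW using whp_Nab hk hr
  have hne : (KK k).Nonempty := ⟨(1, 0), by
    unfold KK
    exact Finset.mem_union_left _ (Finset.mem_image.2 ⟨1, by simp, rfl⟩)⟩
  obtain ⟨t0, ht0, hmin⟩ := Finset.exists_min_image (KK k) γ hne
  refine ⟨γ t0, hγ t0, WHP.forall_mem _ fun q hq => (hW q).mono (Eventually.of_forall fun n Φ h => le_trans ?_ h)⟩
  have := hmin q hq
  gcongr
end

section
/-! Part D6: lower bound on the conditional expectation of `Zp` -/

lemma log_one_add_le4 (w : ℝ) (hw : |w| ≤ 1 / 2) : Real.log (1 + w) ≤ w - w ^ 2 / 2 + w ^ 3 / 3 + 2 * w ^ 4 := by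
  have h := Real.abs_log_sub_add_sum_range_le (x := -w) (by rw [abs_neg]; linarith) 3
  rw [abs_neg, sub_neg_eq_add] at h
  have h1 := (abs_le.1 h).2
  have h2 : |w| ^ (3 + 1) / (1 - |w|) ≤ 2 * w ^ 4 := by
    rw [div_le_iff₀ (by linarith)]
    have : |w| ^ (3 + 1) = w ^ 4 := by
      rw [show 3 + 1 = 4 from rfl]
      exact Even.pow_abs (by decide) w
    rw [this]
    have : 0 ≤ w ^ 4 := by positivity
    nlinarith
  simp [Finset.sum_range_succ] at h1
  ring_nf at h1 h2 ⊢
  linarith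

lemma binEntropy_ge (w : ℝ) (hw : |w| ≤ 1 / 2) : Real.log 2 - w ^ 2 / 2 - 5 / 2 * w ^ 4 ≤ Real.binEntropy (1 / 2 + w / 2) := by
  have hw' := abs_le.1 hw
  have h1 := log_one_add_le4 w hw
  have h2 := log_one_add_le4 (-w) (by rwa [abs_neg])
  unfold Real.binEntropy
  rw [Real.log_inv, Real.log_inv]
  have e1 : (1:ℝ) / 2 + w / 2 = (1 + w) / 2 := by ring
  have e2 : 1 - (1 + w) / 2 = (1 + -w) / 2 := by ring
  rw [e1, e2, Real.log_div (by linarith) (by norm_num), Real.log_div (by linarith) (by norm_num)]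
  have h3 := mul_le_mul_of_nonneg_left h1 (show 0 ≤ (1 + w) / 2 by linarith)
  have h4 := mul_le_mul_of_nonneg_left h2 (show 0 ≤ (1 + -w) / 2 by linarith)
  have h5 : 0 ≤ w ^ 4 := by positivity
  nlinarith

lemma sum_entropy {n k m : ℕ} (hk : 10 ^ 4 ≤ k) (hb : (bb k : ℝ) / 2 ^ k ≤ 1 / (k:ℝ) ^ 4) (Φ : Formula n k m) :
    n * Real.log 2 - AA k Φ / 4 ^ k / 2 * (1 + 5 / (k:ℝ) ^ 8) ≤ ∑ x, Real.binEntropy (pLit k (degSeq n k m Φ) (x, true)) := by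
  have hK : (10 ^ 4 : ℝ) ≤ k := by exact_mod_cast hk
  have hk0 : (0:ℝ) < k := by linarith
  have hk4 : 1 / (k:ℝ) ^ 4 ≤ 1 / 2 := by
    apply one_div_le_one_div_of_le (by norm_num)
    calc (2:ℝ) ≤ k := by linarith
      _ = k ^ 1 := (pow_one _).symm
      _ ≤ k ^ 4 := pow_le_pow_right₀ (by linarith) (by norm_num)
  have e : n * Real.log 2 - AA k Φ / 4 ^ k / 2 * (1 + 5 / (k:ℝ) ^ 8) =
      ∑ x : Fin n, (Real.log 2 - ((fz k (zv Φ x) : ℤ) : ℝ) ^ 2 / 4 ^ k / 2 * (1 + 5 / (k:ℝ) ^ 8)) := by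
    rw [Finset.sum_sub_distrib, ← Finset.sum_mul, ← Finset.sum_div, ← Finset.sum_div]
    unfold AA; simp
  rw [e]
  refine Finset.sum_le_sum fun x _ => ?_
  have e2 : pLit k (degSeq n k m Φ) (x, true) = 1 / 2 + (((fz k (zv Φ x) : ℤ) : ℝ) / 2 ^ k) / 2 := by
    rw [pLit_eq]
    unfold tt
    have : zl (degSeq n k m Φ) (x, true) = zv Φ x := rfl
    rw [this, pow_succ, div_div]
  rw [e2]
  have hf := Finset.mem_Icc.1 (fz_mem k (zv Φ x))
  have hf' : |((fz k (zv Φ x) : ℤ) : ℝ)| ≤ bb k := by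
    rw [abs_le]; exact ⟨by exact_mod_cast hf.1, by exact_mod_cast hf.2⟩
  generalize ((fz k (zv Φ x) : ℤ) : ℝ) = f at hf' ⊢
  have h2 : (0:ℝ) < 2 ^ k := by positivity
  have hw : |f / 2 ^ k| ≤ 1 / (k:ℝ) ^ 4 := by
    rw [abs_div, abs_of_pos h2]
    exact (div_le_div_of_nonneg_right hf' h2.le).trans hb
  have hE := binEntropy_ge (f / 2 ^ k) (hw.trans hk4)
  have e3 : f ^ 2 / 4 ^ k = (f / 2 ^ k) ^ 2 := by
    rw [div_pow, ← pow_mul, mul_comm k 2, pow_mul]; norm_num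
  rw [e3]
  generalize f / 2 ^ k = w at hw hE ⊢
  have h6 : w ^ 2 ≤ 1 / (k:ℝ) ^ 8 := by
    have := pow_le_pow_left₀ (abs_nonneg w) hw 2
    rw [sq_abs, div_pow, ← pow_mul] at this
    simpa using this
  have h7 : w ^ 4 ≤ w ^ 2 * (1 / (k:ℝ) ^ 8) := by
    have := mul_le_mul_of_nonneg_left h6 (sq_nonneg w)
    nlinarith
  have e5 : w ^ 2 / 2 * (1 + 5 / (k:ℝ) ^ 8) = w ^ 2 / 2 + 5 / 2 * (w ^ 2 * (1 / (k:ℝ) ^ 8)) := by ring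
  rw [e5]
  linarith

def gc (t : ℝ) : ℝ := max 0 (min 1 (1 - t))
lemma gc_mem (t : ℝ) : 0 ≤ gc t ∧ gc t ≤ 1 := ⟨le_max_left _ _, max_le zero_le_one (min_le_left _ _)⟩
lemma gc_eq {t : ℝ} (h0 : 0 ≤ t) (h1 : t ≤ 1) : gc t = 1 - t := by
  unfold gc; rw [min_eq_right (by linarith), max_eq_right (by linarith)]

lemma pLit_01 {n k : ℕ} (hk : 10 ^ 4 ≤ k) (hb : (bb k : ℝ) / 2 ^ k ≤ 1 / (k:ℝ) ^ 4) (d : Lit n → ℕ) (l : Lit n) :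
    0 ≤ pLit k d l ∧ pLit k d l ≤ 1 := by
  have hK : (10 ^ 4 : ℝ) ≤ k := by exact_mod_cast hk
  have hk4 : 1 / (k:ℝ) ^ 4 ≤ 1 / 2 := by
    apply one_div_le_one_div_of_le (by norm_num)
    calc (2:ℝ) ≤ k := by linarith
      _ = k ^ 1 := (pow_one _).symm
      _ ≤ k ^ 4 := pow_le_pow_right₀ (by linarith) (by norm_num)
  rw [pLit_eq]
  unfold tt
  have hf := Finset.mem_Icc.1 (fz_mem k (zl d l))
  have hf' : |((fz k (zl d l) : ℤ) : ℝ)| ≤ bb k := by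
    rw [abs_le]; exact ⟨by exact_mod_cast hf.1, by exact_mod_cast hf.2⟩
  generalize ((fz k (zl d l) : ℤ) : ℝ) = f at hf' ⊢
  have h2 : (0:ℝ) < 2 ^ k := by positivity
  have hw : |f / 2 ^ k| ≤ 1 / 2 := by
    rw [abs_div, abs_of_pos h2]
    exact ((div_le_div_of_nonneg_right hf' h2.le).trans hb).trans hk4
  rw [pow_succ, ← div_div]
  have := abs_le.1 hw
  constructor <;> linarith

lemma SS_gc {n k m : ℕ} (hk : 10 ^ 4 ≤ k) (hb : (bb k : ℝ) / 2 ^ k ≤ 1 / (k:ℝ) ^ 4) (Φ : Formula n k m) :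
    SS gc Φ = ((m * k : ℕ) : ℝ) / 2 - AA k Φ / 2 ^ (k + 1) := by
  have e1 : SS gc Φ = ∑ s : Fin m × Fin k, ((1:ℝ) / 2 - ((fz k (zl (degSeq n k m Φ) (Φ s.1 s.2)) : ℤ) : ℝ) / 2 ^ (k + 1)) := by
    unfold SS
    refine Finset.sum_congr rfl fun s _ => ?_
    have := pLit_01 hk hb (degSeq n k m Φ) (Φ s.1 s.2)
    rw [gc_eq this.1 this.2, pLit_eq, tt]; ring
  rw [e1, Finset.sum_sub_distrib, ← Finset.sum_div, ← Finset.sum_div]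
  congr 1
  · simp
  · congr 1
    rw [occ_sum Φ (fun l => ((fz k (zl (degSeq n k m Φ) l) : ℤ) : ℝ)), Fintype.sum_prod_type]
    unfold AA
    refine Finset.sum_congr rfl fun x _ => ?_
    rw [Fintype.sum_bool]
    have a1 : zl (degSeq n k m Φ) (x, true) = zv Φ x := rfl
    have a2 : zl (degSeq n k m Φ) (x, false) = - zv Φ x := by
      unfold zl zv degSeq; simp
    rw [a1, a2, fz_neg]
    have a3 : ((zv Φ x : ℤ) : ℝ) = (occ n k m Φ (x, true) : ℝ) - occ n k m Φ (x, false) := by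
      unfold zv; push_cast; ring
    have a4 : ((fz k (zv Φ x) : ℤ) : ℝ) ^ 2 = ((zv Φ x : ℤ) : ℝ) * ((fz k (zv Φ x) : ℤ) : ℝ) := by
      unfold fz; split_ifs
      · ring
      · simp
    rw [a4, a3]; push_cast; ring

lemma CS_gc {n k m : ℕ} (hk : 10 ^ 4 ≤ k) (hb : (bb k : ℝ) / 2 ^ k ≤ 1 / (k:ℝ) ^ 4) (Φ : Formula n k m) :
    CS (fun _ => gc) Φ = ∑ i, pi0 (clauseType k (degSeq n k m Φ) (Φ i)) := by
  unfold CS pi0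
  refine Finset.sum_congr rfl fun i _ => Finset.prod_congr rfl fun j _ => ?_
  have := pLit_01 hk hb (degSeq n k m Φ) (Φ i j)
  exact gc_eq this.1 this.2

def bet (k : ℕ) : ℝ := 1 / 2 * (1 - (1 - 1 / (k:ℝ) ^ 3) / 2 ^ k)

lemma whp_SS_gc {k : ℕ} (hk : 10 ^ 4 ≤ k) (h2k : (k:ℝ) ^ 8 ≤ 2 ^ k) (hb : (bb k : ℝ) / 2 ^ k ≤ 1 / (k:ℝ) ^ 4) {r : ℝ}
    (hr1 : 1 ≤ r) (hrl : (2:ℝ) ^ k / 2 ≤ r) (hru : r ≤ 2 ^ k * Real.log 2) :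
    WHP k r (fun n Φ => SS gc Φ ≤ bet k * (⌊r * n⌋₊ * k : ℕ)) := by
  have hK : (10 ^ 4 : ℝ) ≤ k := by exact_mod_cast hk
  have hk0 : (0:ℝ) < k := by linarith
  refine (whp_AA hk (by linarith) hru 1 one_pos).mono ?_
  filter_upwards [eventually_ge_atTop 1] with n hn Φ h
  have hn1 : (1:ℝ) ≤ n := by exact_mod_cast hn
  rw [SS_gc hk hb]
  have hA := h.1
  have hm : (n:ℝ) * (2 ^ k / 4) ≤ (⌊r * n⌋₊ : ℝ) := by
    have := (Nat.lt_floor_add_one (r * (n:ℝ))).le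
    have h3 : (2:ℝ) ^ k / 2 * n ≤ r * n := by gcongr
    have h8 : (1:ℝ) ≤ 2 ^ k / 4 := by
      have : (10^4:ℝ) ^ 8 ≤ k ^ 8 := pow_le_pow_left₀ (by norm_num) hK 8
      norm_num at this ⊢
      linarith
    nlinarith
  have hc : (n:ℝ) * (2 ^ k / (k:ℝ) ^ 5) + 1 * n ≤ (⌊r * n⌋₊ * k : ℕ) * (1 / (k:ℝ) ^ 3) := by
    have e1 : ((⌊r * n⌋₊ * k : ℕ) : ℝ) * (1 / (k:ℝ) ^ 3) = (⌊r * n⌋₊ : ℝ) / k ^ 2 := by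
      push_cast; field_simp
    rw [e1]
    have h1 : (n:ℝ) * (2 ^ k / 4) / k ^ 2 ≤ (⌊r * n⌋₊ : ℝ) / k ^ 2 := div_le_div_of_nonneg_right hm (by positivity)
    refine le_trans ?_ h1
    have h5 : (1:ℝ) ≤ 2 ^ k / k ^ 5 := by
      rw [le_div_iff₀ (by positivity), one_mul]
      exact (pow_le_pow_right₀ (by linarith) (by norm_num)).trans h2k
    have h6 : 2 * (2 ^ k / (k:ℝ) ^ 5) ≤ 2 ^ k / 4 / k ^ 2 := by
      rw [div_div, ← mul_div_assoc, div_le_div_iff₀ (by positivity) (by positivity)]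
      have h7 : 8 ≤ (k:ℝ) ^ 3 := by
        have : (10^4:ℝ) ^ 3 ≤ k ^ 3 := pow_le_pow_left₀ (by norm_num) hK 3
        norm_num at this ⊢
        linarith
      have h8 : 0 ≤ (2:ℝ) ^ k * k ^ 2 := by positivity
      nlinarith only [h7, h8, mul_le_mul_of_nonneg_left h7 h8]
    have h9 : (n:ℝ) * (2 ^ k / 4) / k ^ 2 = n * (2 ^ k / 4 / k ^ 2) := by ring
    rw [h9]
    have h10 : (n:ℝ) * (2 * (2 ^ k / (k:ℝ) ^ 5)) ≤ n * (2 ^ k / 4 / k ^ 2) := by gcongr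
    have h11 : (n:ℝ) * 1 ≤ n * (2 ^ k / (k:ℝ) ^ 5) := by gcongr
    linarith
  have hA2 : ((⌊r * n⌋₊ * k : ℕ) : ℝ) * (1 - 1 / (k:ℝ) ^ 3) ≤ AA k Φ := by linarith
  have h12 := div_le_div_of_nonneg_right hA2 (show (0:ℝ) ≤ 2 ^ (k + 1) by positivity)
  have e : bet k * ((⌊r * n⌋₊ * k : ℕ) : ℝ) = ((⌊r * n⌋₊ * k : ℕ) : ℝ) / 2 - ((⌊r * n⌋₊ * k : ℕ) : ℝ) * (1 - 1 / (k:ℝ) ^ 3) / 2 ^ (k + 1) := by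
    unfold bet; rw [pow_succ]; ring
  rw [e]; linarith

lemma bet_pow {k : ℕ} (hk : 10 ^ 4 ≤ k) (h2k : (k:ℝ) ^ 8 ≤ 2 ^ k) :
    0 ≤ bet k ∧ bet k ^ k ≤ 1 / 2 ^ k - 1 / 4 ^ k * (k - 1 / (k:ℝ) ^ 2 - 1 / (k:ℝ) ^ 6) := by
  have hK : (10 ^ 4 : ℝ) ≤ k := by exact_mod_cast hk
  have hk0 : (0:ℝ) < k := by linarith
  have hc3 : 1 / (k:ℝ) ^ 3 ≤ 1 := by
    rw [div_le_one (by positivity)]; exact one_le_pow₀ (by linarith)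
  have hq : (1:ℝ) ≤ 2 ^ k := one_le_pow₀ (by norm_num)
  have hc0 : 0 < 1 / (k:ℝ) ^ 3 := by positivity
  set y : ℝ := (1 - 1 / (k:ℝ) ^ 3) / 2 ^ k with hy
  have y0 : 0 ≤ y := div_nonneg (by linarith) (by positivity)
  have y1 : y ≤ 1 / 2 ^ k := div_le_div_of_nonneg_right (by linarith) (by positivity)
  have hky : (k:ℝ) / 2 ^ k ≤ 1 := by
    rw [div_le_one (by positivity)]
    exact le_trans (by nth_rw 1 [← pow_one (k:ℝ)]; exact pow_le_pow_right₀ (by linarith) (by norm_num)) h2k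
  have y2 : y ≤ 1 := y1.trans (by rw [div_le_one (by positivity)]; exact hq)
  have ky : (k:ℝ) * y ≤ k / 2 ^ k := by
    calc (k:ℝ) * y ≤ k * (1 / 2 ^ k) := by gcongr
      _ = _ := by ring
  have ky0 : 0 ≤ (k:ℝ) * y := by positivity
  refine ⟨by unfold bet; rw [← hy]; linarith, ?_⟩
  have h1 : (1 - y) ^ k ≤ 1 - k * y + (k * y) ^ 2 := by
    have := pow_le_pow_left₀ (by linarith) (Real.one_sub_le_exp_neg y) k
    rw [← Real.exp_nat_mul] at this
    refine this.trans ?_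
    have h := (abs_le.1 (Real.abs_exp_sub_one_sub_id_le (x := k * -y) (by
      rw [mul_neg, abs_neg, abs_of_nonneg ky0]; linarith))).2
    nlinarith
  have h2 : ((k:ℝ) * y) ^ 2 ≤ 1 / 2 ^ k * (1 / (k:ℝ) ^ 6) := by
    calc ((k:ℝ) * y) ^ 2 ≤ (k / 2 ^ k) ^ 2 := pow_le_pow_left₀ ky0 ky 2
      _ ≤ _ := by
        rw [div_pow, div_mul_div_comm, one_mul]
        rw [div_le_div_iff₀ (by positivity) (by positivity)]
        have e : (k:ℝ) ^ 2 * (2 ^ k * k ^ 6) = 2 ^ k * k ^ 8 := by ring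
        have e' : (1:ℝ) * (2 ^ k) ^ 2 = 2 ^ k * 2 ^ k := by ring
        rw [e, e']; gcongr
  have e4 : (4:ℝ) ^ k = 2 ^ k * 2 ^ k := by rw [← mul_pow]; norm_num
  have e5 : (k:ℝ) * y = 1 / 2 ^ k * (k - 1 / (k:ℝ) ^ 2) := by
    rw [hy]; field_simp
  unfold bet
  rw [← hy, mul_pow, one_div_pow]
  have h3 : (1 - y) ^ k ≤ 1 - 1 / 2 ^ k * (k - 1 / (k:ℝ) ^ 2 - 1 / (k:ℝ) ^ 6) := by
    rw [e5] at h1; linarith [e5 ▸ h2]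
  calc 1 / 2 ^ k * (1 - y) ^ k ≤ 1 / 2 ^ k * (1 - 1 / 2 ^ k * (k - 1 / (k:ℝ) ^ 2 - 1 / (k:ℝ) ^ 6)) := by gcongr
    _ = _ := by
      have : (1:ℝ) / 4 ^ k = 1 / 2 ^ k * (1 / 2 ^ k) := by rw [e4]; field_simp
      rw [this]; ring
end

section
/-! Part D7: whp lower bound on the conditional expectation of `Zp` -/

set_option maxHeartbeats 1000000 in
lemma final_arith (q k c n m r ε H G A : ℝ) (hk : 10 ^ 4 ≤ k) (hc : c = 1 / k) (hq : 1 ≤ q) (hn : 0 ≤ n) (hm0 : 0 ≤ m)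
    (hm : m ≤ r * n) (hr : r ≤ q * Real.log 2) (hε : ε = 1 / (40 * k * (q * q)))
    (hH : n * Real.log 2 - A / (q * q) / 2 * (1 + 5 / k ^ 8) ≤ H)
    (hA : A ≤ m * k + ε * n)
    (hG : G ≤ m * (1 / q - 1 / (q * q) * (k - 1 / k ^ 2 - 1 / k ^ 6)) + ε * n) :
    n / q * ((q * Real.log 2 - r) - Real.log 2 / 2 - 1 / k) ≤
      H - (G + m * (1 / (q * q) * ((k + 1) / 2 + 1 / k))) - ε * n - ε * m := by
  have hk0 : 0 < k := by linarith
  have hq0 : 0 < q := by linarith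
  have c0 : 0 < c := by rw [hc]; positivity
  have c1 : c ≤ 1 / 10 ^ 4 := by rw [hc]; exact one_div_le_one_div_of_le (by norm_num) hk
  obtain ⟨p, hp⟩ : ∃ p, p = 1 / q := ⟨_, rfl⟩
  have p0 : 0 < p := by rw [hp]; positivity
  have p1 : p ≤ 1 := by rw [hp, div_le_one hq0]; exact hq
  have hpq : p * q = 1 := by rw [hp]; field_simp
  have hck : c * k = 1 := by rw [hc]; field_simp
  have eqq : 1 / (q * q) = p * p := by rw [hp]; field_simp
  have e8 : 5 / k ^ 8 = 5 * c ^ 8 := by rw [hc]; field_simp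
  have e2 : 1 / k ^ 2 = c ^ 2 := by rw [hc]; field_simp
  have e6 : 1 / k ^ 6 = c ^ 6 := by rw [hc]; field_simp
  have eε : ε = 1 / 40 * c * (p * p) := by rw [hε, hc, hp]; field_simp
  have eA : A / (q * q) = A * (p * p) := by rw [← eqq]; ring
  rw [eA, e8] at hH
  rw [← hp, eqq, e2, e6] at hG
  rw [eqq, ← hc]
  have en : n / q = n * p := by rw [hp]; ring
  rw [en]
  have ε0 : 0 < ε := by rw [eε]; positivity
  have l1 := Real.log_two_gt_d9
  have l2 := Real.log_two_lt_d9
  generalize Real.log 2 = L at *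
  -- A term
  have pp : p * p ≤ p := by nlinarith only [p0, p1]
  have c8 : c ^ 8 ≤ c := by
    calc c ^ 8 ≤ c ^ 1 := pow_le_pow_of_le_one c0.le (by linarith) (by norm_num)
      _ = c := pow_one c
  have hA1 : A * (p * p) / 2 * (1 + 5 * c ^ 8) ≤ (m * k + ε * n) * (p * p) / 2 * (1 + 5 * c ^ 8) := by
    have : 0 ≤ 1 + 5 * c ^ 8 := by positivity
    gcongr
  have hA2 : (m * k + ε * n) * (p * p) / 2 * (1 + 5 * c ^ 8) = m * (p * p) * (k / 2 + 5 / 2 * c ^ 7) + ε * n * ((p * p) * (1 + 5 * c ^ 8) / 2) := by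
    have : k * c ^ 8 = c ^ 7 := by
      calc k * c ^ 8 = (c * k) * c ^ 7 := by ring
        _ = _ := by rw [hck, one_mul]
    linear_combination (5 / 2 * m * (p * p)) * this
  have hA3 : ε * n * ((p * p) * (1 + 5 * c ^ 8) / 2) ≤ ε * n * 1 := by
    have : (p * p) * (1 + 5 * c ^ 8) / 2 ≤ 1 := by
      have h1 : (p * p) * (1 + 5 * c ^ 8) ≤ 1 * 2 := mul_le_mul (by linarith) (by linarith) (by positivity) (by norm_num)
      linarith
    have : 0 ≤ ε * n := by positivity
    gcongr
  have hS : c ^ 2 + c ^ 6 + 5 / 2 * c ^ 7 ≤ 1 / 10 * c := by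
    have h2 : c ^ 2 ≤ c * (1 / 10 ^ 4) := by rw [sq]; gcongr
    have h6 : c ^ 6 ≤ c ^ 2 := pow_le_pow_of_le_one c0.le (by linarith) (by norm_num)
    have h7 : c ^ 7 ≤ c ^ 2 := pow_le_pow_of_le_one c0.le (by linarith) (by norm_num)
    linarith
  have hmpp : 0 ≤ m * (p * p) := by positivity
  have hS2 := mul_le_mul_of_nonneg_left hS hmpp
  -- m terms
  have hmp : m * p ≤ r * n * p := by gcongr
  have hrp : r * p ≤ L := by
    calc r * p ≤ q * L * p := by gcongr
      _ = (p * q) * L := by ring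
      _ = L := by rw [hpq, one_mul]
  have hmpL : m * p ≤ n * L := by nlinarith only [hmp, mul_le_mul_of_nonneg_left hrp hn]
  have hmpp2 : m * (p * p) ≤ n * L * p := by nlinarith only [mul_le_mul_of_nonneg_right hmpL p0.le]
  have h11 : m * (p * p) * (1 / 2 + 11 / 10 * c) ≤ n * L * p * (1 / 2 + 11 / 10 * c) := by
    have : 0 ≤ 1 / 2 + 11 / 10 * c := by positivity
    gcongr
  have hεm : ε * m ≤ 1 / 40 * c * (n * p) := by
    rw [eε]
    have : m * (p * p) ≤ n * p := by nlinarith only [hmpp2, mul_nonneg hn p0.le, l2]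
    nlinarith only [mul_le_mul_of_nonneg_left this c0.le]
  have hεn : ε * n ≤ 1 / 40 * c * (n * p) := by
    rw [eε]
    have : n * (p * p) ≤ n * p := by gcongr
    nlinarith only [mul_le_mul_of_nonneg_left this c0.le]
  have hnpc : 0 ≤ n * p * c := by positivity
  have hfin : n * L * p * (11 / 10 * c) ≤ n * p * c * (8 / 10) := by nlinarith only [hnpc, l2]
  have t1 : n * p * (q * L - r - L / 2 - c) = n * L - r * n * p - n * L * p * (1 / 2) - n * p * c := by
    linear_combination (n * L) * hpq
  rw [t1]
  ring_nf at hH hG hA1 hA2 hA3 hS2 hmp h11 hεm hεn hnpc hfin ⊢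
  linarith only [hH, hG, hA1, hA2, hA3, hS2, hmp, h11, hεm, hεn, hnpc, hfin]

lemma whp_Zp {k : ℕ} (hk : 10 ^ 4 ≤ k) (h2k : (k:ℝ) ^ 8 ≤ 2 ^ k) (hb : (bb k : ℝ) / 2 ^ k ≤ 1 / (k:ℝ) ^ 4) {r : ℝ}
    (hr1 : 1 ≤ r) (hrl : (2:ℝ) ^ k / 2 ≤ r) (hru : r ≤ 2 ^ k * Real.log 2) :
    WHP k r (fun n Φ => Real.exp ((n:ℝ) / 2 ^ k * ((2 ^ k * Real.log 2 - r) - Real.log 2 / 2 - 1 / k)) ≤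
      expOver (formulaClass n k ⌊r * n⌋₊ (degSeq n k ⌊r * n⌋₊ Φ) (typeCounts n k ⌊r * n⌋₊ Φ))
        (fun Ψ => (Zp 2 n k ⌊r * n⌋₊ (degSeq n k ⌊r * n⌋₊ Φ) Ψ : ℝ))) := by
  have hK : (10 ^ 4 : ℝ) ≤ k := by exact_mod_cast hk
  have hk0 : (0:ℝ) < k := by linarith
  have hk1 : 1 ≤ k := by omega
  have hr0 : 0 ≤ r := by linarith
  obtain ⟨ε, hε⟩ : ∃ ε : ℝ, ε = 1 / (40 * k * (2 ^ k * 2 ^ k)) := ⟨_, rfl⟩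
  have ε0 : 0 < ε := by rw [hε]; positivity
  obtain ⟨γ1, hγ1, W1⟩ := whp_NabKK hk1 hr1
  obtain ⟨γ2, hγ2, W2⟩ := whp_types hk1 hr1
  obtain ⟨hb0, hbp⟩ := bet_pow hk h2k
  have W3 := CS_upper hk1 hr1 gc gc_mem (bet k) hb0 (whp_SS_gc hk h2k hb hr1 hrl hru) ε ε0
  have W4 := whp_AA hk hr0 hru ε ε0
  have W5 := whp_P2 (k := k) hr0
  obtain ⟨N0, hN0⟩ := class_main (k := k) (by omega) h2k hb (min γ1 γ2) ε (lt_min hγ1 hγ2) ε0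
  refine (W1.and (W2.and (W3.and (W4.and W5)))).mono ?_
  filter_upwards [eventually_ge_atTop N0] with n hn Φ h
  obtain ⟨h1, h2, h3, h4, h5⟩ := h
  have hm : N0 ≤ ⌊r * n⌋₊ := by
    have := le_floor_mul hr1 n
    have : n ≤ ⌊r * (n:ℝ)⌋₊ := by exact_mod_cast this
    omega
  refine le_trans (Real.exp_le_exp.2 ?_) (hN0 n ⌊r * n⌋₊ hn hm Φ
    (fun q hq => le_trans (mul_le_mul_of_nonneg_right (min_le_left _ _) (by positivity)) (h1 q hq)) h5
    (fun l hl => le_trans (mul_le_mul_of_nonneg_right (min_le_right _ _) (by positivity)) (h2 l hl)))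
  rw [CS_gc hk hb] at h3
  have e4 : (4:ℝ) ^ k = 2 ^ k * 2 ^ k := by rw [← mul_pow]; norm_num
  have hH := sum_entropy hk hb Φ
  rw [e4] at hH hbp
  have hA := h4.2
  rw [Nat.cast_mul] at hA
  have hG : ∑ i, pi0 (clauseType k (degSeq n k ⌊r * n⌋₊ Φ) (Φ i)) ≤
      (⌊r * n⌋₊ : ℝ) * (1 / 2 ^ k - 1 / (2 ^ k * 2 ^ k) * (k - 1 / (k:ℝ) ^ 2 - 1 / (k:ℝ) ^ 6)) + ε * n :=
    h3.trans (by gcongr)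
  have hf := final_arith (2 ^ k) k (1 / k) n ⌊r * n⌋₊ r ε _ _ _ hK rfl (one_le_pow₀ (by norm_num)) (by positivity) (by positivity)
    (floor_le_mul hr0 n) hru hε hH hA hG
  refine hf.trans (le_of_eq ?_)
  rw [Finset.sum_add_distrib]
  congr 3
  simp only [Finset.sum_const, Finset.card_univ, Fintype.card_fin, nsmul_eq_mul, kap]
  rw [one_div_pow, e4]
end

section
/-! Part E: assembly -/

lemma tower_gen {α β : Type*} [Fintype α] (f : α → β) (Y : α → ℝ) :
    ∑ a, (∑ b ∈ univ.filter (fun b => f b = f a), Y b) / ((univ.filter (fun b => f b = f a)).card : ℝ) =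
      ∑ b, Y b := by
  simp_rw [Finset.sum_div, Finset.sum_filter]
  rw [Finset.sum_comm]
  refine Finset.sum_congr rfl fun b _ => ?_
  have e : ∀ a, (if f b = f a then Y b / ((univ.filter (fun b => f b = f a)).card : ℝ) else 0) =
      if f a = f b then Y b / ((univ.filter (fun c => f c = f b)).card : ℝ) else 0 := by
    intro a
    by_cases h : f a = f b
    · simp [h]
    · simp [h, Ne.symm h]
  simp_rw [e]
  rw [← Finset.sum_filter, Finset.sum_const, nsmul_eq_mul]
  have : ((univ.filter (fun c => f c = f b)).card : ℝ) ≠ 0 := by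
    have : 0 < (univ.filter (fun c => f c = f b)).card := Finset.card_pos.2 ⟨b, by simp⟩
    positivity
  field_simp

lemma class_eq {n k m : ℕ} (Φ : Formula n k m) :
    formulaClass n k m (degSeq n k m Φ) (typeCounts n k m Φ) =
      univ.filter (fun Ψ => (degSeq n k m Ψ, typeCounts n k m Ψ) = (degSeq n k m Φ, typeCounts n k m Φ)) := by
  unfold formulaClass
  ext Ψ
  simp only [Finset.mem_filter, Finset.mem_univ, true_and, Prod.mk.injEq]
  constructor
  · rintro ⟨h1, h2⟩
    refine ⟨h1, funext fun ℓ => ?_⟩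
    rw [← h2 ℓ]; unfold typeCounts; rw [h1]
  · rintro ⟨h1, h2⟩
    refine ⟨h1, fun ℓ => ?_⟩
    rw [← h2]; unfold typeCounts; rw [h1]

def cE {n k m : ℕ} (Φ : Formula n k m) (Y : Formula n k m → ℝ) : ℝ :=
  expOver (formulaClass n k m (degSeq n k m Φ) (typeCounts n k m Φ)) Y

lemma tower {n k m : ℕ} (Y : Formula n k m → ℝ) : expF n k m (fun Φ => cE Φ Y) = expF n k m Y := by
  unfold expF cE expOver
  congr 1
  have := tower_gen (fun Ψ : Formula n k m => (degSeq n k m Ψ, typeCounts n k m Ψ)) Y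
  rw [← this]
  refine Finset.sum_congr rfl fun Φ _ => ?_
  simp only [class_eq]
  congr!

lemma cE_mono {n k m : ℕ} (Φ : Formula n k m) {Y Y' : Formula n k m → ℝ} (h : ∀ Ψ, Y Ψ ≤ Y' Ψ) :
    cE Φ Y ≤ cE Φ Y' := by
  unfold cE expOver; gcongr with Ψ; exact h Ψ

lemma cE_add {n k m : ℕ} (Φ : Formula n k m) (Y Y' : Formula n k m → ℝ) :
    cE Φ (fun Ψ => Y Ψ + Y' Ψ) = cE Φ Y + cE Φ Y' := by
  unfold cE expOver; rw [Finset.sum_add_distrib, add_div]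

lemma cE_nonneg {n k m : ℕ} (Φ : Formula n k m) {Y : Formula n k m → ℝ} (h : ∀ Ψ, 0 ≤ Y Ψ) :
    0 ≤ cE Φ Y := by
  unfold cE expOver
  exact div_nonneg (Finset.sum_nonneg fun Ψ _ => h Ψ) (by positivity)

lemma card_satF {n k m : ℕ} (σ : Assignment n) :
    ((univ.filter fun Φ : Formula n k m => Satisfies σ Φ).card : ℝ) = ((2 ^ k - 1) * (n : ℝ) ^ k) ^ m := by
  have : (univ.filter fun Φ : Formula n k m => Satisfies σ Φ) =
      Fintype.piFinset (fun _ : Fin m => univ.filter fun C : Clause n k => satC σ C) := by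
    ext Φ
    simp only [Fintype.mem_piFinset, Finset.mem_filter, Finset.mem_univ, true_and]
    rfl
  rw [this, Fintype.card_piFinset]
  push_cast
  rw [Finset.prod_const, card_sat]; simp

lemma expF_satCount {n k m : ℕ} (hn : 1 ≤ n) :
    expF n k m (fun Φ => (satCount n k m Φ : ℝ)) = 2 ^ n * (1 - 1 / 2 ^ k) ^ m := by
  have hn' : (0:ℝ) < n := by exact_mod_cast hn
  have e1 : ∑ Φ : Formula n k m, (satCount n k m Φ : ℝ) =
      ∑ σ : Assignment n, ((univ.filter fun Φ : Formula n k m => Satisfies σ Φ).card : ℝ) := by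
    unfold satCount satSet
    simp_rw [Finset.card_filter]
    push_cast
    rw [Finset.sum_comm]
  unfold expF
  rw [e1]
  simp_rw [card_satF]
  rw [Finset.sum_const, card_Formula, nsmul_eq_mul, Finset.card_univ]
  have e2 : (1 - 1 / 2 ^ k : ℝ) = ((2 ^ k - 1) * (n : ℝ) ^ k) / (2 * n) ^ k := by
    rw [mul_pow]; field_simp
  rw [e2, div_pow]
  simp [mul_div_assoc]

lemma exp_lin_tendsto {c : ℝ} (hc : 0 < c) (A B : ℝ) :
    Tendsto (fun n : ℕ => (A + B * (n:ℝ)) * Real.exp (-(n * c))) atTop (nhds 0) := by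
  have h1 : Tendsto (fun n : ℕ => (n:ℝ) ^ 1 * (Real.exp (-c)) ^ n) atTop (nhds 0) :=
    tendsto_pow_mul_geom 1 _ (Real.exp_pos _).le (by rw [Real.exp_lt_one_iff]; linarith)
  have h0 : Tendsto (fun n : ℕ => (n:ℝ) ^ 0 * (Real.exp (-c)) ^ n) atTop (nhds 0) :=
    tendsto_pow_mul_geom 0 _ (Real.exp_pos _).le (by rw [Real.exp_lt_one_iff]; linarith)
  have h := (h0.const_mul A).add (h1.const_mul B)
  simp only [mul_zero, add_zero] at h
  refine h.congr fun n => ?_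
  have : Real.exp (-(n * c)) = Real.exp (-c) ^ n := by rw [← Real.exp_nat_mul]; congr 1; ring
  rw [this]; ring

section
variable {k : ℕ} {r : ℝ}

lemma del_gt (hk : 10 ^ 4 ≤ k) : 1 / (k:ℝ) < del k := by
  have h0 := del_pos (by omega : 1 ≤ k)
  have h1 := del_le hk
  rw [← del_pow4]
  have h3 : del k ^ 3 < 1 := pow_lt_one₀ h0.le (by linarith) (by norm_num)
  calc del k ^ 4 = del k ^ 3 * del k := by ring
    _ < 1 * del k := by gcongr
    _ = del k := one_mul _

lemma whp_upper (K : KB k) (hr : rbal k < r) (hr2 : r < 2 ^ k * Real.log 2 - (3/2) * Real.log 2 - del k) :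
    WHP k r (fun n Φ => cE Φ (fun Ψ => (satCount n k ⌊r * n⌋₊ Ψ : ℝ)) ≤
      Real.exp ((n:ℝ) / 2 ^ k * ((2 ^ k * Real.log 2 - r) - Real.log 2 / 2 + del k))) := by
  have hd : 0 < del k - 1 / k := by linarith [del_gt K.h4]
  have hc : 0 < (del k - 1 / k) / 2 ^ k := by positivity
  refine WHP.of_bound (fun n : ℕ => (2 + 0 * (n:ℝ)) * Real.exp (-(n * ((del k - 1 / k) / 2 ^ k)))) ?_
    (exp_lin_tendsto hc 2 0)
  filter_upwards [eventually_ge_atTop 1] with n hn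
  set T := Real.exp ((n:ℝ) / 2 ^ k * ((2 ^ k * Real.log 2 - r) - Real.log 2 / 2 + del k)) with hT
  have hTp : 0 < T := Real.exp_pos _
  refine (prF_mono (fun Φ h => (not_le.1 h).le)).trans
    ((markovF (fun Φ => cE Φ (fun Ψ => (satCount n k ⌊r * n⌋₊ Ψ : ℝ)))
      (fun Φ => cE_nonneg Φ fun Ψ => by positivity) T hTp).trans ?_)
  rw [tower, expF_satCount hn, div_le_iff₀ hTp]
  refine (EZ_bound K hr hr2 n).trans (le_of_eq ?_)
  rw [hT, mul_assoc, ← Real.exp_add, zero_mul, add_zero]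
  congr 2; ring

def Ybad {n m : ℕ} (k : ℕ) (L : ℝ) (Φ : Formula n k m) : ℝ :=
  ((univ.filter fun σ : Assignment n => Satisfies σ Φ ∧ L < clusterSize n k _ Φ σ).card : ℝ)

def LZp (k : ℕ) (r : ℝ) (n : ℕ) : ℝ :=
  Real.exp ((n:ℝ) / 2 ^ k * ((2 ^ k * Real.log 2 - r) - Real.log 2 / 2 - 1 / k))

lemma whp_bad (K : KB k) (hr : rbal k < r) (hr2 : r < 2 ^ k * Real.log 2 - (3/2) * Real.log 2 - del k) :
    WHP k r (fun n Φ => cE Φ (Ybad k (LZp k r n)) ≤ LZp k r n / 2) := by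
  have hk : (10000:ℝ) ≤ k := by exact_mod_cast K.h4
  have hk0 : (0:ℝ) < k := by linarith
  have hc : 0 < (3 / (k:ℝ)) / 2 ^ k := by positivity
  refine WHP.of_bound (fun n : ℕ => (36 + 24 * (n:ℝ)) * Real.exp (-(n * ((3 / (k:ℝ)) / 2 ^ k)))) ?_
    (exp_lin_tendsto hc 36 24)
  filter_upwards [eventually_ge_atTop 1] with n hn
  have hLp : 0 < LZp k r n := Real.exp_pos _
  have hTp : 0 < LZp k r n / 2 := by linarith
  refine (prF_mono (fun Φ h => (not_le.1 h).le)).trans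
    ((markovF (fun Φ => cE Φ (Ybad k (LZp k r n)))
      (fun Φ => cE_nonneg Φ fun Ψ => by unfold Ybad; positivity) _ hTp).trans ?_)
  rw [tower, div_le_iff₀ hTp]
  have h := cluster_final K hr hr2 n hn (LZp k r n) rfl
  have hcard : (0:ℝ) < Fintype.card (Formula n k ⌊r * n⌋₊) := by
    rw [card_Formula]; have : 0 < n := hn
    positivity
  unfold expF Ybad
  rw [div_le_iff₀ hcard]
  refine h.trans (le_of_eq ?_)
  have : (n:ℝ) * (3 / k / 2 ^ k) = n / 2 ^ k * (3 / k) := by ring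
  rw [this]; ring

lemma Zgood_le {n m : ℕ} (d : Lit n → ℕ) (mv : (Fin k → ℝ) → ℕ) (Ψ : Formula n k m) :
    (Zgood 2 n k m d mv Ψ : ℝ) ≤ satCount n k m Ψ := by
  unfold Zgood satCount satSet
  norm_cast
  refine Finset.card_le_card fun σ h => ?_
  simp only [Finset.mem_filter, Finset.mem_univ, true_and] at h ⊢
  exact h.1

lemma Zp_le {n m : ℕ} (d : Lit n → ℕ) (mv : (Fin k → ℝ) → ℕ) (L : ℝ)
    (hL : L ≤ expOver (formulaClass n k m d mv) fun Ψ => (Zp 2 n k m d Ψ : ℝ)) (Ψ : Formula n k m) :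
    (Zp 2 n k m d Ψ : ℝ) ≤ Zgood 2 n k m d mv Ψ + Ybad k L Ψ := by
  unfold Zp Zgood Ybad
  norm_cast
  refine (Finset.card_le_card fun σ h => ?_).trans (Finset.card_union_le _ _)
  simp only [Finset.mem_filter, Finset.mem_univ, true_and, Finset.mem_union] at h ⊢
  by_cases hg : Good 2 n k m d mv Ψ σ
  · exact Or.inl ⟨h.1, h.2, hg⟩
  · refine Or.inr ⟨h.1, lt_of_le_of_lt hL ?_⟩
    unfold Good at hg
    exact not_le.1 hg

lemma good_step {n m : ℕ} (Φ : Formula n k m) (L : ℝ)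
    (h1 : L ≤ expOver (formulaClass n k m (degSeq n k m Φ) (typeCounts n k m Φ))
      fun Ψ => (Zp 2 n k m (degSeq n k m Φ) Ψ : ℝ))
    (h2 : cE Φ (Ybad k L) ≤ L / 2) :
    L / 2 ≤ expOver (formulaClass n k m (degSeq n k m Φ) (typeCounts n k m Φ))
      (fun Ψ => (Zgood 2 n k m (degSeq n k m Φ) (typeCounts n k m Φ) Ψ : ℝ)) := by
  have h4 : cE Φ (fun Ψ => (Zp 2 n k m (degSeq n k m Φ) Ψ : ℝ)) ≤
      cE Φ (fun Ψ => (Zgood 2 n k m (degSeq n k m Φ) (typeCounts n k m Φ) Ψ : ℝ) + Ybad k L Ψ) :=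
    cE_mono Φ (fun Ψ => Zp_le (degSeq n k m Φ) (typeCounts n k m Φ) L h1 Ψ)
  rw [cE_add] at h4
  have h5 : L ≤ cE Φ (fun Ψ => (Zp 2 n k m (degSeq n k m Φ) Ψ : ℝ)) := h1
  have h7 : cE Φ (fun Ψ => Ybad k L Ψ) ≤ L / 2 := h2
  have h6 : L / 2 ≤ cE Φ (fun Ψ => (Zgood 2 n k m (degSeq n k m Φ) (typeCounts n k m Φ) Ψ : ℝ)) := by
    linarith
  exact h6

lemma final_whp (K : KB k) (h8 : (k:ℝ) ^ 8 ≤ 2 ^ k) (hb : (bb k:ℝ) / 2 ^ k ≤ 1 / (k:ℝ) ^ 4)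
    (hr : rbal k < r) (hr2 : r < 2 ^ k * Real.log 2 - (3/2) * Real.log 2 - del k) :
    WHP k r (fun n Φ =>
      Real.exp (((n : ℝ) / 2 ^ k) * ((2 ^ k * Real.log 2 - r) - Real.log 2 / 2 - del k)) ≤
        expOver (formulaClass n k ⌊r * n⌋₊ (degSeq n k ⌊r * n⌋₊ Φ) (typeCounts n k ⌊r * n⌋₊ Φ))
          (fun Ψ => (Zgood 2 n k ⌊r * n⌋₊ (degSeq n k ⌊r * n⌋₊ Φ) (typeCounts n k ⌊r * n⌋₊ Φ) Ψ : ℝ)) ∧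
      expOver (formulaClass n k ⌊r * n⌋₊ (degSeq n k ⌊r * n⌋₊ Φ) (typeCounts n k ⌊r * n⌋₊ Φ))
          (fun Ψ => (Zgood 2 n k ⌊r * n⌋₊ (degSeq n k ⌊r * n⌋₊ Φ) (typeCounts n k ⌊r * n⌋₊ Φ) Ψ : ℝ)) ≤
      Real.exp (((n : ℝ) / 2 ^ k) * ((2 ^ k * Real.log 2 - r) - Real.log 2 / 2 + del k))) := by
  obtain ⟨f1, f2, f3⟩ := r_facts K hr hr2
  have h2k : (0:ℝ) < 2 ^ k := by positivity
  have hrl : (2:ℝ) ^ k / 2 ≤ r := by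
    have := K.c2
    have l2 := Real.log_two_gt_d9
    have : (1/2:ℝ) ≤ r / 2 ^ k := by linarith
    rw [le_div_iff₀ h2k] at this; linarith
  have hru : r ≤ 2 ^ k * Real.log 2 := by
    rw [div_le_iff₀ h2k] at f2; linarith
  have w := (whp_Zp K.h4 h8 hb f3 hrl hru).and ((whp_bad K hr hr2).and (whp_upper K hr hr2))
  have hd : 0 < del k - 1 / k := by linarith [del_gt K.h4]
  have hc : 0 < (del k - 1 / k) / 2 ^ k := by positivity
  have ev : ∀ᶠ n : ℕ in atTop, (2 + 0 * (n:ℝ)) * Real.exp (-(n * ((del k - 1 / k) / 2 ^ k))) ≤ 1 :=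
    (exp_lin_tendsto hc 2 0).eventually_le_const one_pos
  refine w.mono ?_
  filter_upwards [ev] with n hn Φ hΦ
  obtain ⟨h1, h2, h3⟩ := hΦ
  constructor
  · have h6 := good_step Φ (LZp k r n) h1 h2
    refine le_trans ?_ h6
    have e : Real.exp (((n : ℝ) / 2 ^ k) * ((2 ^ k * Real.log 2 - r) - Real.log 2 / 2 - del k)) =
        LZp k r n * Real.exp (-(n * ((del k - 1 / k) / 2 ^ k))) := by
      unfold LZp
      rw [← Real.exp_add]; congr 1; ring
    rw [e]
    have hLp : 0 < LZp k r n := Real.exp_pos _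
    have hn' : Real.exp (-(n * ((del k - 1 / k) / 2 ^ k))) ≤ 1 / 2 := by linarith
    calc _ ≤ LZp k r n * (1 / 2) := by gcongr
      _ = _ := by ring
  · exact le_trans (cE_mono Φ (fun Ψ => Zgood_le _ _ Ψ)) h3

end

lemma k_conditions : ∀ᶠ k : ℕ in atTop, (k:ℝ) ^ 8 ≤ 2 ^ k ∧ (bb k:ℝ) / 2 ^ k ≤ 1 / (k:ℝ) ^ 4 := by
  have a := tendsto_pow_mul_geom 8 (1/2) (by norm_num) (by norm_num)
  have b := tendsto_pow_mul_geom 10 (1/2) (by norm_num) (by norm_num)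
  filter_upwards [a.eventually_le_const (show (0:ℝ) < 1 by norm_num),
    b.eventually_le_const (show (0:ℝ) < 1/100 by norm_num), eventually_ge_atTop 1] with k h1 h2 h3
  have hk : (0:ℝ) < k := by exact_mod_cast h3
  have h2k : (0:ℝ) < 2 ^ k := by positivity
  rw [one_div_pow, mul_one_div, div_le_iff₀ h2k] at h1 h2
  refine ⟨by linarith, ?_⟩
  have hb : (bb k : ℝ) ≤ 10 * Real.sqrt ((k : ℝ) * 2 ^ k * Real.log k) := Nat.floor_le (by positivity)
  have hl : Real.log k ≤ k := (Real.log_le_sub_one_of_pos hk).trans (by linarith)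
  rw [div_le_div_iff₀ h2k (by positivity), one_mul]
  have hs : Real.sqrt ((k : ℝ) * 2 ^ k * Real.log k) ≤ 2 ^ k / (10 * (k:ℝ) ^ 4) := by
    rw [Real.sqrt_le_left (by positivity), div_pow, le_div_iff₀ (by positivity)]
    calc (k:ℝ) * 2 ^ k * Real.log k * (10 * (k:ℝ) ^ 4) ^ 2
        ≤ (k:ℝ) * 2 ^ k * k * (10 * (k:ℝ) ^ 4) ^ 2 := by gcongr
      _ = 2 ^ k * (100 * (k:ℝ) ^ 10) := by ring
      _ ≤ 2 ^ k * 2 ^ k := by gcongr; linarith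
      _ = _ := by ring
  calc (bb k : ℝ) * (k:ℝ) ^ 4 ≤ (10 * (2 ^ k / (10 * (k:ℝ) ^ 4))) * (k:ℝ) ^ 4 := by
        gcongr; linarith
    _ = 2 ^ k := by field_simp

lemma del_tendsto : Tendsto del atTop (nhds 0) :=
  (tendsto_rpow_neg_atTop (show (0:ℝ) < 1/4 by norm_num)).comp tendsto_natCast_atTop_atTop
end

/-- There are `k0`, a sequence `delta k → 0` and a judiciousness slack
`a > 0` such that for every `k ≥ k0` and density `r = 2^k ln 2 - ρ` with
`r_bal < r < 2^k ln 2 - (3/2) ln 2 - delta k`, whp the pair `(d, m)` satisfies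
`exp((n/2^k)(ρ - ln 2 / 2 - delta k)) ≤ E[Z_{p,good}(Φ_{d,m})] ≤
exp((n/2^k)(ρ - ln 2 / 2 + delta k))`. -/
theorem statement5 :
    ∃ (k0 : ℕ) (delta : ℕ → ℝ) (a : ℝ),
      Tendsto delta atTop (nhds 0) ∧ 0 < a ∧
      ∀ k : ℕ, k0 ≤ k →
        ∀ r : ℝ, rbal k < r →
          r < 2 ^ k * Real.log 2 - (3 / 2) * Real.log 2 - delta k →
          Tendsto
            (fun n : ℕ =>
              let m := ⌊r * (n : ℝ)⌋₊
              prF n k m fun Φ =>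
                let d := degSeq n k m Φ
                let mv := typeCounts n k m Φ
                let rho := 2 ^ k * Real.log 2 - r
                Real.exp (((n : ℝ) / 2 ^ k) * (rho - Real.log 2 / 2 - delta k)) ≤
                    expOver (formulaClass n k m d mv)
                      (fun Ψ => (Zgood a n k m d mv Ψ : ℝ)) ∧
                  expOver (formulaClass n k m d mv)
                      (fun Ψ => (Zgood a n k m d mv Ψ : ℝ)) ≤
                    Real.exp (((n : ℝ) / 2 ^ k) * (rho - Real.log 2 / 2 + delta k)))
            atTop (nhds 1) := by
  obtain ⟨k0, hk0⟩ := eventually_atTop.1 (KB_eventually.and k_conditions)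
  refine ⟨k0, del, 2, del_tendsto, two_pos, fun k hk r hr hr2 => ?_⟩
  obtain ⟨K, h8, hb⟩ := hk0 k hk
  have w := (final_whp K h8 hb hr hr2).const_sub 1
  rw [sub_zero] at w
  refine w.congr' ?_
  filter_upwards [eventually_ge_atTop 1] with n hn
  rw [prF_not hn, sub_sub_cancel]
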